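/- arXiv:2510.10590 — 4 statements merged into one kernel-verified Lean document; each statement's English description precedes it below -/
import Mathlib

section
/- For every positive odd integer r, the maximum of the Turán density π(F) over all r-uniform hypergraphs F with exactly three edges is strictly less than 1/2; that is, γ(r) < 1/2 for all odd r ≥ 1. -/
open Filter

/-- The degree of a vertex in a hypergraph given as a finite set of edges. -/
def hypDegree {V : Type*} [DecidableEq V] (F : Finset (Finset V)) (v : V) : ℕ :=
  (F.filter fun e => v ∈ e).card

/-- `H` contains a copy of `F`: a map injective on the vertex support of `F`
sending every edge of `F` to an edge of `H`. -/
def HasCopy {V W : Type*} [DecidableEq V] (H : Finset (Finset V))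
    (F : Finset (Finset W)) : Prop :=
  ∃ φ : W → V, Set.InjOn φ (⋃ e ∈ F, (e : Set W)) ∧ ∀ e ∈ F, e.image φ ∈ H

/-- `F` is isomorphic to `G` (as edge sets; isolated vertices are irrelevant). -/
def IsIsoTo {V W : Type*} [DecidableEq V] (F : Finset (Finset W))
    (G : Finset (Finset V)) : Prop :=
  ∃ φ : W → V, Set.InjOn φ (⋃ e ∈ F, (e : Set W)) ∧ F.image (fun e => e.image φ) = G

open scoped Classical in
/-- The Turán number `ex(n, F)`: the maximum number of edges of an `F`-free
`r`-uniform hypergraph on `n` vertices. -/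
noncomputable def exNum (r n : ℕ) {m : ℕ} (F : Finset (Finset (Fin m))) : ℕ :=
  ((Finset.univ : Finset (Finset (Finset (Fin n)))).filter fun H =>
    (∀ e ∈ H, e.card = r) ∧ ¬ HasCopy H F).sup Finset.card

/-- The Turán density `π(F) = lim_{n → ∞} ex(n,F) / C(n,r)` (the limit exists). -/
noncomputable def turanDensity (r : ℕ) {m : ℕ} (F : Finset (Finset (Fin m))) : ℝ :=
  limUnder atTop fun n : ℕ => (exNum r n F : ℝ) / (n.choose r : ℝ)

/-- `γ(r)`: the maximum Turán density of an `r`-uniform hypergraph with exactly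
three edges. -/
noncomputable def gammaT (r : ℕ) : ℝ :=
  sSup {x : ℝ | ∃ (m : ℕ) (F : Finset (Finset (Fin m))),
    (∀ e ∈ F, e.card = r) ∧ F.card = 3 ∧ turanDensity r F = x}

/-- The expanded triangle `T_{2k}` on `3k` vertices: three pairwise disjoint
`k`-sets `S 0, S 1, S 2`, with edges `S 0 ∪ S 1`, `S 1 ∪ S 2`, `S 2 ∪ S 0`. -/
def expTriangle (k : ℕ) : Finset (Finset (Fin (3 * k))) :=
  let S : ℕ → Finset (Fin (3 * k)) :=
    fun a => Finset.univ.filter fun v => a * k ≤ v.val ∧ v.val < (a + 1) * k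
  {S 0 ∪ S 1, S 1 ∪ S 2, S 2 ∪ S 0}

/-- The suspension of a hypergraph: add the same set of `t` new cone vertices
to every edge.  For an `s`-graph `F`, the `r`-suspension `F̂^r` is `suspend (r - s) F`. -/
def suspend {m : ℕ} (t : ℕ) (F : Finset (Finset (Fin m))) :
    Finset (Finset (Fin (m + t))) :=
  F.image fun e =>
    e.image (Fin.castAdd t) ∪ Finset.univ.filter fun v : Fin (m + t) => m ≤ v.val

namespace OddMantel
open Finset

lemma image_swap_eq {Q : Type*} [DecidableEq Q] (E : Finset Q) (u v : Q) (h : u ∈ E ↔ v ∈ E)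
    (σ : Equiv.Perm Q) : E.image (σ * Equiv.swap u v) = E.image σ := by
  have : E.image (Equiv.swap u v) = E := by
    ext a
    simp only [mem_image]
    constructor
    · rintro ⟨b, hb, rfl⟩
      rcases Equiv.swap_apply_eq_iff.mp (rfl : Equiv.swap u v b = _) with _
      by_cases h1 : b = u
      · subst h1; simpa using h.mp hb
      · by_cases h2 : b = v
        · subst h2; simpa using h.mpr hb
        · rwa [Equiv.swap_apply_of_ne_of_ne h1 h2]
    · intro ha
      refine ⟨Equiv.swap u v a, ?_, by simp⟩
      by_cases h1 : a = u
      · subst h1; simpa using h.mp ha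
      · by_cases h2 : a = v
        · subst h2; simpa using h.mpr ha
        · rwa [Equiv.swap_apply_of_ne_of_ne h1 h2]
  conv_rhs => rw [← this]
  rw [image_image]; rfl

lemma exists_perm {Q : Type*} [Fintype Q] [DecidableEq Q] (E E' : Finset Q) (h : E.card = E'.card) :
    ∃ σ : Equiv.Perm Q, E.image σ = E' := by
  have e : {x // x ∈ E} ≃ {x // x ∈ E'} := Fintype.equivOfCardEq (by simpa using h)
  refine ⟨e.extendSubtype, ?_⟩
  apply Finset.eq_of_subset_of_card_le
  · intro a ha
    obtain ⟨b, hb, rfl⟩ := mem_image.mp ha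
    exact e.extendSubtype_mem b hb
  · rw [card_image_of_injective _ (Equiv.injective _), h]

lemma parity_zero {Q : Type*} [Fintype Q] [DecidableEq Q] (E0 E1 E2 : Finset Q) (x : Q)
    (hx0 : x ∈ E0) (hx1 : x ∈ E1) (hx2 : x ∈ E2)
    (h0 : ∀ s, s ∉ E0 → s ∈ E1 ∧ s ∈ E2)
    (hc1 : E0.card = E1.card) (hc2 : E0.card = E2.card) (g : Finset Q → ZMod 2)
    (h : ∀ σ : Equiv.Perm Q, g (E0.image σ) + g (E1.image σ) + g (E2.image σ) = 0) :
    g E0 = 0 := by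
  have hs : ∀ (σ : Equiv.Perm Q) (s : Q), s ∉ E0 →
      g (E0.image (σ * Equiv.swap s x)) = g (E0.image σ) := by
    intro σ s hs
    have a := h σ
    have b := h (σ * Equiv.swap s x)
    rw [image_swap_eq E1 s x (by simp [hx1, h0 s hs]), image_swap_eq E2 s x (by simp [hx2, h0 s hs])] at b
    rw [← a] at b
    simpa using b
  have hs2 : ∀ (σ : Equiv.Perm Q) (u v : Q), u ∉ E0 → v ∈ E0 →
      g (E0.image (σ * Equiv.swap u v)) = g (E0.image σ) := by
    intro σ u v hu hv
    by_cases hvx : v = x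
    · subst hvx; exact hs σ u hu
    · have hux : u ≠ x := fun h => hu (h ▸ hx0)
      have huv : u ≠ v := fun h => hu (h ▸ hv)
      have : Equiv.swap u v = Equiv.swap x v * Equiv.swap u x * Equiv.swap x v := by
        rw [Equiv.swap_mul_swap_mul_swap (x := u) (y := x) (z := v) hux huv, Equiv.swap_comm]
      rw [this, ← mul_assoc, image_swap_eq E0 x v (by simp [hx0, hv]), ← mul_assoc, hs _ u hu,
        image_swap_eq E0 x v (by simp [hx0, hv])]
  have hs3 : ∀ (σ : Equiv.Perm Q) (u v : Q),
      g (E0.image (σ * Equiv.swap u v)) = g (E0.image σ) := by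
    intro σ u v
    by_cases hu : u ∈ E0 <;> by_cases hv : v ∈ E0
    · rw [image_swap_eq E0 u v (by simp [hu, hv])]
    · rw [Equiv.swap_comm]; exact hs2 σ v u hv hu
    · exact hs2 σ u v hu hv
    · rw [image_swap_eq E0 u v (by simp [hu, hv])]
  have hall : ∀ σ τ : Equiv.Perm Q, g (E0.image (τ * σ)) = g (E0.image τ) := by
    intro σ
    induction σ using Equiv.Perm.swap_induction_on with
    | one => intro τ; simp
    | swap_mul f u v huv ih => intro τ; rw [← mul_assoc, ih, hs3]
  obtain ⟨σ1, h1⟩ := exists_perm E0 E1 hc1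
  obtain ⟨σ2, h2⟩ := exists_perm E0 E2 hc2
  have e1 := hall σ1 1
  have e2 := hall σ2 1
  have e0 := h 1
  simp only [one_mul, h1, h2, Equiv.Perm.coe_one, image_id] at e0 e1 e2
  rw [e1, e2] at e0
  clear e1 e2
  generalize g E0 = c at *
  revert c; decide

lemma goodman {A S : Type*} [Fintype A] [Fintype S] (f : A → S → S → ℝ)
    (hsym : ∀ a s t, f a s t = f a t s) (P T O : ℝ)
    (hP : P = ∑ a, ∑ s, ∑ t, f a s t)
    (hT : T = ∑ a, ∑ s, ∑ t, ∑ u, f a s t * f a s u * f a t u)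
    (hO : O = ∑ a, ∑ s, ∑ t, ∑ u, (f a s t + f a s u + f a t u
      - 2 * (f a s t * f a s u + f a s t * f a t u + f a s u * f a t u)
      + 4 * (f a s t * f a s u * f a t u))) :
    O ≤ 3 * Fintype.card S * P - 6 * (P ^ 2 / (Fintype.card A * Fintype.card S)) + 4 * T := by
  set C : ℝ := ∑ a, ∑ s, (∑ t, f a s t) ^ 2 with hC
  have hPC : P ^ 2 / (Fintype.card A * Fintype.card S) ≤ C := by
    have h1 : P = ∑ x : A × S, ∑ t, f x.1 x.2 t := by rw [hP, Fintype.sum_prod_type]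
    have h2 : C = ∑ x : A × S, (∑ t, f x.1 x.2 t) ^ 2 := by rw [hC, Fintype.sum_prod_type]
    have h3 := sq_sum_le_card_mul_sum_sq (s := (univ : Finset (A × S)))
      (f := fun x => ∑ t, f x.1 x.2 t)
    rw [← h1, ← h2] at h3
    simp only [card_univ, Fintype.card_prod, Nat.cast_mul] at h3
    have hC0 : 0 ≤ C := by rw [hC]; positivity
    exact div_le_of_le_mul₀ (by positivity) hC0 (by linarith)
  have c1 : ∑ a, ∑ s, ∑ t, ∑ u, f a s t * f a s u = C := by
    simp only [hC, sq, Finset.sum_mul_sum]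
  have c2 : ∑ a, ∑ s, ∑ t, ∑ u, f a s t * f a t u = C := by
    rw [← c1]
    refine sum_congr rfl fun a _ => ?_
    rw [sum_comm]
    refine sum_congr rfl fun s _ => sum_congr rfl fun t _ => sum_congr rfl fun u _ => ?_
    rw [hsym a t s]
  have c3 : ∑ a, ∑ s, ∑ t, ∑ u, f a s u * f a t u = C := by
    rw [← c2]
    refine sum_congr rfl fun a _ => sum_congr rfl fun s _ => ?_
    rw [sum_comm]
    refine sum_congr rfl fun t _ => sum_congr rfl fun u _ => ?_
    rw [hsym a t u]
  have l1 : ∑ a, ∑ s, ∑ t, ∑ u : S, f a s t = Fintype.card S * P := by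
    rw [hP]; simp [mul_sum]
  have l2 : ∑ a, ∑ s, ∑ t : S, ∑ u : S, f a s u = Fintype.card S * P := by
    rw [hP]; simp [mul_sum]
  have l3 : ∑ a, ∑ s : S, ∑ t : S, ∑ u : S, f a t u = Fintype.card S * P := by
    rw [hP]; simp [mul_sum]
  simp only [sum_add_distrib, sum_sub_distrib, ← mul_sum] at hO
  simp only [← mul_sum] at c1 c2
  rw [c1, c2, c3, l1, l2, l3, ← hT] at hO
  linarith

lemma blowup (t : ℕ) (ht : 0 < t) (q : ℕ) : ∀ δ : ℝ, 0 < δ → ∃ n0 : ℕ, ∀ n ≥ n0,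
    ∀ P : Finset (Fin q → Fin n), δ * (n : ℝ) ^ q ≤ P.card →
    ∃ T : Fin q → Fin t → Fin n, (∀ i, Function.Injective (T i)) ∧
      ∀ τ : Fin q → Fin t, (fun i => T i (τ i)) ∈ P := by
  induction q with
  | zero =>
    intro δ hδ
    refine ⟨0, fun n _ P hP => ?_⟩
    have : 0 < (P.card : ℝ) := lt_of_lt_of_le (by positivity) hP
    obtain ⟨p, hp⟩ := card_pos.mp (by exact_mod_cast this)
    refine ⟨fun i => i.elim0, fun i => i.elim0, fun τ => ?_⟩
    convert hp
  | succ q ih =>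
    intro δ hδ
    set c : ℝ := (δ / 2) * (δ / (4 * t)) ^ t with hc
    have hc0 : 0 < c := by positivity
    obtain ⟨n1, hn1⟩ := ih c hc0
    refine ⟨max n1 (max 1 ⌈4 * t / δ⌉₊), fun n hn P hP => ?_⟩
    have hnn1 : n1 ≤ n := le_trans (le_max_left _ _) hn
    have hn0 : 1 ≤ n := le_trans (le_trans (le_max_left _ _) (le_max_right _ _)) hn
    have hn2 : 4 * t / δ ≤ n := by
      refine (Nat.le_ceil _).trans ?_
      exact_mod_cast le_trans (le_trans (le_max_right _ _) (le_max_right _ _)) hn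
    have hnr : (0 : ℝ) < n := by exact_mod_cast hn0
    let N : (Fin q → Fin n) → Finset (Fin n) := fun x => univ.filter fun y => Fin.cons y x ∈ P
    have hsum : (P.card : ℝ) = ∑ x, ((N x).card : ℝ) := by
      have : P.card = ∑ x : Fin q → Fin n, (N x).card := by
        rw [← card_sigma]
        symm
        refine card_bij (fun a _ => (Fin.cons a.2 a.1 : Fin (q+1) → Fin n)) ?_ ?_ ?_
        · rintro ⟨x, y⟩ h; simpa [N] using h
        · rintro ⟨x, y⟩ _ ⟨x', y'⟩ _ h
          have := Fin.cons_inj.mp h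
          simp only at this
          obtain ⟨rfl, rfl⟩ := this; rfl
        · intro p hp
          exact ⟨⟨Fin.tail p, p 0⟩, by simpa [N] using hp, by simp⟩
      rw [this]; push_cast; rfl
    let G : Finset (Fin q → Fin n) := univ.filter fun x => δ / 2 * n ≤ (N x).card
    have hG : δ / 2 * (n : ℝ) ^ q ≤ G.card := by
      have h1 : ∀ x : Fin q → Fin n, ((N x).card : ℝ) ≤ δ / 2 * n + if x ∈ G then (n : ℝ) else 0 := by
        intro x
        by_cases hx : x ∈ G
        · have : ((N x).card : ℝ) ≤ n := by
            have := card_le_univ (N x); simp only [Fintype.card_fin] at this; exact_mod_cast this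
          simp only [hx, if_true]; nlinarith
        · simp only [hx, if_false]
          simp only [G, mem_filter, mem_univ, true_and, not_le] at hx
          linarith
      have h2 := sum_le_sum fun x (_ : x ∈ (univ : Finset (Fin q → Fin n))) => h1 x
      rw [← hsum, sum_add_distrib] at h2
      simp only [sum_const, card_univ, Fintype.card_fun, Fintype.card_fin, nsmul_eq_mul, Nat.cast_pow, sum_ite_mem, univ_inter] at h2
      have h3 := hP.trans h2
      rw [pow_succ] at h3
      have : (δ / 2 * (n : ℝ) ^ q) * n ≤ G.card * n := by nlinarith
      exact le_of_mul_le_mul_right this hnr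
    have hch : ∀ x ∈ G, (δ / (4 * t)) ^ t * (n : ℝ) ^ t ≤ ((N x).powersetCard t).card := by
      intro x hx
      simp only [G, mem_filter, mem_univ, true_and] at hx
      rw [card_powersetCard]
      set a := (N x).card
      have htr : (0:ℝ) < t := by exact_mod_cast ht
      have h4 : 4 * (t:ℝ) ≤ δ * n := by
        rw [div_le_iff₀ hδ] at hn2; linarith
      have hta : t ≤ a := by
        have : (t:ℝ) ≤ a := by linarith
        exact_mod_cast this
      have h2ta : 2 * t ≤ a := by
        have : 2 * (t:ℝ) ≤ a := by linarith
        exact_mod_cast this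
      have h5 : ((a / (2 * t) : ℝ)) ^ t ≤ (a.choose t : ℝ) := by
        refine le_trans ?_ (Nat.pow_le_choose (α := ℝ) t a)
        have hf : (t.factorial : ℝ) ≤ (t : ℝ) ^ t := by exact_mod_cast Nat.factorial_le_pow t
        have hf0 : (0:ℝ) < t.factorial := by exact_mod_cast Nat.factorial_pos t
        have hb : (a : ℝ) / 2 ≤ ((a + 1 - t : ℕ) : ℝ) := by
          rw [Nat.cast_sub (by omega)]; push_cast
          have : 2 * (t:ℝ) ≤ a := by linarith
          linarith
        rw [← div_div, div_pow]
        gcongr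
      refine le_trans ?_ h5
      rw [← mul_pow]
      apply pow_le_pow_left₀ (by positivity)
      rw [div_mul_eq_mul_div, div_le_div_iff₀ (by positivity) (by positivity)]
      nlinarith
    have hex : ∃ Y ∈ (univ : Finset (Fin n)).powersetCard t,
        c * (n : ℝ) ^ q ≤ (univ.filter fun x => Y ⊆ N x).card := by
      by_contra hcon
      push Not at hcon
      have hdc : ∑ x ∈ G, ((N x).powersetCard t).card ≤
          ∑ Y ∈ (univ : Finset (Fin n)).powersetCard t, (univ.filter fun x => Y ⊆ N x).card := by
        have e1 : ∀ x, ((N x).powersetCard t).card = ∑ Y ∈ (univ : Finset (Fin n)).powersetCard t, if Y ⊆ N x then 1 else 0 := by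
          intro x
          rw [← card_filter]
          congr 1
          ext Y; simp [mem_powersetCard, and_comm]
        simp only [e1]
        rw [sum_comm]
        refine sum_le_sum fun Y _ => ?_
        rw [← card_filter]
        exact card_le_card (filter_subset_filter _ (subset_univ _))
      have hdc' : ∑ x ∈ G, (((N x).powersetCard t).card : ℝ) ≤
          ∑ Y ∈ (univ : Finset (Fin n)).powersetCard t, ((univ.filter fun x => Y ⊆ N x).card : ℝ) := by
        exact_mod_cast hdc
      have h6 := sum_le_sum hch
      rw [sum_const, nsmul_eq_mul] at h6
      have htn : t ≤ n := by
        have hGp : (0:ℝ) < G.card := lt_of_lt_of_le (by positivity) hG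
        obtain ⟨x, hx⟩ := card_pos.mp (by exact_mod_cast hGp : 0 < G.card)
        have := hch x hx
        have h7 : (0:ℝ) < ((N x).powersetCard t).card := lt_of_lt_of_le (by positivity) this
        obtain ⟨Y, hY⟩ := card_pos.mp (by exact_mod_cast h7 : 0 < ((N x).powersetCard t).card)
        rw [mem_powersetCard] at hY
        have := card_le_univ Y
        simp only [Fintype.card_fin] at this; omega
      have h8 : ∑ Y ∈ (univ : Finset (Fin n)).powersetCard t, ((univ.filter fun x => Y ⊆ N x).card : ℝ)
          < ∑ Y ∈ (univ : Finset (Fin n)).powersetCard t, c * (n : ℝ) ^ q := by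
        apply sum_lt_sum_of_nonempty
        · rw [powersetCard_nonempty]; simpa using htn
        · exact hcon
      rw [sum_const, nsmul_eq_mul, card_powersetCard] at h8
      simp only [card_univ, Fintype.card_fin] at h8
      have h9 : ((n.choose t : ℕ) : ℝ) ≤ (n : ℝ) ^ t := by exact_mod_cast Nat.choose_le_pow n t
      have h10 : ((n.choose t : ℕ) : ℝ) * (c * (n : ℝ) ^ q) ≤ (n : ℝ) ^ t * (c * (n : ℝ) ^ q) := by gcongr
      have h11 : (δ / 2 * (n : ℝ) ^ q) * ((δ / (4 * t)) ^ t * (n : ℝ) ^ t) ≤ G.card * ((δ / (4 * t)) ^ t * (n : ℝ) ^ t) := by gcongr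
      have h12 : (δ / 2 * (n : ℝ) ^ q) * ((δ / (4 * t)) ^ t * (n : ℝ) ^ t) = (n : ℝ) ^ t * (c * (n : ℝ) ^ q) := by rw [hc]; ring
      linarith
    obtain ⟨Y, hY, hYc⟩ := hex
    rw [mem_powersetCard] at hY
    obtain ⟨T, hT1, hT2⟩ := hn1 n hnn1 _ hYc
    let e := Y.equivFinOfCardEq hY.2
    refine ⟨Fin.cons (fun i => (e.symm i : Fin n)) T, ?_, ?_⟩
    · intro i
      refine Fin.cases ?_ ?_ i
      · intro a b hab
        simpa [Subtype.ext_iff] using hab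
      · intro j; simpa using hT1 j
    · intro τ
      have h1 := hT2 (fun i => τ i.succ)
      simp only [mem_filter, mem_univ, true_and] at h1
      have h2 := h1 (e.symm (τ 0)).2
      simp only [N, mem_filter, mem_univ, true_and] at h2
      convert h2 using 1
      ext i
      refine Fin.cases ?_ ?_ i
      · simp
      · intro j; simp

abbrev R (d k : ℕ) := Fin d ⊕ (Fin k ⊕ Fin k)
abbrev Q (d k : ℕ) := Fin d ⊕ (Fin k ⊕ (Fin k ⊕ Fin k))

def i01 (d k : ℕ) : R d k → Q d k := Sum.map id (Sum.map id Sum.inl)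
def i02 (d k : ℕ) : R d k → Q d k := Sum.map id (Sum.map id Sum.inr)
def i12 (d k : ℕ) : R d k → Q d k := Sum.map id Sum.inr

lemma i01_inj (d k : ℕ) : Function.Injective (i01 d k) :=
  Function.injective_id.sumMap (Function.injective_id.sumMap Sum.inl_injective)
lemma i02_inj (d k : ℕ) : Function.Injective (i02 d k) :=
  Function.injective_id.sumMap (Function.injective_id.sumMap Sum.inr_injective)
lemma i12_inj (d k : ℕ) : Function.Injective (i12 d k) :=
  Function.injective_id.sumMap Sum.inr_injective

def E01 (d k : ℕ) : Finset (Q d k) := univ.image (i01 d k)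
def E02 (d k : ℕ) : Finset (Q d k) := univ.image (i02 d k)
def E12 (d k : ℕ) : Finset (Q d k) := univ.image (i12 d k)

lemma card_E01 (d k : ℕ) : (E01 d k).card = d + 2 * k := by
  rw [E01, card_image_of_injective _ (i01_inj d k)]; simp; ring
lemma card_E02 (d k : ℕ) : (E02 d k).card = d + 2 * k := by
  rw [E02, card_image_of_injective _ (i02_inj d k)]; simp; ring
lemma card_E12 (d k : ℕ) : (E12 d k).card = d + 2 * k := by
  rw [E12, card_image_of_injective _ (i12_inj d k)]; simp; ring

lemma sum_R {V : Type*} [Fintype V] (d k : ℕ) (h : (R d k → V) → ℝ) :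
    ∑ y, h y = ∑ a : Fin d → V, ∑ s : Fin k → V, ∑ t : Fin k → V, h (Sum.elim a (Sum.elim s t)) := by
  rw [← (Equiv.sumArrowEquivProdArrow _ _ _).symm.sum_comp, Fintype.sum_prod_type]
  refine sum_congr rfl fun a _ => ?_
  rw [← (Equiv.sumArrowEquivProdArrow _ _ _).symm.sum_comp, Fintype.sum_prod_type]
  rfl

lemma sum_Q {V : Type*} [Fintype V] (d k : ℕ) (h : (Q d k → V) → ℝ) :
    ∑ y, h y = ∑ a : Fin d → V, ∑ s : Fin k → V, ∑ t : Fin k → V, ∑ u : Fin k → V,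
      h (Sum.elim a (Sum.elim s (Sum.elim t u))) := by
  rw [← (Equiv.sumArrowEquivProdArrow _ _ _).symm.sum_comp, Fintype.sum_prod_type]
  refine sum_congr rfl fun a _ => ?_
  rw [← (Equiv.sumArrowEquivProdArrow _ _ _).symm.sum_comp, Fintype.sum_prod_type]
  refine sum_congr rfl fun s _ => ?_
  rw [← (Equiv.sumArrowEquivProdArrow _ _ _).symm.sum_comp, Fintype.sum_prod_type]
  rfl

set_option maxHeartbeats 1000000 in
lemma many_copies (n d k : ℕ) (hd : 0 < d) (H : Finset (Finset (Fin n))) (P T : ℝ)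
    (hP : P = (univ.filter fun y : R d k → Fin n => univ.image y ∈ H).card)
    (hT : T = (univ.filter fun z : Q d k → Fin n =>
      (E01 d k).image z ∈ H ∧ (E02 d k).image z ∈ H ∧ (E12 d k).image z ∈ H).card) :
    (n : ℝ) ^ k * P ≤ (Fintype.card (Equiv.Perm (Q d k)) : ℝ) *
      (3 * (n : ℝ) ^ k * P - 6 * (P ^ 2 / ((n : ℝ) ^ d * (n : ℝ) ^ k)) + 4 * T) := by
  classical
  let h : (R d k → Fin n) → ℝ := fun y => if univ.image y ∈ H then 1 else 0
  have h01 : ∀ y, h y = 0 ∨ h y = 1 := by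
    intro y; simp only [h]; split_ifs <;> simp
  let f : (Fin d → Fin n) → (Fin k → Fin n) → (Fin k → Fin n) → ℝ :=
    fun a s t => h (Sum.elim a (Sum.elim s t))
  let o : (Q d k → Fin n) → ℝ := fun z =>
    h (z ∘ i01 d k) + h (z ∘ i02 d k) + h (z ∘ i12 d k)
      - 2 * (h (z ∘ i01 d k) * h (z ∘ i02 d k) + h (z ∘ i01 d k) * h (z ∘ i12 d k)
        + h (z ∘ i02 d k) * h (z ∘ i12 d k))
      + 4 * (h (z ∘ i01 d k) * h (z ∘ i02 d k) * h (z ∘ i12 d k))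
  have ho : ∀ z, o z = 0 ∨ o z = 1 := by
    intro z
    simp only [o]
    rcases h01 (z ∘ i01 d k) with h1 | h1 <;> rcases h01 (z ∘ i02 d k) with h2 | h2 <;>
      rcases h01 (z ∘ i12 d k) with h3 | h3 <;> rw [h1, h2, h3] <;> norm_num
  have hP' : P = ∑ a, ∑ s, ∑ t, f a s t := by
    rw [hP, ← sum_R d k h]; simp [h]
  have c01 : ∀ (a : Fin d → Fin n) (s t u : Fin k → Fin n),
      Sum.elim a (Sum.elim s (Sum.elim t u)) ∘ i01 d k = Sum.elim a (Sum.elim s t) := by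
    intro a s t u; funext x; rcases x with x | x | x <;> rfl
  have c02 : ∀ (a : Fin d → Fin n) (s t u : Fin k → Fin n),
      Sum.elim a (Sum.elim s (Sum.elim t u)) ∘ i02 d k = Sum.elim a (Sum.elim s u) := by
    intro a s t u; funext x; rcases x with x | x | x <;> rfl
  have c12 : ∀ (a : Fin d → Fin n) (s t u : Fin k → Fin n),
      Sum.elim a (Sum.elim s (Sum.elim t u)) ∘ i12 d k = Sum.elim a (Sum.elim t u) := by
    intro a s t u; funext x; rcases x with x | x | x <;> rfl
  have hT' : T = ∑ a, ∑ s, ∑ t, ∑ u, f a s t * f a s u * f a t u := by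
    have e : ∀ z : Q d k → Fin n, (if ((E01 d k).image z ∈ H ∧ (E02 d k).image z ∈ H ∧ (E12 d k).image z ∈ H) then (1:ℝ) else 0)
      = h (z ∘ i01 d k) * h (z ∘ i02 d k) * h (z ∘ i12 d k) := by
      intro z
      simp only [h, E01, E02, E12, image_image]
      split_ifs <;> simp_all
    rw [hT, card_filter]
    push_cast
    rw [sum_congr rfl fun z _ => e z, sum_Q]
    simp only [c01, c02, c12, f]
  have hO' : ∑ z, o z = ∑ a, ∑ s, ∑ t, ∑ u, (f a s t + f a s u + f a t u
      - 2 * (f a s t * f a s u + f a s t * f a t u + f a s u * f a t u)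
      + 4 * (f a s t * f a s u * f a t u)) := by
    rw [sum_Q]
    simp only [o, c01, c02, c12, f]
  have hsym : ∀ a s t, f a s t = f a t s := by
    intro a s t
    simp only [f, h]
    congr 2
    ext x; simp [or_comm]
  have key := goodman f hsym P T _ hP' hT' hO'
  simp only [Fintype.card_fun, Fintype.card_fin, Nat.cast_pow] at key
  have hl : ∑ z, h (z ∘ i01 d k) = (n : ℝ) ^ k * P := by
    rw [sum_Q, hP']
    simp only [c01]
    simp only [sum_const, card_univ, Fintype.card_fun, Fintype.card_fin, nsmul_eq_mul, Nat.cast_pow,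
      ← mul_sum]
    rfl
  have hpt : ∀ z, h (z ∘ i01 d k) ≤ ∑ σ : Equiv.Perm (Q d k), o (z ∘ σ) := by
    intro z
    have hnn : ∀ σ ∈ (univ : Finset (Equiv.Perm (Q d k))), 0 ≤ o (z ∘ σ) := by
      intro σ _; rcases ho (z ∘ σ) with h | h <;> rw [h]; norm_num
    rcases h01 (z ∘ i01 d k) with h1 | h1
    · rw [h1]; exact sum_nonneg hnn
    · rw [h1]
      by_cases hall : ∀ σ : Equiv.Perm (Q d k), o (z ∘ σ) = 0
      · exfalso
        let g : Finset (Q d k) → ZMod 2 := fun E => if E.image z ∈ H then 1 else 0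
        have := parity_zero (E01 d k) (E02 d k) (E12 d k) (Sum.inl ⟨0, hd⟩)
          (mem_image.mpr ⟨Sum.inl ⟨0, hd⟩, mem_univ _, rfl⟩)
          (mem_image.mpr ⟨Sum.inl ⟨0, hd⟩, mem_univ _, rfl⟩)
          (mem_image.mpr ⟨Sum.inl ⟨0, hd⟩, mem_univ _, rfl⟩)
          (by
            rintro (s | s | s | s) hs
            · exact absurd (mem_image.mpr ⟨Sum.inl s, mem_univ _, rfl⟩) hs
            · exact absurd (mem_image.mpr ⟨Sum.inr (Sum.inl s), mem_univ _, rfl⟩) hs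
            · exact absurd (mem_image.mpr ⟨Sum.inr (Sum.inr s), mem_univ _, rfl⟩) hs
            · exact ⟨mem_image.mpr ⟨Sum.inr (Sum.inr s), mem_univ _, rfl⟩,
                mem_image.mpr ⟨Sum.inr (Sum.inr s), mem_univ _, rfl⟩⟩)
          (by rw [card_E01, card_E02]) (by rw [card_E01, card_E12]) g
          (by
            intro σ
            have := hall σ
            simp only [o, h, Function.comp_assoc] at this
            simp only [g, E01, E02, E12, image_image]
            split_ifs at this ⊢ <;> first | (exfalso; norm_num at this; done) | decide)
        simp only [g, E01, image_image] at this
        simp only [h] at h1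
        split_ifs at this h1
        · exact absurd this (by decide)
        · exact absurd h1 (by norm_num)
      · push Not at hall
        obtain ⟨σ, hσ⟩ := hall
        have h2 : o (z ∘ σ) = 1 := (ho _).resolve_left hσ
        rw [← h2]
        exact single_le_sum (f := fun σ : Equiv.Perm (Q d k) => o (z ∘ σ)) hnn (mem_univ σ)
  have hsum := sum_le_sum fun z (_ : z ∈ (univ : Finset (Q d k → Fin n))) => hpt z
  rw [hl, sum_comm] at hsum
  have hper : ∀ σ : Equiv.Perm (Q d k), ∑ z : Q d k → Fin n, o (z ∘ σ) = ∑ z, o z := by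
    intro σ
    exact (Equiv.arrowCongr σ.symm (Equiv.refl (Fin n))).sum_comp o
  simp only [hper, sum_const, nsmul_eq_mul, card_univ] at hsum
  refine hsum.trans ?_
  gcongr

set_option maxHeartbeats 2000000 in
lemma exists_hom {m r : ℕ} (hodd : Odd r) (A B C : Finset (Fin m)) (hA : A.card = r)
    (hB : B.card = r) (hC : C.card = r) :
    ∃ d k : ℕ, 0 < d ∧ d + 2 * k = r ∧ ∃ φ : Fin m → Q d k,
      A.image φ = E01 d k ∧ B.image φ = E02 d k ∧ C.image φ = E12 d k := by
  classical
  let 𝒮 : Finset (Fin m → Fin m) := univ.filter fun ψ =>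
    Set.InjOn ψ A ∧ Set.InjOn ψ B ∧ Set.InjOn ψ C
  have hne : 𝒮.Nonempty := ⟨id, by simp [𝒮]⟩
  obtain ⟨ψ, hψ, hmin⟩ := exists_min_image 𝒮 (fun ψ => ((A ∪ B ∪ C).image ψ).card) hne
  simp only [𝒮, mem_filter, mem_univ, true_and] at hψ
  obtain ⟨iA, iB, iC⟩ := hψ
  set A' := A.image ψ with hA'
  set B' := B.image ψ with hB'
  set C' := C.image ψ with hC'
  have cA : A'.card = r := by rw [hA', card_image_of_injOn iA, hA]
  have cB : B'.card = r := by rw [hB', card_image_of_injOn iB, hB]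
  have cC : C'.card = r := by rw [hC', card_image_of_injOn iC, hC]
  set U := A' ∪ B' ∪ C' with hU
  have hUi : (A ∪ B ∪ C).image ψ = U := by simp only [hU, image_union]; rfl
  have cover : ∀ x ∈ U, ∀ y ∈ U, x ≠ y →
      (x ∈ A' ∧ y ∈ A') ∨ (x ∈ B' ∧ y ∈ B') ∨ (x ∈ C' ∧ y ∈ C') := by
    intro x hx y hy hxy
    by_contra hcon
    push Not at hcon
    let μ : Fin m → Fin m := fun v => if v = x then y else v
    have hμ : ∀ W : Finset (Fin m), (x ∈ W → y ∉ W) → Set.InjOn μ W := by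
      intro W hW a ha b hb hab
      simp only [μ] at hab
      split_ifs at hab with h1 h2 h2
      · rw [h1, h2]
      · subst h1; subst hab; exact absurd hb (hW ha)
      · subst h2; subst hab; exact absurd ha (hW hb)
      · exact hab
    have hcomp : ∀ W : Finset (Fin m), Set.InjOn ψ W → (x ∈ W.image ψ → y ∉ W.image ψ) →
        Set.InjOn (μ ∘ ψ) W := by
      intro W h1 h2
      refine (hμ _ h2).comp h1 ?_
      intro a ha
      simp only [coe_image]
      exact ⟨a, ha, rfl⟩
    have hmem : μ ∘ ψ ∈ 𝒮 := by
      simp only [𝒮, mem_filter, mem_univ, true_and]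
      exact ⟨hcomp A iA hcon.1, hcomp B iB hcon.2.1, hcomp C iC hcon.2.2⟩
    have h3 := hmin _ hmem
    rw [← image_image, hUi] at h3
    have h4 : U.image μ ⊆ U.erase x := by
      intro a ha
      obtain ⟨b, hb, rfl⟩ := mem_image.mp ha
      simp only [μ, mem_erase]
      split_ifs with h
      · exact ⟨hxy.symm, hy⟩
      · exact ⟨h, hb⟩
    have h5 := card_le_card h4
    have h6 := card_erase_lt_of_mem hx
    omega
  -- no vertex lies in exactly one edge
  have two : ∀ W Y Z : Finset (Fin m), W.card = r → Y.card = r → W ∪ Y ∪ Z = U →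
      (∀ x ∈ U, ∀ y ∈ U, x ≠ y → (x ∈ W ∧ y ∈ W) ∨ (x ∈ Y ∧ y ∈ Y) ∨ (x ∈ Z ∧ y ∈ Z)) →
      ∀ x ∈ W, x ∉ Y → x ∈ Z := by
    intro W Y Z cW cY hWU hcov x hx hxY
    by_contra hxZ
    have hxU : x ∈ U := by rw [← hWU]; simp [hx]
    have : Y ⊆ W := by
      intro y hy
      by_cases hxy : x = y
      · rwa [← hxy]
      · have hyU : y ∈ U := by rw [← hWU]; simp [hy]
        rcases hcov x hxU y hyU hxy with h | h | h
        · exact h.2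
        · exact absurd h.1 hxY
        · exact absurd h.1 hxZ
    have := eq_of_subset_of_card_le this (by omega)
    exact hxY (this ▸ hx)
  have tA : ∀ x ∈ A', x ∉ B' → x ∈ C' := two A' B' C' cA cB rfl cover
  have tB : ∀ x ∈ B', x ∉ A' → x ∈ C' := two B' A' C' cB cA (by rw [hU, union_comm B' A'])
    (fun x hx y hy hxy => by have := cover x hx y hy hxy; tauto)
  have tC : ∀ x ∈ C', x ∉ A' → x ∈ B' := two C' A' B' cC cA
    (by rw [hU]; ext; simp; tauto)
    (fun x hx y hy hxy => by have := cover x hx y hy hxy; tauto)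
  set X := A' ∩ B' ∩ C' with hX
  have cS0 : (U \ C').card = U.card - r := by
    rw [card_sdiff_of_subset (by rw [hU]; exact subset_union_right), cC]
  have cS1 : (U \ B').card = U.card - r := by
    rw [card_sdiff_of_subset (by rw [hU]; intro x hx; simp [hx]), cB]
  have cS2 : (U \ A').card = U.card - r := by
    rw [card_sdiff_of_subset (by rw [hU]; intro x hx; simp [hx]), cA]
  set k := U.card - r with hk
  have eA : A' = X ∪ ((U \ C') ∪ (U \ B')) := by
    ext x; have := tA x; have := tB x; have := tC x
    simp only [hX, hU, mem_union, mem_inter, Finset.mem_sdiff]; tauto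
  have eB : B' = X ∪ ((U \ C') ∪ (U \ A')) := by
    ext x; have := tA x; have := tB x; have := tC x
    simp only [hX, hU, mem_union, mem_inter, Finset.mem_sdiff]; tauto
  have eC : C' = X ∪ ((U \ B') ∪ (U \ A')) := by
    ext x; have := tA x; have := tB x; have := tC x
    simp only [hX, hU, mem_union, mem_inter, Finset.mem_sdiff]; tauto
  have d01 : Disjoint (U \ C') (U \ B') := by
    rw [disjoint_left]; intro x; have := tA x; have := tB x; have := tC x
    simp only [hU, mem_union, Finset.mem_sdiff]; tauto
  have d02 : Disjoint (U \ C') (U \ A') := by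
    rw [disjoint_left]; intro x; have := tA x; have := tB x; have := tC x
    simp only [hU, mem_union, Finset.mem_sdiff]; tauto
  have d12 : Disjoint (U \ B') (U \ A') := by
    rw [disjoint_left]; intro x; have := tA x; have := tB x; have := tC x
    simp only [hU, mem_union, Finset.mem_sdiff]; tauto
  have dX0 : Disjoint X (U \ C') := by
    rw [disjoint_left]; intro x
    simp only [hX, mem_inter, Finset.mem_sdiff]; tauto
  have dX1 : Disjoint X (U \ B') := by
    rw [disjoint_left]; intro x
    simp only [hX, mem_inter, Finset.mem_sdiff]; tauto
  have dX2 : Disjoint X (U \ A') := by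
    rw [disjoint_left]; intro x
    simp only [hX, mem_inter, Finset.mem_sdiff]; tauto
  have hr : X.card + 2 * k = r := by
    have h1 : A'.card = X.card + (k + k) := by
      conv_lhs => rw [eA]
      rw [card_union_of_disjoint (disjoint_union_right.mpr ⟨dX0, dX1⟩), card_union_of_disjoint d01, cS0, cS1]
    omega
  have hd : 0 < X.card := by
    obtain ⟨j, hj⟩ := hodd; omega
  refine ⟨X.card, k, hd, hr, ?_⟩
  let fX : Fin X.card → Fin m := fun i => (X.equivFin.symm i : Fin m)
  let f0 : Fin k → Fin m := fun i => ((equivFinOfCardEq cS0).symm i : Fin m)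
  let f1 : Fin k → Fin m := fun i => ((equivFinOfCardEq cS1).symm i : Fin m)
  let f2 : Fin k → Fin m := fun i => ((equivFinOfCardEq cS2).symm i : Fin m)
  have rng : ∀ (W : Finset (Fin m)) (j : ℕ) (e : Fin j ≃ W), univ.image (fun i => (e i : Fin m)) = W := by
    intro W j e
    ext x
    simp only [mem_image, mem_univ, true_and]
    constructor
    · rintro ⟨i, rfl⟩; exact (e i).2
    · intro hx; exact ⟨e.symm ⟨x, hx⟩, by simp⟩
  have gX : univ.image fX = X := rng _ _ _
  have g0 : univ.image f0 = U \ C' := rng _ _ _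
  have g1 : univ.image f1 = U \ B' := rng _ _ _
  have g2 : univ.image f2 = U \ A' := rng _ _ _
  have jX : Function.Injective fX := Subtype.val_injective.comp (Equiv.injective _)
  have j0 : Function.Injective f0 := Subtype.val_injective.comp (Equiv.injective _)
  have j1 : Function.Injective f1 := Subtype.val_injective.comp (Equiv.injective _)
  have j2 : Function.Injective f2 := Subtype.val_injective.comp (Equiv.injective _)
  have mX : ∀ i, fX i ∈ X := fun i => Subtype.prop _
  have m0 : ∀ i, f0 i ∈ U \ C' := fun i => Subtype.prop _
  have m1 : ∀ i, f1 i ∈ U \ B' := fun i => Subtype.prop _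
  have m2 : ∀ i, f2 i ∈ U \ A' := fun i => Subtype.prop _
  let Ψ : Q X.card k → Fin m := Sum.elim fX (Sum.elim f0 (Sum.elim f1 f2))
  have hΨ : Function.Injective Ψ := by
    refine jX.sumElim (j0.sumElim (j1.sumElim j2 ?_) ?_) ?_
    · intro a b h; exact disjoint_left.mp d12 (m1 a) (h ▸ m2 b)
    · rintro a (b | b) h
      · exact disjoint_left.mp d01 (m0 a) (h ▸ m1 b)
      · exact disjoint_left.mp d02 (m0 a) (h ▸ m2 b)
    · rintro a (b | b | b) h
      · exact disjoint_left.mp dX0 (mX a) (h ▸ m0 b)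
      · exact disjoint_left.mp dX1 (mX a) (h ▸ m1 b)
      · exact disjoint_left.mp dX2 (mX a) (h ▸ m2 b)
  have imgel : ∀ (f : Fin X.card → Fin m) (g h : Fin k → Fin m),
      univ.image (Sum.elim f (Sum.elim g h)) = univ.image f ∪ (univ.image g ∪ univ.image h) := by
    intro f g h; ext x; simp
  have iA' : (E01 X.card k).image Ψ = A' := by
    have hh := imgel fX f0 f1
    rw [gX, g0, g1] at hh
    rw [E01, image_image, eA]
    refine Eq.trans ?_ hh
    congr 1; funext x; rcases x with x | x | x <;> rfl
  have iB' : (E02 X.card k).image Ψ = B' := by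
    have hh := imgel fX f0 f2
    rw [gX, g0, g2] at hh
    rw [E02, image_image, eB]
    refine Eq.trans ?_ hh
    congr 1; funext x; rcases x with x | x | x <;> rfl
  have iC' : (E12 X.card k).image Ψ = C' := by
    have hh := imgel fX f1 f2
    rw [gX, g1, g2] at hh
    rw [E12, image_image, eC]
    refine Eq.trans ?_ hh
    congr 1; funext x; rcases x with x | x | x <;> rfl
  have : Nonempty (Q X.card k) := ⟨Sum.inl ⟨0, hd⟩⟩
  have hinv : Function.invFun Ψ ∘ Ψ = id := Function.invFun_comp hΨ
  refine ⟨Function.invFun Ψ ∘ ψ, ?_, ?_, ?_⟩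
  · rw [← image_image, ← hA', ← iA', image_image, hinv, image_id]
  · rw [← image_image, ← hB', ← iB', image_image, hinv, image_id]
  · rw [← image_image, ← hC', ← iC', image_image, hinv, image_id]

lemma count_lower (n d k r : ℕ) (hr : d + 2 * k = r) (H : Finset (Finset (Fin n)))
    (hH : ∀ e ∈ H, e.card = r) :
    r.factorial * H.card ≤ (univ.filter fun y : R d k → Fin n => univ.image y ∈ H).card := by
  classical
  rw [card_eq_sum_card_fiberwise (f := fun y : R d k → Fin n => univ.image y) (t := H)
    (fun y hy => by simpa using hy)]
  rw [mul_comm, ← smul_eq_mul, ← sum_const]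
  refine sum_le_sum fun e he => ?_
  have hc : Fintype.card (R d k) = Fintype.card e := by
    rw [Fintype.card_coe, hH e he, ← hr]; simp; ring
  have h1 : Fintype.card (R d k ≃ e) = r.factorial := by
    rw [Fintype.card_equiv (Fintype.equivOfCardEq hc), hc, Fintype.card_coe, hH e he]
  rw [← h1, ← card_univ]
  refine card_le_card_of_injOn (fun σ x => (σ x : Fin n)) ?_ ?_
  · intro σ _
    have : univ.image (fun x => (σ x : Fin n)) = e := by
      ext x
      simp only [mem_image, mem_univ, true_and]
      constructor
      · rintro ⟨i, rfl⟩; exact (σ i).2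
      · intro hx; exact ⟨σ.symm ⟨x, hx⟩, by simp⟩
    simp only [coe_filter, Set.mem_ofPred_eq, mem_filter, mem_univ, true_and, this]
    exact ⟨he, trivial⟩
  · intro σ _ τ _ h
    ext x
    exact congrArg Fin.val (congrFun h x)

lemma choose_lower (r : ℕ) (η : ℝ) (hη : 0 < η) : ∃ n0 : ℕ, ∀ n ≥ n0,
    (1 - η) * (n : ℝ) ^ r ≤ r.factorial * (n.choose r : ℝ) := by
  refine ⟨max (r + 1) ⌈(r : ℝ) ^ 2 / η⌉₊, fun n hn => ?_⟩
  have h1 : r + 1 ≤ n := le_trans (le_max_left _ _) hn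
  have h2 : (r : ℝ) ^ 2 / η ≤ n := by
    refine (Nat.le_ceil _).trans ?_
    exact_mod_cast le_trans (le_max_right _ _) hn
  have hn0 : (0 : ℝ) < n := by exact_mod_cast (by omega : 0 < n)
  have h3 := Nat.pow_le_choose (α := ℝ) r n
  rw [div_le_iff₀' (by exact_mod_cast Nat.factorial_pos r)] at h3
  refine le_trans ?_ h3
  have hrn : (r : ℝ) ≤ n := by exact_mod_cast (by omega : r ≤ n)
  have h4 : (n : ℝ) * (1 + -(r / n)) ≤ ((n + 1 - r : ℕ) : ℝ) := by
    rw [Nat.cast_sub (by omega)]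
    push_cast
    have : (n : ℝ) * (1 + -(r / n)) = n - r := by field_simp; ring
    linarith
  have hq : (r : ℝ) / n ≤ 1 := by rw [div_le_one hn0]; exact hrn
  have h5 := one_add_mul_le_pow (a := -((r : ℝ) / n)) (by linarith) r
  have h6 : (r : ℝ) * (r / n) ≤ η := by
    rw [div_le_iff₀ hη] at h2
    rw [← mul_div_assoc, div_le_iff₀ hn0]
    nlinarith
  calc (1 - η) * (n : ℝ) ^ r ≤ (1 + -((r : ℝ) / n)) ^ r * (n : ℝ) ^ r := by
        gcongr; linarith
    _ = ((n : ℝ) * (1 + -(r / n))) ^ r := by rw [mul_pow, mul_comm]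
    _ ≤ _ := by
        apply pow_le_pow_left₀ _ h4
        apply mul_nonneg hn0.le; linarith

lemma blowupQ (W : Type) [Fintype W] [DecidableEq W] (t : ℕ) (ht : 0 < t) (δ : ℝ) (hδ : 0 < δ) :
    ∃ n0 : ℕ, ∀ n ≥ n0,
    ∀ P : Finset (W → Fin n), δ * (n : ℝ) ^ (Fintype.card W) ≤ P.card →
    ∃ T : W → Fin t → Fin n, (∀ i, Function.Injective (T i)) ∧
      ∀ τ : W → Fin t, (fun i => T i (τ i)) ∈ P := by
  obtain ⟨n0, h⟩ := blowup t ht (Fintype.card W) δ hδ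
  refine ⟨n0, fun n hn P hP => ?_⟩
  let e := Fintype.equivFin W
  let E : (W → Fin n) ≃ (Fin (Fintype.card W) → Fin n) := Equiv.arrowCongr e (Equiv.refl _)
  obtain ⟨T, h1, h2⟩ := h n hn (P.map E.toEmbedding) (by rwa [card_map])
  refine ⟨fun x => T (e x), fun i => h1 _, fun τ => ?_⟩
  have := h2 (τ ∘ e.symm)
  rw [mem_map_equiv] at this
  convert this using 1
  funext i
  simp [E, Equiv.arrowCongr]

lemma numeric (M p τ : ℝ) (hM : 1 ≤ M) (hp : 1 / 2 - 1 / (12 * M) ≤ p)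
    (h : p ≤ M * (3 * p - 6 * p ^ 2 + 4 * τ)) : 1 / (20 * M) ≤ τ := by
  have hM0 : 0 < M := by linarith
  have h1 : M * (1 - 2 * p) ≤ 1 / 6 := by
    have : M * (1 / (12 * M)) = 1 / 12 := by field_simp
    nlinarith
  have h2 : 1 / (12 * M) ≤ 1 / 12 := by
    rw [div_le_div_iff₀ (by positivity) (by norm_num)]; linarith
  have h3 : 5 / 12 ≤ p := by linarith
  have h4 : M * (3 * p - 6 * p ^ 2) ≤ p / 2 := by nlinarith
  rw [div_le_iff₀ (by positivity)]
  nlinarith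

lemma pair_common {d k : ℕ} (x y : Q d k) : (x ∈ E01 d k ∧ y ∈ E01 d k) ∨
    (x ∈ E02 d k ∧ y ∈ E02 d k) ∨ (x ∈ E12 d k ∧ y ∈ E12 d k) := by
  rcases x with x | x | x | x <;> rcases y with y | y | y | y <;>
    simp [E01, E02, E12, i01, i02, i12]

set_option maxHeartbeats 1000000 in
lemma ex_bound (r : ℕ) (hr1 : 1 ≤ r) (hodd : Odd r) (m : ℕ) (F : Finset (Finset (Fin m)))
    (hF : ∀ e ∈ F, e.card = r) (hF3 : F.card = 3) :
    ∃ n0 : ℕ, ∀ n ≥ n0, ∀ H : Finset (Finset (Fin n)), (∀ e ∈ H, e.card = r) → ¬ HasCopy H F →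
      (H.card : ℝ) ≤ (1 / 2 - 1 / (24 * ((3 * r).factorial : ℝ))) * (n.choose r : ℝ) := by
  classical
  obtain ⟨A, B, C, -, -, -, rfl⟩ := card_eq_three.mp hF3
  have cA : A.card = r := hF A (by simp)
  have cB : B.card = r := hF B (by simp)
  have cC : C.card = r := hF C (by simp)
  obtain ⟨d, k, hd, hdk, φ, fA, fB, fC⟩ := exists_hom hodd A B C cA cB cC
  have hm : 0 < m := by
    obtain ⟨x, _⟩ := card_pos.mp (by omega : 0 < A.card)
    exact x.pos
  have : Nonempty (Fin m) := ⟨⟨0, hm⟩⟩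
  set M : ℝ := (Fintype.card (Equiv.Perm (Q d k)) : ℝ) with hM
  set N : ℝ := ((3 * r).factorial : ℝ) with hN
  have hQc : Fintype.card (Q d k) = d + 3 * k := by simp; ring
  have hM1 : 1 ≤ M := by
    rw [hM]; exact_mod_cast Fintype.card_pos
  have hMN : M ≤ N := by
    rw [hM, hN, Fintype.card_perm, hQc]
    exact_mod_cast Nat.factorial_le (by omega)
  have hN1 : 1 ≤ N := hM1.trans hMN
  obtain ⟨n1, hn1⟩ := blowupQ (Q d k) m hm (1 / (20 * M)) (by positivity)
  obtain ⟨n2, hn2⟩ := choose_lower r (1 / (24 * N)) (by positivity)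
  refine ⟨max 1 (max n1 n2), fun n hn H hH hfree => ?_⟩
  have hn0 : 1 ≤ n := le_trans (le_max_left _ _) hn
  have hnn1 : n1 ≤ n := le_trans (le_trans (le_max_left _ _) (le_max_right _ _)) hn
  have hnn2 : n2 ≤ n := le_trans (le_trans (le_max_right _ _) (le_max_right _ _)) hn
  by_contra hbig
  push Not at hbig
  apply hfree
  have hnr : (0 : ℝ) < n := by exact_mod_cast hn0
  set P : ℝ := (((univ.filter fun y : R d k → Fin n => univ.image y ∈ H).card : ℕ) : ℝ) with hP
  set TS := univ.filter fun z : Q d k → Fin n =>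
      (E01 d k).image z ∈ H ∧ (E02 d k).image z ∈ H ∧ (E12 d k).image z ∈ H with hTS
  have key := many_copies n d k hd H P TS.card hP rfl
  rw [← hM] at key
  have hPl : (r.factorial : ℝ) * H.card ≤ P := by
    rw [hP]; exact_mod_cast count_lower n d k r hdk H hH
  set η : ℝ := 1 / (24 * N) with hη
  have hη0 : 0 < η := by positivity
  have hη1 : η ≤ 1 / 24 := by
    rw [hη, div_le_div_iff₀ (by positivity) (by norm_num)]; linarith
  have hηM : 2 * η ≤ 1 / (12 * M) := by
    rw [hη, ← mul_div_assoc, div_le_div_iff₀ (by positivity) (by positivity)]; linarith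
  have hf0 : (0:ℝ) < r.factorial := by exact_mod_cast Nat.factorial_pos r
  have hPn : (1 / 2 - 2 * η) * (n : ℝ) ^ r ≤ P := by
    have h1 := hn2 n hnn2
    have h2 : (1 / 2 - η) * ((1 - η) * (n : ℝ) ^ r) ≤ (1 / 2 - η) * (r.factorial * (n.choose r : ℝ)) := by
      apply mul_le_mul_of_nonneg_left h1; linarith
    have h3 : (1 / 2 - η) * (r.factorial * (n.choose r : ℝ)) ≤ r.factorial * H.card := by
      have := mul_le_mul_of_nonneg_left hbig.le hf0.le
      linarith
    have h4 : (1 / 2 - 2 * η) * (n : ℝ) ^ r ≤ (1 / 2 - η) * ((1 - η) * (n : ℝ) ^ r) := by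
      rw [← mul_assoc]
      apply mul_le_mul_of_nonneg_right _ (by positivity)
      nlinarith
    linarith
  have hτ : 1 / (20 * M) ≤ (TS.card : ℝ) / (n : ℝ) ^ (d + 3 * k) := by
    apply numeric M (P / (n : ℝ) ^ r) _ hM1
    · rw [le_div_iff₀ (by positivity)]
      refine le_trans ?_ hPn
      gcongr
    · have hd3 : (0:ℝ) < (n:ℝ) ^ (d + 3 * k) := by positivity
      have h1 := div_le_div_of_nonneg_right key hd3.le
      have e1 : (n : ℝ) ^ k * P / (n:ℝ) ^ (d + 3 * k) = P / (n : ℝ) ^ r := by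
        rw [← hdk, div_eq_div_iff (by positivity) (by positivity)]; ring
      have e2 : M * (3 * (n : ℝ) ^ k * P - 6 * (P ^ 2 / ((n : ℝ) ^ d * (n : ℝ) ^ k)) + 4 * TS.card) / (n:ℝ) ^ (d + 3 * k)
          = M * (3 * (P / (n : ℝ) ^ r) - 6 * (P / (n : ℝ) ^ r) ^ 2 + 4 * (TS.card / (n : ℝ) ^ (d + 3 * k))) := by
        rw [← e1]
        have e3 : ((n : ℝ) ^ k * P / (n:ℝ) ^ (d + 3 * k)) ^ 2 = P ^ 2 / ((n : ℝ) ^ d * (n : ℝ) ^ k) / (n:ℝ) ^ (d + 3 * k) := by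
          rw [div_pow, div_div, div_eq_div_iff (by positivity) (by positivity)]; ring
        rw [e3]; ring
      rw [e1, e2] at h1
      exact h1
  rw [le_div_iff₀ (by positivity), ← hQc] at hτ
  obtain ⟨T, hTi, hTm⟩ := hn1 n hnn1 TS hτ
  have hTm' : ∀ τ : Q d k → Fin m, (E01 d k).image (fun i => T i (τ i)) ∈ H ∧
      (E02 d k).image (fun i => T i (τ i)) ∈ H ∧ (E12 d k).image (fun i => T i (τ i)) ∈ H := by
    intro τ
    have := hTm τ
    simpa only [hTS, mem_filter, mem_univ, true_and] using this
  refine ⟨fun v => T (φ v) v, ?_, ?_⟩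
  · apply Set.injOn_of_injective
    intro v w hvw
    simp only at hvw
    by_cases h : φ v = φ w
    · rw [h] at hvw; exact hTi _ hvw
    · exfalso
      apply h
      let τ : Q d k → Fin m := fun x => if x = φ v then v else w
      have hv : τ (φ v) = v := by simp [τ]
      have hw : τ (φ w) = w := by simp [τ, Ne.symm h]
      have hinj : ∀ E : Finset (Q d k), E.card = r → E.image (fun i => T i (τ i)) ∈ H →
          φ v ∈ E → φ w ∈ E → φ v = φ w := by
        intro E hE hEH h1 h2
        have : Set.InjOn (fun i => T i (τ i)) E := by
          rw [← card_image_iff, hH _ hEH, hE]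
        apply this h1 h2
        simp only [hv, hw]; exact hvw
      obtain ⟨q1, q2, q3⟩ := hTm' τ
      rcases pair_common (φ v) (φ w) with h | h | h
      · exact hinj _ (by rw [card_E01, hdk]) q1 h.1 h.2
      · exact hinj _ (by rw [card_E02, hdk]) q2 h.1 h.2
      · exact hinj _ (by rw [card_E12, hdk]) q3 h.1 h.2
  · have hedge : ∀ (W : Finset (Fin m)) (E : Finset (Q d k)), W.card = r → E.card = r →
        W.image φ = E → (∀ τ : Q d k → Fin m, E.image (fun i => T i (τ i)) ∈ H) →
        W.image (fun v => T (φ v) v) ∈ H := by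
      intro W E hW hE hWE h
      have hinj : Set.InjOn φ W := by rw [← card_image_iff, hWE, hE, hW]
      have h1 := h (Function.invFunOn φ W)
      rw [← hWE, image_image] at h1
      convert h1 using 1
      apply image_congr
      intro v hv
      simp only [Function.comp]
      rw [hinj.leftInvOn_invFunOn hv]
    intro e he
    simp only [mem_insert, mem_singleton] at he
    rcases he with rfl | rfl | rfl
    · exact hedge _ _ cA (by rw [card_E01, hdk]) fA fun τ => (hTm' τ).1
    · exact hedge _ _ cB (by rw [card_E02, hdk]) fB fun τ => (hTm' τ).2.1
    · exact hedge _ _ cC (by rw [card_E12, hdk]) fC fun τ => (hTm' τ).2.2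

lemma exNum_le {r n m : ℕ} (F : Finset (Finset (Fin m))) (b : ℕ)
    (h : ∀ H : Finset (Finset (Fin n)), (∀ e ∈ H, e.card = r) → ¬ HasCopy H F → H.card ≤ b) :
    exNum r n F ≤ b := by
  classical
  unfold exNum
  apply Finset.sup_le
  intro H hH
  simp only [mem_filter, mem_univ, true_and] at hH
  exact h H hH.1 hH.2

lemma le_exNum {r n m : ℕ} (F : Finset (Finset (Fin m))) (H : Finset (Finset (Fin n)))
    (h1 : ∀ e ∈ H, e.card = r) (h2 : ¬ HasCopy H F) : H.card ≤ exNum r n F := by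
  classical
  unfold exNum
  apply Finset.le_sup (f := Finset.card)
  simp only [mem_filter, mem_univ, true_and]
  exact ⟨h1, h2⟩

lemma ex_mono {r n m : ℕ} (hn : r ≤ n) (F : Finset (Finset (Fin m))) :
    exNum r (n + 1) F * (n + 1 - r) ≤ (n + 1) * exNum r n F := by
  classical
  rw [← Nat.le_div_iff_mul_le (by omega)]
  apply exNum_le
  intro H hH hfree
  rw [Nat.le_div_iff_mul_le (by omega)]
  let Hv : Fin (n + 1) → Finset (Finset (Fin n)) := fun v =>
    univ.filter fun e => e.image v.succAbove ∈ H
  have h1 : ∀ v, (Hv v).card ≤ exNum r n F := by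
    intro v
    apply le_exNum
    · intro e he
      simp only [Hv, mem_filter, mem_univ, true_and] at he
      rw [← hH _ he, card_image_of_injective _ Fin.succAbove_right_injective]
    · rintro ⟨ψ, hψ, he⟩
      apply hfree
      refine ⟨v.succAbove ∘ ψ, Fin.succAbove_right_injective.comp_injOn hψ, fun e hee => ?_⟩
      have := he e hee
      simp only [Hv, mem_filter, mem_univ, true_and] at this
      rwa [image_image] at this
  have h2 : ∀ v, (H.filter fun e => v ∉ e).card ≤ (Hv v).card := by
    intro v
    have : (H.filter fun e => v ∉ e) ⊆ (Hv v).image (fun e => e.image v.succAbove) := by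
      intro e he
      simp only [mem_filter] at he
      have hee : (univ.filter fun x => v.succAbove x ∈ e).image v.succAbove = e := by
        ext y
        simp only [mem_image, mem_filter, mem_univ, true_and]
        constructor
        · rintro ⟨x, hx, rfl⟩; exact hx
        · intro hy
          obtain ⟨x, rfl⟩ := Fin.exists_succAbove_eq (x := y) (y := v) (fun h => he.2 (h ▸ hy))
          exact ⟨x, hy, rfl⟩
      refine mem_image.mpr ⟨_, ?_, hee⟩
      simp only [Hv, mem_filter, mem_univ, true_and]
      rw [hee]; exact he.1
    exact (card_le_card this).trans card_image_le
  have h3 : ∑ v : Fin (n + 1), (H.filter fun e => v ∉ e).card = H.card * (n + 1 - r) := by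
    simp only [card_filter]
    rw [sum_comm, ← smul_eq_mul, ← sum_const]
    refine sum_congr rfl fun e he => ?_
    rw [← card_filter, ← hH e he]
    have : (univ.filter fun v => v ∉ e) = eᶜ := by ext; simp
    rw [this, card_compl, Fintype.card_fin]
  rw [← h3]
  calc _ ≤ ∑ v : Fin (n + 1), exNum r n F := sum_le_sum fun v _ => (h2 v).trans (h1 v)
    _ = _ := by simp

lemma density_anti {r m : ℕ} (F : Finset (Finset (Fin m))) :
    Antitone fun j : ℕ => (exNum r (j + r) F : ℝ) / ((j + r).choose r : ℝ) := by
  apply antitone_nat_of_succ_le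
  intro j
  have h1 := ex_mono (r := r) (n := j + r) (by omega) F
  have h2 := Nat.choose_mul_succ_eq (j + r) r
  have e : j + 1 + r = j + r + 1 := by ring
  rw [e]
  have p1 : 0 < (j + r).choose r := Nat.choose_pos (by omega)
  have p2 : 0 < (j + r + 1).choose r := Nat.choose_pos (by omega)
  rw [div_le_div_iff₀ (by exact_mod_cast p2) (by exact_mod_cast p1)]
  have h3 : exNum r (j + r + 1) F * (j + r).choose r ≤ exNum r (j + r) F * (j + r + 1).choose r := by
    have p3 : 0 < j + r + 1 := by omega
    apply Nat.le_of_mul_le_mul_left _ p3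
    calc (j + r + 1) * (exNum r (j + r + 1) F * (j + r).choose r)
        = exNum r (j + r + 1) F * ((j + r).choose r * (j + r + 1)) := by ring
      _ = exNum r (j + r + 1) F * (j + r + 1 - r) * (j + r + 1).choose r := by rw [h2]; ring
      _ ≤ (j + r + 1) * exNum r (j + r) F * (j + r + 1).choose r := Nat.mul_le_mul_right _ h1
      _ = _ := by ring
  exact_mod_cast h3

lemma density_le (r : ℕ) (hr1 : 1 ≤ r) (hodd : Odd r) (m : ℕ) (F : Finset (Finset (Fin m)))
    (hF : ∀ e ∈ F, e.card = r) (hF3 : F.card = 3) :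
    turanDensity r F ≤ 1 / 2 - 1 / (24 * ((3 * r).factorial : ℝ)) := by
  have hbdd : BddBelow (Set.range fun j : ℕ => (exNum r (j + r) F : ℝ) / ((j + r).choose r : ℝ)) :=
    ⟨0, by rintro _ ⟨j, rfl⟩; positivity⟩
  have ht := tendsto_atTop_ciInf (density_anti F) hbdd
  have ht' := (tendsto_add_atTop_iff_nat (f := fun n : ℕ => (exNum r n F : ℝ) / (n.choose r : ℝ)) r).mp ht
  unfold turanDensity
  rw [ht'.limUnder_eq]
  apply le_of_tendsto ht'
  obtain ⟨n0, h0⟩ := ex_bound r hr1 hodd m F hF hF3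
  filter_upwards [eventually_ge_atTop (max n0 r)] with n hn
  have hp : 0 < n.choose r := Nat.choose_pos (le_trans (le_max_right _ _) hn)
  rw [div_le_iff₀ (by exact_mod_cast hp)]
  set c := (1 / 2 - 1 / (24 * ((3 * r).factorial : ℝ))) with hc
  have hc0 : 0 ≤ c := by
    have : (1:ℝ) ≤ ((3 * r).factorial : ℝ) := by exact_mod_cast Nat.factorial_pos _
    have : 1 / (24 * ((3 * r).factorial : ℝ)) ≤ 1 / 2 := by
      rw [div_le_div_iff₀ (by positivity) (by norm_num)]; linarith
    linarith
  have : exNum r n F ≤ ⌊c * (n.choose r : ℝ)⌋₊ := by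
    apply exNum_le
    intro H h1 h2
    exact Nat.le_floor (h0 n (le_trans (le_max_left _ _) hn) H h1 h2)
  exact (Nat.le_floor_iff (by positivity)).mp this

end OddMantel

/-- **Odd hypergraph Mantel theorem.** For every positive odd integer `r`,
the maximum Turán density over `r`-graphs with exactly three edges is
strictly less than `1/2`. -/
theorem odd_mantel (r : ℕ) (hr : 1 ≤ r) (hodd : Odd r) :
    gammaT r < 1 / 2 := by
  
  have hf : (1:ℝ) ≤ ((3 * r).factorial : ℝ) := by exact_mod_cast Nat.factorial_pos _
  have hlt : (0:ℝ) < 1 / (24 * ((3 * r).factorial : ℝ)) := by positivity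
  have hle : gammaT r ≤ 1 / 2 - 1 / (24 * ((3 * r).factorial : ℝ)) := by
    unfold gammaT
    apply Real.sSup_le
    · rintro x ⟨m, F, h1, h2, rfl⟩
      exact OddMantel.density_le r hr hodd m F h1 h2
    · have : 1 / (24 * ((3 * r).factorial : ℝ)) ≤ 1 / 2 := by
        rw [div_le_div_iff₀ (by positivity) (by norm_num)]; linarith
      linarith
  linarith
end

section
/- Let r be a positive even integer and let F be an r-uniform hypergraph with exactly three edges such that F is not isomorphic to the expanded triangle T_r. Then π(F) < 1/2. -/
open Filter

section limit

theorem em_exNum_le {r n m : ℕ} {F : Finset (Finset (Fin m))} {H : Finset (Finset (Fin n))}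
    (h1 : ∀ e ∈ H, e.card = r) (h2 : ¬ HasCopy H F) : H.card ≤ exNum r n F := by
  classical
  unfold exNum
  refine Finset.le_sup (f := Finset.card) ?_
  simp only [Finset.mem_filter, Finset.mem_univ, true_and]
  exact ⟨h1, h2⟩

theorem em_le_of {r n m : ℕ} {F : Finset (Finset (Fin m))} {N : ℕ}
    (h : ∀ H : Finset (Finset (Fin n)), (∀ e ∈ H, e.card = r) → ¬ HasCopy H F → H.card ≤ N) :
    exNum r n F ≤ N := by
  classical
  unfold exNum
  refine Finset.sup_le ?_
  intro H hH
  simp only [Finset.mem_filter, Finset.mem_univ, true_and] at hH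
  exact h H hH.1 hH.2

theorem em_step (r n : ℕ) {m : ℕ} (F : Finset (Finset (Fin m))) :
    exNum r (n + 1) F * (n + 1 - r) ≤ (n + 1) * exNum r n F := by
  classical
  rcases Nat.lt_or_ge n r with hr | hr
  · rw [Nat.sub_eq_zero_of_le hr]; simp
  rw [← Nat.le_div_iff_mul_le (by omega)]
  refine em_le_of ?_
  intro H h1 h2
  rw [Nat.le_div_iff_mul_le (by omega)]
  have key : ∀ v : Fin (n + 1), (H.filter fun e => v ∉ e).card ≤ exNum r n F := by
    intro v
    set H' : Finset (Finset (Fin n)) :=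
      Finset.univ.filter fun e => e.map (Fin.succAboveEmb v) ∈ H with hH'
    have hle : (H.filter fun e => v ∉ e).card ≤ H'.card := by
      refine Finset.card_le_card_of_surjOn (fun e => e.map (Fin.succAboveEmb v)) ?_
      intro e he
      simp only [Finset.coe_filter, Set.mem_ofPred_eq] at he
      have hee : (Finset.univ.filter fun x => v.succAbove x ∈ e).map (Fin.succAboveEmb v) = e := by
        ext y
        simp only [Finset.mem_map, Finset.mem_filter, Finset.mem_univ, true_and]
        constructor
        · rintro ⟨x, hx, rfl⟩; exact hx
        · intro hy
          obtain ⟨x, hx⟩ := Fin.exists_succAbove_eq (x := y) (y := v) (by rintro rfl; exact he.2 hy)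
          exact ⟨x, by rw [hx]; exact hy, hx⟩
      refine ⟨_, ?_, hee⟩
      simp only [hH', Finset.coe_filter, Finset.mem_univ, true_and, Set.mem_ofPred_eq]
      rw [hee]; exact he.1
    refine hle.trans (em_exNum_le ?_ ?_)
    · intro e he
      simp only [hH', Finset.mem_filter, Finset.mem_univ, true_and] at he
      have := h1 _ he
      rwa [Finset.card_map] at this
    · rintro ⟨φ, hφ, hφ2⟩
      refine h2 ⟨fun x => v.succAbove (φ x), ?_, ?_⟩
      · intro x hx y hy hxy
        exact hφ hx hy (Fin.succAbove_right_injective hxy)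
      · intro e he
        have := hφ2 e he
        simp only [hH', Finset.mem_filter, Finset.mem_univ, true_and] at this
        rw [Finset.map_eq_image, Finset.image_image] at this
        exact this
  have hdc : ∑ v : Fin (n + 1), (H.filter fun e => v ∉ e).card = H.card * (n + 1 - r) := by
    have := Finset.sum_card_bipartiteAbove_eq_sum_card_bipartiteBelow
      (s := (Finset.univ : Finset (Fin (n + 1)))) (t := H) (fun v e => v ∉ e)
    unfold Finset.bipartiteAbove Finset.bipartiteBelow at this
    rw [this]
    rw [Finset.sum_const_nat]
    intro e he
    have : (Finset.univ.filter fun v => v ∉ e) = eᶜ := by ext; simp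
    rw [this, Finset.card_compl, h1 e he, Fintype.card_fin]
  rw [← hdc]
  calc _ ≤ ∑ v : Fin (n + 1), exNum r n F := Finset.sum_le_sum fun v _ => key v
    _ = _ := by simp

theorem em_anti (r n : ℕ) (hn : r ≤ n) {m : ℕ} (F : Finset (Finset (Fin m))) :
    (exNum r (n + 1) F : ℝ) / ((n + 1).choose r : ℝ) ≤ (exNum r n F : ℝ) / (n.choose r : ℝ) := by
  have h := em_step r n F
  have hc := Nat.choose_mul_succ_eq n r
  have p1 : 0 < n.choose r := Nat.choose_pos hn
  have p2 : 0 < (n + 1).choose r := Nat.choose_pos (by omega)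
  rw [div_le_div_iff₀ (by exact_mod_cast p2) (by exact_mod_cast p1)]
  have : exNum r (n + 1) F * n.choose r ≤ exNum r n F * (n + 1).choose r := by
    refine Nat.le_of_mul_le_mul_right (c := n + 1) ?_ (by omega)
    calc exNum r (n + 1) F * n.choose r * (n + 1)
        = (exNum r (n + 1) F * (n + 1 - r)) * (n + 1).choose r := by
          rw [mul_assoc, hc]; ring
      _ ≤ ((n + 1) * exNum r n F) * (n + 1).choose r := Nat.mul_le_mul_right _ h
      _ = _ := by ring
  exact_mod_cast this

theorem em_limit (r : ℕ) {m : ℕ} (F : Finset (Finset (Fin m))) (c : ℝ)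
    (h : ∀ᶠ n : ℕ in atTop, (exNum r n F : ℝ) / (n.choose r : ℝ) ≤ c) : turanDensity r F ≤ c := by
  have hanti : Antitone fun n : ℕ => (exNum r (n + r) F : ℝ) / ((n + r).choose r : ℝ) := by
    refine antitone_nat_of_succ_le fun n => ?_
    have := em_anti r (n + r) (by omega) F
    rw [show n + 1 + r = n + r + 1 by ring]
    exact this
  have hb : BddBelow (Set.range fun n : ℕ => (exNum r (n + r) F : ℝ) / ((n + r).choose r : ℝ)) := by
    refine ⟨0, ?_⟩
    rintro _ ⟨n, rfl⟩
    positivity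
  have ht := tendsto_atTop_ciInf hanti hb
  rw [Filter.tendsto_add_atTop_iff_nat (f := fun n : ℕ => (exNum r n F : ℝ) / (n.choose r : ℝ))] at ht
  unfold turanDensity
  rw [ht.limUnder_eq]
  exact le_of_tendsto ht h
end limit

section expectation
open Finset BigOperators

theorem em_jensen {α : Type*} [Fintype α] [Nonempty α] (f : α → ℝ) (hf : ∀ a, 0 ≤ f a) (N : ℕ) :
    (𝔼 a, f a) ^ N ≤ 𝔼 a, f a ^ N := by
  have h := Real.pow_arith_mean_le_arith_mean_pow (univ : Finset α)
    (fun _ => ((Fintype.card α : ℝ))⁻¹) f (fun _ _ => by positivity) (by simp) (fun a _ => hf a) N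
  rw [← mul_sum, ← mul_sum] at h
  rw [Fintype.expect_eq_sum_div_card, Fintype.expect_eq_sum_div_card]
  rw [div_eq_inv_mul, div_eq_inv_mul]
  exact h

theorem em_goodman {α β : Type*} [Fintype α] [Nonempty α] [Fintype β] [Nonempty β]
    (g : α → β → β → ℝ) (hs : ∀ τ a b, g τ a b = g τ b a) (hg : ∀ τ a b, 0 ≤ g τ a b)
    (p η : ℝ) (hp : p = 𝔼 τ, 𝔼 a, 𝔼 b, g τ a b)
    (hη : η = 𝔼 τ, 𝔼 a, 𝔼 b, 𝔼 c, g τ a b * g τ b c * g τ a c) :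
    (𝔼 τ, 𝔼 a, 𝔼 b, 𝔼 c, (g τ a b + g τ b c + g τ a c
      - 2 * (g τ a b * g τ b c + g τ b c * g τ a c + g τ a b * g τ a c)
      + 4 * (g τ a b * g τ b c * g τ a c))) ≤ 3 * p - 6 * p ^ 2 + 4 * η := by
  have h1 : (𝔼 τ, 𝔼 a, 𝔼 b, 𝔼 _c : β, g τ a b) = p := by simp [hp]
  have h2 : (𝔼 τ, 𝔼 _a : β, 𝔼 b, 𝔼 c, g τ b c) = p := by simp [hp]
  have h3 : (𝔼 τ, 𝔼 a, 𝔼 _b : β, 𝔼 c, g τ a c) = p := by simp [hp]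
  set q := 𝔼 τ, 𝔼 a, (𝔼 b, g τ a b) ^ 2 with hq
  have h6 : (𝔼 τ, 𝔼 a, 𝔼 b, 𝔼 c, g τ a b * g τ a c) = q := by
    rw [hq]
    refine Finset.expect_congr rfl fun τ _ => Finset.expect_congr rfl fun a _ => ?_
    simp_rw [← Finset.mul_expect, ← Finset.expect_mul, sq]
  have h4 : (𝔼 τ, 𝔼 a, 𝔼 b, 𝔼 c, g τ a b * g τ b c) = q := by
    rw [← h6]
    refine Finset.expect_congr rfl fun τ _ => ?_
    rw [Finset.expect_comm]
    refine Finset.expect_congr rfl fun a _ => Finset.expect_congr rfl fun b _ =>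
      Finset.expect_congr rfl fun c _ => ?_
    rw [hs τ b a]
  have h5 : (𝔼 τ, 𝔼 a, 𝔼 b, 𝔼 c, g τ b c * g τ a c) = q := by
    rw [← h6]
    refine Finset.expect_congr rfl fun τ _ => ?_
    have : ∀ a, (𝔼 b, 𝔼 c, g τ b c * g τ a c) = 𝔼 c, 𝔼 b, g τ b c * g τ a c :=
      fun a => Finset.expect_comm _ _ _
    simp_rw [this]
    rw [Finset.expect_comm]
    refine Finset.expect_congr rfl fun c _ => ?_
    rw [Finset.expect_comm]
    refine Finset.expect_congr rfl fun a _ => Finset.expect_congr rfl fun b _ => ?_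
    rw [hs τ c a, hs τ c b]
  have hpq : p ^ 2 ≤ q := by
    rw [hp, hq]
    refine (em_jensen _ (fun τ => ?_) 2).trans ?_
    · exact Finset.expect_nonneg fun a _ => Finset.expect_nonneg fun b _ => hg _ _ _
    · refine Finset.expect_le_expect fun τ _ => em_jensen _ (fun a => ?_) 2
      exact Finset.expect_nonneg fun b _ => hg _ _ _
  simp only [Finset.expect_add_distrib, Finset.expect_sub_distrib]
  have hm : ∀ (k : ℝ) (G : α → β → β → β → ℝ), (𝔼 τ, 𝔼 a, 𝔼 b, 𝔼 c, k * G τ a b c)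
      = k * 𝔼 τ, 𝔼 a, 𝔼 b, 𝔼 c, G τ a b c := by
    intro k G
    simp only [← Finset.mul_expect]
  rw [hm 2, hm 4]
  simp only [Finset.expect_add_distrib]
  rw [h1, h2, h3, h4, h5, h6, ← hη]
  linarith

/-- blow-up inequality -/
theorem em_blowup {V : Type*} [Fintype V] [Nonempty V] (b : ℕ) : ∀ (q : ℕ)
    (f : (Fin q → V) → ℝ), (∀ y, 0 ≤ f y) →
    (𝔼 y, f y) ^ (b ^ q) ≤ 𝔼 ψ : Fin q → Fin b → V, ∏ σ : Fin q → Fin b, f (fun j => ψ j (σ j)) := by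
  intro q
  induction q with
  | zero =>
    intro f hf
    simp
    have e1 : ∀ y : Fin 0 → V, f y = f default := fun y => by congr 1; exact Subsingleton.elim _ _
    have e2 : ∀ y : Fin 0 → Fin b → V, f (fun j => y j (Fin.elim0 j)) = f default := fun y => e1 _
    simp only [e1]
    exact le_rfl
  | succ q ih =>
    intro f hf
    have split : ∀ {X : Type _} [Fintype X] (G : (Fin (q + 1) → X) → ℝ),
        (𝔼 y, G y) = 𝔼 x, 𝔼 y : Fin q → X, G (Fin.cons x y) := by
      intro X _ G
      rw [← Finset.expect_product' (f := fun x y => G (Fin.cons x y)), Finset.univ_product_univ]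
      exact (Fintype.expect_equiv (Fin.consEquiv fun _ => X) _ _ (fun p => rfl)).symm
    have splitP : ∀ {X : Type _} [Fintype X] (G : (Fin (q + 1) → X) → ℝ),
        (∏ y, G y) = ∏ y : Fin q → X, ∏ x, G (Fin.cons x y) := by
      intro X _ G
      rw [Finset.prod_comm, ← Finset.prod_product' (f := fun x y => G (Fin.cons x y)), Finset.univ_product_univ]
      exact (Fintype.prod_equiv (Fin.consEquiv fun _ => X) _ _ (fun p => rfl)).symm
    rw [split, split]
    have e1 : ∀ (x : Fin b → V) (ψ : Fin q → Fin b → V),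
        (∏ σ : Fin (q + 1) → Fin b, f (fun j => (Fin.cons x ψ : Fin (q + 1) → Fin b → V) j (σ j)))
        = ∏ i, ∏ σ : Fin q → Fin b, f (Fin.cons (x i) (fun j => ψ j (σ j))) := by
      intro x ψ
      rw [splitP, Finset.prod_comm]
      refine Finset.prod_congr rfl fun i _ => Finset.prod_congr rfl fun σ _ => ?_
      congr 1
      funext j
      refine Fin.cases ?_ (fun j => ?_) j <;> simp
    simp only [e1]
    have e2 : ∀ ψ : Fin q → Fin b → V,
        (𝔼 x : Fin b → V, ∏ i, ∏ σ : Fin q → Fin b, f (Fin.cons (x i) (fun j => ψ j (σ j))))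
        = (𝔼 x : V, ∏ σ : Fin q → Fin b, f (Fin.cons x (fun j => ψ j (σ j)))) ^ b := by
      intro ψ
      rw [Fintype.expect_eq_sum_div_card, Fintype.expect_eq_sum_div_card, div_pow,
        Fintype.sum_pow]
      simp
    have e3 : (𝔼 x : Fin b → V, 𝔼 ψ : Fin q → Fin b → V,
        ∏ i, ∏ σ : Fin q → Fin b, f (Fin.cons (x i) (fun j => ψ j (σ j))))
        = 𝔼 ψ : Fin q → Fin b → V,
          (𝔼 x : V, ∏ σ : Fin q → Fin b, f (Fin.cons x (fun j => ψ j (σ j)))) ^ b := by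
      rw [Finset.expect_comm]
      exact Finset.expect_congr rfl fun ψ _ => e2 ψ
    rw [e3]
    have np : ∀ (ψ : Fin q → Fin b → V) (x : V),
      0 ≤ ∏ σ : Fin q → Fin b, f (Fin.cons x (fun j => ψ j (σ j))) :=
      fun ψ x => Finset.prod_nonneg fun _ _ => hf _
    refine le_trans ?_ (em_jensen _ (fun ψ => Finset.expect_nonneg fun x _ => np ψ x) b)
    have e4 : (𝔼 ψ : Fin q → Fin b → V, 𝔼 x : V, ∏ σ : Fin q → Fin b, f (Fin.cons x (fun j => ψ j (σ j))))
        = 𝔼 x : V, 𝔼 ψ : Fin q → Fin b → V, ∏ σ : Fin q → Fin b, f (Fin.cons x (fun j => ψ j (σ j))) :=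
      Finset.expect_comm _ _ _
    rw [e4, pow_succ, pow_mul]
    refine pow_le_pow_left₀ (pow_nonneg ?_ _) ?_ b
    · exact Finset.expect_nonneg fun x _ => Finset.expect_nonneg fun y _ => hf _
    refine (em_jensen _ (fun x => Finset.expect_nonneg fun y _ => hf _) _).trans ?_
    exact Finset.expect_le_expect fun x _ => ih (fun y => f (Fin.cons x y)) (fun y => hf _)
end expectation

theorem em_z1 : ∀ a b c d e : ZMod 2, a + e + c = 0 → b + e + d = 0 → a + b = c + d := by decide
theorem em_z2 : ∀ a b c d e f : ZMod 2, a + e + c = 0 → b + f + d = 0 → a + b = c + d →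
    a + b = e + f → a = b := by decide
theorem em_z3 : ∀ a : ZMod 2, a + a + a = 0 → a = 0 := by decide

section algebra
variable {I : Type*} [Fintype I] [DecidableEq I]

/-- swap step -/
theorem em_swap {t s : ℕ} (ht : 1 ≤ t) (hI : Fintype.card I = t + 3 * s + 1) (χ : Finset I → ZMod 2)
    (hχ : ∀ T A B C : Finset I, T.card = t → A.card = s → B.card = s → C.card = s →
      Disjoint T A → Disjoint T B → Disjoint T C → Disjoint A B → Disjoint A C → Disjoint B C →
      χ (T ∪ (A ∪ B)) + χ (T ∪ (B ∪ C)) + χ (T ∪ (A ∪ C)) = 0)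
    (v w : I) (R : Finset I) (hvw : v ≠ w) (hv : v ∉ R) (hw : w ∉ R) (hR : R.card + 1 = t + 2 * s) :
    χ (insert v R) = χ (insert w R) := by
  have key : ∀ T A B C : Finset I, T.card + 1 = t → A.card = s → B.card = s → C.card = s →
      Disjoint T A → Disjoint T B → Disjoint T C → Disjoint A B → Disjoint A C → Disjoint B C →
      (∀ x, x = v ∨ x = w → x ∉ T ∧ x ∉ A ∧ x ∉ B ∧ x ∉ C) →
      χ (insert v T ∪ (A ∪ B)) + χ (insert w T ∪ (A ∪ B)) =
      χ (insert v T ∪ (A ∪ C)) + χ (insert w T ∪ (A ∪ C)) := by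
    intro T A B C hT hA hB hC hTA hTB hTC hAB hAC hBC hx
    rcases Nat.eq_zero_or_pos s with hs | hs
    · subst hs
      rw [Finset.card_eq_zero] at hB hC
      subst hB hC
      rfl
    · obtain ⟨u, hu⟩ : A.Nonempty := Finset.card_pos.mp (by omega)
      have hv' := hx v (Or.inl rfl)
      have hw' := hx w (Or.inr rfl)
      have huT : u ∉ T := fun h => Finset.disjoint_left.mp hTA h hu
      have huB : u ∉ B := Finset.disjoint_left.mp hAB hu
      have huC : u ∉ C := Finset.disjoint_left.mp hAC hu
      have hcard : (A.erase u).card + 1 = s := by rw [Finset.card_erase_add_one hu, hA]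
      have h1 : ∀ x, x = v ∨ x = w → χ (insert u T ∪ (insert x (A.erase u) ∪ B)) + χ (insert u T ∪ (B ∪ C))
          + χ (insert u T ∪ (insert x (A.erase u) ∪ C)) = 0 := by
        intro x hxx
        obtain ⟨h1, h2, h3, h4⟩ := hx x hxx
        have hxu : x ≠ u := fun h => h2 (h ▸ hu)
        rw [Finset.disjoint_left] at hTA hTB hTC hAB hAC hBC
        apply hχ
        · rw [Finset.card_insert_of_notMem huT, hT]
        · rw [Finset.card_insert_of_notMem (by simp [h2]), hcard]
        · exact hB
        · exact hC
        all_goals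
          rw [Finset.disjoint_left]
          intro y hy hy'
          try simp only [Finset.mem_insert, Finset.mem_erase] at hy
          try simp only [Finset.mem_insert, Finset.mem_erase] at hy'
          clear hχ hx hxx hR hI
          grind
      have e1 : ∀ x, ∀ D, insert u T ∪ (insert x (A.erase u) ∪ D) = insert x T ∪ (A ∪ D) := by
        intro x D
        ext y
        simp only [Finset.mem_insert, Finset.mem_union, Finset.mem_erase]
        by_cases hy : y = u
        · subst hy; simp [hu]
        · simp [hy]; tauto
      have hv1 := h1 v (Or.inl rfl)
      have hw1 := h1 w (Or.inr rfl)
      rw [e1, e1] at hv1 hw1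
      generalize χ (insert v T ∪ (A ∪ B)) = a at *
      generalize χ (insert w T ∪ (A ∪ B)) = b at *
      generalize χ (insert v T ∪ (A ∪ C)) = c at *
      generalize χ (insert w T ∪ (A ∪ C)) = d at *
      generalize χ (insert u T ∪ (B ∪ C)) = e at *
      exact em_z1 a b c d e hv1 hw1
  -- choose the sets
  obtain ⟨T, hTR, hT⟩ := Finset.exists_subset_card_eq (s := R) (n := t - 1) (by omega)
  obtain ⟨A, hAR, hA⟩ := Finset.exists_subset_card_eq (s := R \ T) (n := s)
    (by rw [Finset.card_sdiff_of_subset hTR]; omega)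
  obtain ⟨C, hCR, hC⟩ := Finset.exists_subset_card_eq (s := (insert v (insert w R))ᶜ) (n := s)
    (by rw [Finset.card_compl, Finset.card_insert_of_notMem (by simp [hvw, hv]),
          Finset.card_insert_of_notMem hw]; omega)
  set B := (R \ T) \ A with hBdef
  have hB : B.card = s := by
    rw [hBdef, Finset.card_sdiff_of_subset hAR, Finset.card_sdiff_of_subset hTR]; omega
  have hRe : ∀ x, insert x T ∪ (A ∪ B) = insert x R := by
    intro x
    ext y
    have := @hTR y
    have := @hAR y
    simp only [hBdef, Finset.mem_insert, Finset.mem_union, Finset.mem_sdiff] at *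
    tauto
  have m1 : ∀ y, y ∈ T → y ∈ R := fun y h => hTR h
  have m2 : ∀ y, y ∈ A → y ∈ R ∧ y ∉ T := fun y h => by simpa using hAR h
  have m3 : ∀ y, y ∈ B → y ∈ R ∧ y ∉ T ∧ y ∉ A := fun y h => by
    have : y ∈ B := h
    rw [hBdef] at this
    simp at this
    tauto
  have m4 : ∀ y, y ∈ C → y ≠ v ∧ y ≠ w ∧ y ∉ R := fun y h => by
    have := hCR h
    simp at this
    tauto
  clear_value B
  have dTA : Disjoint T A := by
    rw [Finset.disjoint_left]; clear hχ key hBdef hRe; grind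
  have dTB : Disjoint T B := by
    rw [Finset.disjoint_left]; clear hχ key hBdef hRe; grind
  have dTC : Disjoint T C := by
    rw [Finset.disjoint_left]; clear hχ key hBdef hRe; grind
  have dAB : Disjoint A B := by
    rw [Finset.disjoint_left]; clear hχ key hBdef hRe; grind
  have dAC : Disjoint A C := by
    rw [Finset.disjoint_left]; clear hχ key hBdef hRe; grind
  have dBC : Disjoint B C := by
    rw [Finset.disjoint_left]; clear hχ key hBdef hRe; grind
  have hx : ∀ x, x = v ∨ x = w → x ∉ T ∧ x ∉ A ∧ x ∉ B ∧ x ∉ C := by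
    clear hBdef hχ key hRe
    grind
  have k1 := key T A B C (by omega) hA hB hC dTA dTB dTC dAB dAC dBC hx
  have k2 := key T B A C (by omega) hB hA hC dTB dTA dTC dAB.symm dBC dAC
    (fun x h => by have := hx x h; tauto)
  rw [Finset.union_comm B A] at k2
  have hT' : ∀ x, x = v ∨ x = w →
      χ (insert x T ∪ (A ∪ B)) + χ (insert x T ∪ (B ∪ C)) + χ (insert x T ∪ (A ∪ C)) = 0 := by
    intro x h
    obtain ⟨h1, h2, h3, h4⟩ := hx x h
    apply hχ _ _ _ _ _ hA hB hC _ _ _ dAB dAC dBC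
    · rw [Finset.card_insert_of_notMem h1]; omega
    all_goals
      rw [Finset.disjoint_insert_left]
      constructor <;> assumption
  have hv1 := hT' v (Or.inl rfl)
  have hw1 := hT' w (Or.inr rfl)
  rw [← hRe v, ← hRe w]
  generalize χ (insert v T ∪ (A ∪ B)) = a at *
  generalize χ (insert w T ∪ (A ∪ B)) = b at *
  generalize χ (insert v T ∪ (A ∪ C)) = c at *
  generalize χ (insert w T ∪ (A ∪ C)) = d at *
  generalize χ (insert v T ∪ (B ∪ C)) = e at *
  generalize χ (insert w T ∪ (B ∪ C)) = f at *
  exact em_z2 a b c d e f hv1 hw1 k1 k2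

theorem em_const {q : ℕ} (χ : Finset I → ZMod 2)
    (h : ∀ (v w : I) (R : Finset I), v ≠ w → v ∉ R → w ∉ R → R.card + 1 = q →
      χ (insert v R) = χ (insert w R)) :
    ∀ (N : ℕ) (P Q : Finset I), P.card = q → Q.card = q → (P \ Q).card = N → χ P = χ Q := by
  intro N
  induction N with
  | zero =>
    intro P Q hP hQ h0
    rw [Finset.card_eq_zero, Finset.sdiff_eq_empty_iff_subset] at h0
    rw [Finset.eq_of_subset_of_card_le h0 (by omega)]
  | succ N ih =>
    intro P Q hP hQ hN
    obtain ⟨v, hv⟩ : (P \ Q).Nonempty := Finset.card_pos.mp (by omega)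
    have hc := Finset.card_sdiff_add_card_inter P Q
    have hc' := Finset.card_sdiff_add_card_inter Q P
    rw [Finset.inter_comm] at hc'
    obtain ⟨w, hw⟩ : (Q \ P).Nonempty := Finset.card_pos.mp (by omega)
    rw [Finset.mem_sdiff] at hv hw
    have hcc := Finset.card_erase_add_one hv.1
    have e1 : χ (insert v (P.erase v)) = χ (insert w (P.erase v)) := by
      apply h
      · rintro rfl; exact hw.2 hv.1
      · simp
      · simp [hw.2]
      · omega
    rw [Finset.insert_erase hv.1] at e1
    rw [e1]
    apply ih
    · rw [Finset.card_insert_of_notMem (by simp [hw.2])]; omega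
    · exact hQ
    · have : insert w (P.erase v) \ Q = (P \ Q).erase v := by
        ext y
        simp only [Finset.mem_sdiff, Finset.mem_insert, Finset.mem_erase]
        grind
      rw [this, Finset.card_erase_of_mem (by simp [hv]), hN]; simp

theorem em_zero {t s : ℕ} (ht : 1 ≤ t) (hI : Fintype.card I = t + 3 * s + 1) (χ : Finset I → ZMod 2)
    (hχ : ∀ T A B C : Finset I, T.card = t → A.card = s → B.card = s → C.card = s →
      Disjoint T A → Disjoint T B → Disjoint T C → Disjoint A B → Disjoint A C → Disjoint B C →
      χ (T ∪ (A ∪ B)) + χ (T ∪ (B ∪ C)) + χ (T ∪ (A ∪ C)) = 0)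
    (T A B C : Finset I) (hT : T.card = t) (hA : A.card = s) (hB : B.card = s) (hC : C.card = s)
    (hTA : Disjoint T A) (hTB : Disjoint T B) (hTC : Disjoint T C) (hAB : Disjoint A B)
    (hAC : Disjoint A C) (hBC : Disjoint B C) : χ (T ∪ (A ∪ B)) = 0 := by
  have h0 := hχ T A B C hT hA hB hC hTA hTB hTC hAB hAC hBC
  have hs := em_swap ht hI χ hχ
  have hc := em_const (q := t + 2 * s) χ (fun v w R h1 h2 h3 h4 => hs v w R h1 h2 h3 h4)
  have cc : ∀ X Y : Finset I, X.card = s → Y.card = s → Disjoint T X → Disjoint T Y → Disjoint X Y →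
      (T ∪ (X ∪ Y)).card = t + 2 * s := by
    intro X Y hX hY h1 h2 h3
    rw [Finset.card_union_of_disjoint, Finset.card_union_of_disjoint h3]
    · omega
    · rw [Finset.disjoint_union_right]; exact ⟨h1, h2⟩
  have c1 := cc A B hA hB hTA hTB hAB
  have e1 := hc _ _ _ c1 (cc B C hB hC hTB hTC hBC) rfl
  have e2 := hc _ _ _ c1 (cc A C hA hC hTA hTC hAC) rfl
  rw [← e1, ← e2] at h0
  generalize χ (T ∪ (A ∪ B)) = a at *
  exact em_z3 a h0
end algebra

section hom

set_option maxHeartbeats 2000000 in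
/-- the folding map inside the ground set -/
theorem em_fold {W : Type*} [DecidableEq W] {r : ℕ} (A B C : Finset W) (hA : A.card = r)
    (hB : B.card = r) (hC : C.card = r) (h1 : (B ∩ C).card ≤ (A ∩ B).card)
    (h2 : (B ∩ C).card ≤ (A ∩ C).card) :
    ∃ (s t : ℕ) (T S₁ S₂ S₃ : Finset W) (π : W → W), t + 2 * s = r ∧ T.card = t ∧ S₁.card = s ∧
      S₂.card = s ∧ S₃.card = s ∧ Disjoint T S₁ ∧ Disjoint T S₂ ∧ Disjoint T S₃ ∧ Disjoint S₁ S₂ ∧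
      Disjoint S₁ S₃ ∧ Disjoint S₂ S₃ ∧ A.image π = T ∪ (S₁ ∪ S₂) ∧ B.image π = T ∪ (S₂ ∪ S₃) ∧
      C.image π = T ∪ (S₁ ∪ S₃) ∧ (t = 0 → A = S₁ ∪ S₂ ∧ B = S₂ ∪ S₃ ∧ C = S₁ ∪ S₃) := by
  have cI : ∀ X Y Z : Finset W, (X ∩ Y).card = ((X ∩ Y) \ Z).card + (X ∩ Y ∩ Z).card :=
    fun X Y Z => (Finset.card_sdiff_add_card_inter _ _).symm
  have i1 := cI B C A
  have i2 := cI A B C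
  have i3 := cI A C B
  have j1 : B ∩ C ∩ A = A ∩ B ∩ C := by ext; simp; tauto
  have j2 : A ∩ C ∩ B = A ∩ B ∩ C := by ext; simp; tauto
  rw [j1] at i1
  rw [j2] at i3
  set S₃ := (B ∩ C) \ A with hS3
  obtain ⟨S₂, hS2, hS2c⟩ := Finset.exists_subset_card_eq (s := (A ∩ B) \ C) (n := S₃.card) (by omega)
  obtain ⟨S₁, hS1, hS1c⟩ := Finset.exists_subset_card_eq (s := (A ∩ C) \ B) (n := S₃.card) (by omega)
  have m3 : ∀ x, x ∈ S₃ ↔ x ∈ B ∧ x ∈ C ∧ x ∉ A := by intro x; simp [hS3]; tauto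
  have m2 : ∀ x, x ∈ S₂ → x ∈ A ∧ x ∈ B ∧ x ∉ C := by
    intro x hx; have := hS2 hx; simp at this; tauto
  have m1 : ∀ x, x ∈ S₁ → x ∈ A ∧ x ∈ C ∧ x ∉ B := by
    intro x hx; have := hS1 hx; simp at this; tauto
  have d12 : Disjoint S₁ S₂ := by
    rw [Finset.disjoint_left]; intro x hx hx'; have := m1 x hx; have := m2 x hx'; tauto
  have d13 : Disjoint S₁ S₃ := by
    rw [Finset.disjoint_left]; intro x hx hx'; have := m1 x hx; have := (m3 x).1 hx'; tauto
  have d23 : Disjoint S₂ S₃ := by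
    rw [Finset.disjoint_left]; intro x hx hx'; have := m2 x hx; have := (m3 x).1 hx'; tauto
  set T := A \ (S₁ ∪ S₂) with hT
  set B' := B \ (S₂ ∪ S₃) with hB'
  set C' := C \ (S₁ ∪ S₃) with hC'
  have mT : ∀ x, x ∈ T ↔ x ∈ A ∧ x ∉ S₁ ∧ x ∉ S₂ := by intro x; simp [hT]
  have mB : ∀ x, x ∈ B' ↔ x ∈ B ∧ x ∉ S₂ ∧ x ∉ S₃ := by intro x; simp [hB']
  have mC : ∀ x, x ∈ C' ↔ x ∈ C ∧ x ∉ S₁ ∧ x ∉ S₃ := by intro x; simp [hC']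
  have sA : S₁ ∪ S₂ ⊆ A := by
    intro x hx; rw [Finset.mem_union] at hx; rcases hx with h | h
    · exact (m1 x h).1
    · exact (m2 x h).1
  have sB : S₂ ∪ S₃ ⊆ B := by
    intro x hx; rw [Finset.mem_union] at hx; rcases hx with h | h
    · exact (m2 x h).2.1
    · exact ((m3 x).1 h).1
  have sC : S₁ ∪ S₃ ⊆ C := by
    intro x hx; rw [Finset.mem_union] at hx; rcases hx with h | h
    · exact (m1 x h).2.1
    · exact ((m3 x).1 h).2.1
  have cA := Finset.card_sdiff_add_card_eq_card sA
  have cB := Finset.card_sdiff_add_card_eq_card sB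
  have cC := Finset.card_sdiff_add_card_eq_card sC
  rw [← hT, Finset.card_union_of_disjoint d12] at cA
  rw [← hB', Finset.card_union_of_disjoint d23] at cB
  rw [← hC', Finset.card_union_of_disjoint d13] at cC
  have eB : (B' \ T).card = (T \ B').card := Finset.card_sdiff_comm (by omega)
  have eC : (C' \ T).card = (T \ C').card := Finset.card_sdiff_comm (by omega)
  let f := Finset.equivOfCardEq eB
  let g := Finset.equivOfCardEq eC
  let π : W → W := fun x => if hx : x ∈ B' \ T then (f ⟨x, hx⟩ : W) else
    if hx : x ∈ C' \ T then (g ⟨x, hx⟩ : W) else x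
  have hBT : ∀ x, x ∈ B' \ T ↔ x ∈ B ∧ x ∉ A ∧ x ∉ C := by
    intro x
    rw [Finset.mem_sdiff, mB, mT]
    have := m1 x; have := m2 x; have := m3 x
    tauto
  have hCT : ∀ x, x ∈ C' \ T ↔ x ∈ C ∧ x ∉ A ∧ x ∉ B := by
    intro x
    rw [Finset.mem_sdiff, mC, mT]
    have := m1 x; have := m2 x; have := m3 x
    tauto
  have pf : ∀ x (hx : x ∈ B' \ T), π x = f ⟨x, hx⟩ := fun x hx => by simp only [π, dif_pos hx]
  have pg : ∀ x (hx : x ∈ C' \ T), π x = g ⟨x, hx⟩ := fun x hx => by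
    have h' : x ∉ B' \ T := by rw [hBT]; have := (hCT x).1 hx; tauto
    simp only [π, dif_neg h', dif_pos hx]
  have pid : ∀ x, x ∉ B' \ T → x ∉ C' \ T → π x = x := fun x h h' => by
    simp only [π, dif_neg h, dif_neg h']
  refine ⟨S₃.card, T.card, T, S₁, S₂, S₃, π, by omega, rfl, hS1c, hS2c, rfl, ?_, ?_, ?_, d12, d13,
    d23, ?_, ?_, ?_, ?_⟩
  · rw [Finset.disjoint_left]; intro x hx; exact ((mT x).1 hx).2.1
  · rw [Finset.disjoint_left]; intro x hx; exact ((mT x).1 hx).2.2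
  · rw [Finset.disjoint_left]; intro x hx; have := (mT x).1 hx; rw [m3]; tauto
  · have : A.image π = A.image id := by
      refine Finset.image_congr fun x hx => ?_
      have hx : x ∈ A := hx
      rw [pid x (by rw [hBT]; tauto) (by rw [hCT]; tauto)]; rfl
    rw [this, Finset.image_id, hT, Finset.sdiff_union_of_subset sA]
  · ext y
    simp only [Finset.mem_image, Finset.mem_union]
    constructor
    · rintro ⟨x, hx, rfl⟩
      by_cases h : x ∈ B' \ T
      · rw [pf x h]
        have := (f ⟨x, h⟩).2
        rw [Finset.mem_sdiff] at this
        exact Or.inl this.1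
      · have hh := h
        rw [hBT] at hh
        rw [pid x h (by rw [hCT]; tauto), mT, m3]
        have := m1 x
        tauto
    · have hid : ∀ y, y ∈ B → (y ∈ A ∨ y ∈ C) → π y = y := by
        intro y h h'
        exact pid y (by rw [hBT]; tauto) (by rw [hCT]; tauto)
      rintro (h | h | h)
      · by_cases hy : y ∈ B'
        · have := (mB y).1 hy
          have h' := (mT y).1 h
          exact ⟨y, this.1, hid y this.1 (Or.inl h'.1)⟩
        · have hy' : y ∈ T \ B' := Finset.mem_sdiff.2 ⟨h, hy⟩
          refine ⟨f.symm ⟨y, hy'⟩, ((hBT _).1 (f.symm ⟨y, hy'⟩).2).1, ?_⟩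
          rw [pf _ (f.symm ⟨y, hy'⟩).2]
          simp
      · have := m2 y h
        exact ⟨y, this.2.1, hid y this.2.1 (Or.inl this.1)⟩
      · have := (m3 y).1 h
        exact ⟨y, this.1, hid y this.1 (Or.inr this.2.1)⟩
  · ext y
    simp only [Finset.mem_image, Finset.mem_union]
    constructor
    · rintro ⟨x, hx, rfl⟩
      by_cases h : x ∈ C' \ T
      · rw [pg x h]
        have := (g ⟨x, h⟩).2
        rw [Finset.mem_sdiff] at this
        exact Or.inl this.1
      · have hh := h
        rw [hCT] at hh
        rw [pid x (by rw [hBT]; tauto) h, mT, m3]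
        have := m2 x
        tauto
    · have hid : ∀ y, y ∈ C → (y ∈ A ∨ y ∈ B) → π y = y := by
        intro y h h'
        exact pid y (by rw [hBT]; tauto) (by rw [hCT]; tauto)
      rintro (h | h | h)
      · by_cases hy : y ∈ C'
        · have := (mC y).1 hy
          have h' := (mT y).1 h
          exact ⟨y, this.1, hid y this.1 (Or.inl h'.1)⟩
        · have hy' : y ∈ T \ C' := Finset.mem_sdiff.2 ⟨h, hy⟩
          refine ⟨g.symm ⟨y, hy'⟩, ((hCT _).1 (g.symm ⟨y, hy'⟩).2).1, ?_⟩
          rw [pg _ (g.symm ⟨y, hy'⟩).2]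
          simp
      · have := m1 y h
        exact ⟨y, this.2.1, hid y this.2.1 (Or.inl this.1)⟩
      · have := (m3 y).1 h
        exact ⟨y, this.2.1, hid y this.2.1 (Or.inr this.1)⟩
  · intro h0
    have z1 : B'.card = 0 := by omega
    have z2 : C'.card = 0 := by omega
    rw [Finset.card_eq_zero, Finset.sdiff_eq_empty_iff_subset] at h0 z1 z2
    exact ⟨h0.antisymm sA, z1.antisymm sB, z2.antisymm sC⟩

/-- the abstract index set -/
abbrev EmJ (t s : ℕ) := Fin t ⊕ Fin s ⊕ Fin s ⊕ Fin s

/-- Labelling the parts -/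
theorem em_label {W : Type*} [DecidableEq W] {s t : ℕ} (T S₁ S₂ S₃ : Finset W) (hT : T.card = t)
    (h1 : S₁.card = s) (h2 : S₂.card = s) (h3 : S₃.card = s)
    (dT1 : Disjoint T S₁) (dT2 : Disjoint T S₂) (dT3 : Disjoint T S₃) (d12 : Disjoint S₁ S₂)
    (d13 : Disjoint S₁ S₃) (d23 : Disjoint S₂ S₃) :
    ∃ L : EmJ t s ↪ W, Finset.univ.image (fun i => L (Sum.inl i)) = T ∧
      Finset.univ.image (fun i => L (Sum.inr (Sum.inl i))) = S₁ ∧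
      Finset.univ.image (fun i => L (Sum.inr (Sum.inr (Sum.inl i)))) = S₂ ∧
      Finset.univ.image (fun i => L (Sum.inr (Sum.inr (Sum.inr i)))) = S₃ := by
  have im : ∀ {n : ℕ} (X : Finset W) (h : X.card = n),
      Finset.univ.image (fun i => ((X.equivFinOfCardEq h).symm i : W)) = X := by
    intro n X h
    ext y
    simp only [Finset.mem_image, Finset.mem_univ, true_and]
    constructor
    · rintro ⟨i, rfl⟩; exact Subtype.property _
    · intro hy; exact ⟨X.equivFinOfCardEq h ⟨y, hy⟩, by simp⟩
  have inj : ∀ {n : ℕ} (X : Finset W) (h : X.card = n),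
      Function.Injective (fun i => ((X.equivFinOfCardEq h).symm i : W)) :=
    fun X h => Subtype.val_injective.comp (Equiv.injective _)
  have mem : ∀ {n : ℕ} (X : Finset W) (h : X.card = n) i, ((X.equivFinOfCardEq h).symm i : W) ∈ X :=
    fun X h i => Subtype.property _
  have ne : ∀ {X Y : Finset W} {x y : W}, Disjoint X Y → x ∈ X → y ∈ Y → x ≠ y :=
    fun d hx hy h => Finset.disjoint_left.mp d hx (h ▸ hy)
  refine ⟨⟨Sum.elim (fun i => ((T.equivFinOfCardEq hT).symm i : W))
    (Sum.elim (fun i => ((S₁.equivFinOfCardEq h1).symm i : W))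
      (Sum.elim (fun i => ((S₂.equivFinOfCardEq h2).symm i : W))
        (fun i => ((S₃.equivFinOfCardEq h3).symm i : W)))), ?_⟩, im T hT, im S₁ h1, im S₂ h2, im S₃ h3⟩
  refine (inj T hT).sumElim ((inj S₁ h1).sumElim ((inj S₂ h2).sumElim (inj S₃ h3) ?_) ?_) ?_
  · intro i j
    exact ne d23 (mem _ _ _) (mem _ _ _)
  · rintro i (j | j)
    · exact ne d12 (mem _ _ _) (mem _ _ _)
    · exact ne d13 (mem _ _ _) (mem _ _ _)
  · rintro i (j | j | j)
    · exact ne dT1 (mem _ _ _) (mem _ _ _)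
    · exact ne dT2 (mem _ _ _) (mem _ _ _)
    · exact ne dT3 (mem _ _ _) (mem _ _ _)
end hom

section counting
open Finset BigOperators
variable {V : Type*} [Fintype V] [DecidableEq V]

theorem em_marginal [Nonempty V] {J I : Type*} [Fintype J] [Fintype I] [DecidableEq J] [DecidableEq I]
    (L : J ↪ I) (G : (J → V) → ℝ) : (𝔼 x : I → V, G (x ∘ L)) = 𝔼 y, G y := by
  classical
  let e : J ⊕ ↥(Set.range L)ᶜ ≃ I :=
    (Equiv.sumCongr (Equiv.ofInjective L L.injective) (Equiv.refl _)).trans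
      (Equiv.Set.sumCompl (Set.range L))
  have he : ∀ j, e (Sum.inl j) = L j := fun j => by simp [e]
  let E : (I → V) ≃ (J → V) × (↥(Set.range L)ᶜ → V) :=
    (Equiv.arrowCongr e.symm (Equiv.refl V)).trans (Equiv.sumArrowEquivProdArrow _ _ _)
  rw [Fintype.expect_equiv E (fun x => G (x ∘ L)) (fun p => G p.1) ?_]
  · rw [← Finset.univ_product_univ, Finset.expect_product]
    simp
  · intro x
    congr 1

/-- edge indicator -/
noncomputable def emG (H : Finset (Finset V)) {t s : ℕ} (τ : Fin t → V) (a b : Fin s → V) : ℝ :=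
  if univ.image τ ∪ (univ.image a ∪ univ.image b) ∈ H then 1 else 0

theorem emG_01 (H : Finset (Finset V)) {t s : ℕ} (τ : Fin t → V) (a b : Fin s → V) :
    emG H τ a b = 0 ∨ emG H τ a b = 1 := by unfold emG; split_ifs <;> simp

theorem emG_nonneg (H : Finset (Finset V)) {t s : ℕ} (τ : Fin t → V) (a b : Fin s → V) :
    0 ≤ emG H τ a b := by rcases emG_01 H τ a b with h | h <;> simp [h]

theorem emG_symm (H : Finset (Finset V)) {t s : ℕ} (τ : Fin t → V) (a b : Fin s → V) :
    emG H τ a b = emG H τ b a := by unfold emG; rw [union_comm (univ.image a)]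

/-- parity polynomial -/
def emPar (x y z : ℝ) : ℝ := x + y + z - 2 * (x * y + y * z + x * z) + 4 * (x * y * z)

theorem emPar_01 {x y z : ℝ} (hx : x = 0 ∨ x = 1) (hy : y = 0 ∨ y = 1) (hz : z = 0 ∨ z = 1) :
    emPar x y z = 0 ∨ emPar x y z = 1 := by
  unfold emPar
  rcases hx with rfl | rfl <;> rcases hy with rfl | rfl <;> rcases hz with rfl | rfl <;> norm_num

/-- parity defect of a configuration -/
noncomputable def emBad (H : Finset (Finset V)) {t s : ℕ} (τ : Fin t → V) (a b c : Fin s → V) : ℝ :=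
  emPar (emG H τ a b) (emG H τ b c) (emG H τ a c)

theorem em_split {t s : ℕ} (Φ : (Fin t → V) → (Fin s → V) → (Fin s → V) → (Fin s → V) → ℝ) :
    (𝔼 y : EmJ t s → V, Φ (fun i => y (Sum.inl i)) (fun i => y (Sum.inr (Sum.inl i)))
      (fun i => y (Sum.inr (Sum.inr (Sum.inl i)))) (fun i => y (Sum.inr (Sum.inr (Sum.inr i)))))
    = 𝔼 τ, 𝔼 a, 𝔼 b, 𝔼 c, Φ τ a b c := by
  let E : (EmJ t s → V) ≃ (Fin t → V) × (Fin s → V) × (Fin s → V) × (Fin s → V) :=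
    (Equiv.sumArrowEquivProdArrow _ _ _).trans (Equiv.prodCongr (Equiv.refl _)
      ((Equiv.sumArrowEquivProdArrow _ _ _).trans (Equiv.prodCongr (Equiv.refl _)
        (Equiv.sumArrowEquivProdArrow _ _ _))))
  rw [Fintype.expect_equiv E _ (fun p => Φ p.1 p.2.1 p.2.2.1 p.2.2.2) ?_]
  · simp_rw [← Finset.univ_product_univ, Finset.expect_product]
  · intro x
    rfl

theorem em_split3 {t s : ℕ} (Φ : (Fin t → V) → (Fin s → V) → (Fin s → V) → ℝ) :
    (𝔼 y : Fin t ⊕ Fin s ⊕ Fin s → V, Φ (fun i => y (Sum.inl i)) (fun i => y (Sum.inr (Sum.inl i)))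
      (fun i => y (Sum.inr (Sum.inr i))))
    = 𝔼 τ, 𝔼 a, 𝔼 b, Φ τ a b := by
  let E : (Fin t ⊕ Fin s ⊕ Fin s → V) ≃ (Fin t → V) × (Fin s → V) × (Fin s → V) :=
    (Equiv.sumArrowEquivProdArrow _ _ _).trans (Equiv.prodCongr (Equiv.refl _)
      (Equiv.sumArrowEquivProdArrow _ _ _))
  rw [Fintype.expect_equiv E _ (fun p => Φ p.1 p.2.1 p.2.2) ?_]
  · simp_rw [← Finset.univ_product_univ, Finset.expect_product]
  · intro x
    rfl

/-- index set with one extra point -/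
abbrev EmI (t s : ℕ) := EmJ t s ⊕ Unit

theorem em_pointwise (H : Finset (Finset V)) {t s : ℕ} (ht : 1 ≤ t) (x : EmI t s → V) :
    emG H (fun i => x (Sum.inl (Sum.inl i))) (fun i => x (Sum.inl (Sum.inr (Sum.inl i))))
      (fun i => x (Sum.inl (Sum.inr (Sum.inr (Sum.inl i))))) ≤
    ∑ L : EmJ t s ↪ EmI t s, emBad H (fun i => x (L (Sum.inl i))) (fun i => x (L (Sum.inr (Sum.inl i))))
      (fun i => x (L (Sum.inr (Sum.inr (Sum.inl i))))) (fun i => x (L (Sum.inr (Sum.inr (Sum.inr i))))) := by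
  have b01 : ∀ (τ : Fin t → V) (a b c : Fin s → V), emBad H τ a b c = 0 ∨ emBad H τ a b c = 1 :=
    fun τ a b c => emPar_01 (emG_01 _ _ _ _) (emG_01 _ _ _ _) (emG_01 _ _ _ _)
  have b0 : ∀ (τ : Fin t → V) (a b c : Fin s → V), 0 ≤ emBad H τ a b c := by
    intro τ a b c
    rcases b01 τ a b c with h | h <;> simp [h]
  rcases emG_01 H (fun i => x (Sum.inl (Sum.inl i))) (fun i => x (Sum.inl (Sum.inr (Sum.inl i))))
      (fun i => x (Sum.inl (Sum.inr (Sum.inr (Sum.inl i))))) with h | h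
  · rw [h]
    exact Finset.sum_nonneg fun L _ => b0 _ _ _ _
  rw [h]
  by_contra hlt
  rw [not_le] at hlt
  have hz : ∀ L : EmJ t s ↪ EmI t s, emBad H (fun i => x (L (Sum.inl i)))
      (fun i => x (L (Sum.inr (Sum.inl i)))) (fun i => x (L (Sum.inr (Sum.inr (Sum.inl i)))))
      (fun i => x (L (Sum.inr (Sum.inr (Sum.inr i))))) = 0 := by
    intro L
    rcases b01 (fun i => x (L (Sum.inl i)))
      (fun i => x (L (Sum.inr (Sum.inl i)))) (fun i => x (L (Sum.inr (Sum.inr (Sum.inl i)))))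
      (fun i => x (L (Sum.inr (Sum.inr (Sum.inr i))))) with h1 | h1
    · exact h1
    · exfalso
      have := Finset.single_le_sum (f := fun L : EmJ t s ↪ EmI t s =>
        emBad H (fun i => x (L (Sum.inl i)))
        (fun i => x (L (Sum.inr (Sum.inl i)))) (fun i => x (L (Sum.inr (Sum.inr (Sum.inl i)))))
        (fun i => x (L (Sum.inr (Sum.inr (Sum.inr i))))))
        (fun L _ => b0 _ _ _ _) (Finset.mem_univ L)
      simp only [h1] at this
      linarith
  have hg : ∀ (τ : Fin t → EmI t s) (a b : Fin s → EmI t s),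
      emG H (fun i => x (τ i)) (fun i => x (a i)) (fun i => x (b i)) =
      if (univ.image τ ∪ (univ.image a ∪ univ.image b)).image x ∈ H then 1 else 0 := by
    intro τ a b
    unfold emG
    simp only [Finset.image_union, Finset.image_image]
    rfl
  have key := em_zero (I := EmI t s) (t := t) (s := s) ht (by simp [EmI]; ring)
    (fun Q => if Q.image x ∈ H then 1 else 0) ?_
    (univ.image fun i => Sum.inl (Sum.inl i)) (univ.image fun i => Sum.inl (Sum.inr (Sum.inl i)))
    (univ.image fun i => Sum.inl (Sum.inr (Sum.inr (Sum.inl i))))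
    (univ.image fun i => Sum.inl (Sum.inr (Sum.inr (Sum.inr i))))
    ?_ ?_ ?_ ?_ ?_ ?_ ?_ ?_ ?_ ?_
  · rw [hg] at h
    split_ifs at h with hh
    · simp only [hh, if_true] at key
      exact absurd key (by decide)
    · norm_num at h
  · intro T A B C hT hA hB hC dTA dTB dTC dAB dAC dBC
    obtain ⟨L, l1, l2, l3, l4⟩ := em_label T A B C hT hA hB hC dTA dTB dTC dAB dAC dBC
    have := hz L
    unfold emBad at this
    rw [hg, hg, hg, l1, l2, l3, l4] at this
    unfold emPar at this
    split_ifs at this ⊢ <;> first | decide | (norm_num at this)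
  all_goals first
    | (rw [Finset.card_image_of_injective _ (fun i j h => by simpa using h)]; simp)
    | (rw [Finset.disjoint_left]; intro y hy hy'; simp only [Finset.mem_image, Finset.mem_univ, true_and] at hy hy';
       obtain ⟨i, rfl⟩ := hy; obtain ⟨j, hj⟩ := hy'; simp at hj)

/-- edge density -/
noncomputable def emP (H : Finset (Finset V)) (t s : ℕ) : ℝ :=
  𝔼 τ : Fin t → V, 𝔼 a : Fin s → V, 𝔼 b : Fin s → V, emG H τ a b

/-- density of the folded configuration -/
noncomputable def emEta (H : Finset (Finset V)) (t s : ℕ) : ℝ :=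
  𝔼 τ : Fin t → V, 𝔼 a : Fin s → V, 𝔼 b : Fin s → V, 𝔼 c : Fin s → V,
    emG H τ a b * emG H τ b c * emG H τ a c

theorem em_main_ineq [Nonempty V] (H : Finset (Finset V)) {t s : ℕ} (ht : 1 ≤ t) :
    emP H t s ≤ (Fintype.card (EmJ t s ↪ EmI t s) : ℝ) *
      (3 * emP H t s - 6 * emP H t s ^ 2 + 4 * emEta H t s) := by
  have h1 : (𝔼 x : EmI t s → V, emG H (fun i => x (Sum.inl (Sum.inl i)))
      (fun i => x (Sum.inl (Sum.inr (Sum.inl i))))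
      (fun i => x (Sum.inl (Sum.inr (Sum.inr (Sum.inl i)))))) = emP H t s := by
    refine (em_marginal (V := V) (J := EmJ t s) (I := EmI t s) Function.Embedding.inl
      (fun y => emG H (fun i => y (Sum.inl i)) (fun i => y (Sum.inr (Sum.inl i)))
        (fun i => y (Sum.inr (Sum.inr (Sum.inl i)))))).trans ?_
    rw [em_split (V := V) (fun τ a b _ => emG H τ a b)]
    simp [emP]
  have h2 : ∀ L : EmJ t s ↪ EmI t s, (𝔼 x : EmI t s → V,
      emBad H (fun i => x (L (Sum.inl i))) (fun i => x (L (Sum.inr (Sum.inl i))))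
      (fun i => x (L (Sum.inr (Sum.inr (Sum.inl i))))) (fun i => x (L (Sum.inr (Sum.inr (Sum.inr i))))))
      ≤ 3 * emP H t s - 6 * emP H t s ^ 2 + 4 * emEta H t s := by
    intro L
    refine (em_marginal (V := V) (J := EmJ t s) (I := EmI t s) L
      (fun y => emBad H (fun i => y (Sum.inl i)) (fun i => y (Sum.inr (Sum.inl i)))
        (fun i => y (Sum.inr (Sum.inr (Sum.inl i)))) (fun i => y (Sum.inr (Sum.inr (Sum.inr i)))))).le.trans ?_
    rw [em_split (V := V) (fun τ a b c => emBad H τ a b c)]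
    exact em_goodman (fun (τ : Fin t → V) (a b : Fin s → V) => emG H τ a b) (emG_symm H) (emG_nonneg H)
      (emP H t s) (emEta H t s) rfl rfl
  rw [← h1]
  refine (Finset.expect_le_expect fun x _ => em_pointwise H ht x).trans ?_
  rw [Finset.expect_sum_comm, h1]
  refine (Finset.sum_le_sum fun L _ => h2 L).trans ?_
  rw [Finset.sum_const, Finset.card_univ, nsmul_eq_mul]

theorem em_count (H : Finset (Finset V)) {R : Type*} [Fintype R] [DecidableEq R]
    (h : ∀ e ∈ H, e.card = Fintype.card R) :
    H.card * (Fintype.card R).factorial ≤ (univ.filter fun y : R → V => univ.image y ∈ H).card := by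
  have hm : Set.MapsTo (fun y : R → V => univ.image y)
      ((univ.filter fun y : R → V => univ.image y ∈ H : Finset (R → V)) : Set (R → V)) (H : Set (Finset V)) := by
    intro y hy
    simpa using hy
  rw [Finset.card_eq_sum_card_fiberwise hm]
  rw [← smul_eq_mul]
  refine Finset.card_nsmul_le_sum _ _ _ ?_
  intro e he
  have hc : Fintype.card R = Fintype.card e := by simp [h e he]
  have e0 : R ≃ e := Fintype.equivOfCardEq hc
  rw [← Fintype.card_equiv e0, ← Finset.card_univ]
  refine Finset.card_le_card_of_injOn (fun (f : R ≃ e) (i : R) => (f i : V)) ?_ ?_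
  · intro f _
    have : univ.image (fun i : R => (f i : V)) = e := by
      ext v
      simp only [Finset.mem_image, Finset.mem_univ, true_and]
      constructor
      · rintro ⟨i, rfl⟩; exact (f i).2
      · intro hv; exact ⟨f.symm ⟨v, hv⟩, by simp⟩
    simp [this, he]
  · intro f _ g _ hfg
    ext i
    exact congrFun hfg i

theorem em_P_ge (H : Finset (Finset V)) {t s r : ℕ} (hr : t + 2 * s = r) (h : ∀ e ∈ H, e.card = r) :
    (H.card : ℝ) * r.factorial / (Fintype.card V : ℝ) ^ r ≤ emP H t s := by
  have hR : Fintype.card (Fin t ⊕ Fin s ⊕ Fin s) = r := by simp; omega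
  have hc := em_count H (R := Fin t ⊕ Fin s ⊕ Fin s) (by rw [hR]; exact h)
  rw [hR] at hc
  unfold emP
  rw [← em_split3 (V := V) (fun τ a b => emG H τ a b), Fintype.expect_eq_sum_div_card]
  have hcard : (Fintype.card (Fin t ⊕ Fin s ⊕ Fin s → V) : ℝ) = (Fintype.card V : ℝ) ^ r := by
    rw [Fintype.card_fun, hR]; push_cast; rfl
  rw [hcard]
  refine div_le_div_of_nonneg_right ?_ (by positivity)
  have e1 : ∀ y : Fin t ⊕ Fin s ⊕ Fin s → V, emG H (fun i => y (Sum.inl i))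
      (fun i => y (Sum.inr (Sum.inl i))) (fun i => y (Sum.inr (Sum.inr i))) =
      if univ.image y ∈ H then 1 else 0 := by
    intro y
    unfold emG
    have : univ.image (fun i => y (Sum.inl i)) ∪ (univ.image (fun i => y (Sum.inr (Sum.inl i))) ∪
        univ.image (fun i => y (Sum.inr (Sum.inr i)))) = univ.image y := by
      ext v
      simp [Sum.exists]
    rw [this]
  simp only [e1]
  rw [Finset.sum_boole]
  exact_mod_cast hc
end counting
section assembly
open Finset BigOperators

/-- the three edges of the folded configuration on the abstract index set -/
def emK (t s : ℕ) : Finset (Finset (EmJ t s)) :=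
  {univ.image Sum.inl ∪ (univ.image (fun i => Sum.inr (Sum.inl i)) ∪
      univ.image (fun i => Sum.inr (Sum.inr (Sum.inl i)))),
    univ.image Sum.inl ∪ (univ.image (fun i => Sum.inr (Sum.inr (Sum.inl i))) ∪
      univ.image (fun i => Sum.inr (Sum.inr (Sum.inr i)))),
    univ.image Sum.inl ∪ (univ.image (fun i => Sum.inr (Sum.inl i)) ∪
      univ.image (fun i => Sum.inr (Sum.inr (Sum.inr i))))}

/-- indicator of the folded configuration -/
noncomputable def emf {V : Type*} [DecidableEq V] (H : Finset (Finset V)) {t s : ℕ}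
    (y : EmJ t s → V) : ℝ :=
  emG H (fun i => y (Sum.inl i)) (fun i => y (Sum.inr (Sum.inl i)))
      (fun i => y (Sum.inr (Sum.inr (Sum.inl i)))) *
    emG H (fun i => y (Sum.inl i)) (fun i => y (Sum.inr (Sum.inr (Sum.inl i))))
      (fun i => y (Sum.inr (Sum.inr (Sum.inr i)))) *
    emG H (fun i => y (Sum.inl i)) (fun i => y (Sum.inr (Sum.inl i)))
      (fun i => y (Sum.inr (Sum.inr (Sum.inr i))))

theorem emf_nonneg {n : ℕ} (H : Finset (Finset (Fin n))) {t s : ℕ}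
    (y : EmJ t s → Fin n) : 0 ≤ emf H y :=
  mul_nonneg (mul_nonneg (emG_nonneg _ _ _ _) (emG_nonneg _ _ _ _)) (emG_nonneg _ _ _ _)

theorem emf_le_one {n : ℕ} (H : Finset (Finset (Fin n))) {t s : ℕ}
    (y : EmJ t s → Fin n) : emf H y ≤ 1 := by
  have h : ∀ (τ : Fin t → Fin n) (a b : Fin s → Fin n), emG H τ a b ≤ 1 := fun τ a b => by
    rcases emG_01 H τ a b with h | h <;> simp [h]
  exact mul_le_one₀ (mul_le_one₀ (h _ _ _) (emG_nonneg _ _ _ _) (h _ _ _)) (emG_nonneg _ _ _ _) (h _ _ _)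

theorem emf_mem {n : ℕ} (H : Finset (Finset (Fin n))) {t s : ℕ}
    (y : EmJ t s → Fin n) (hy : emf H y ≠ 0) : ∀ X ∈ emK t s, X.image y ∈ H := by
  have h : ∀ (τ : Fin t → Fin n) (a b : Fin s → Fin n), emG H τ a b ≠ 0 →
      univ.image τ ∪ (univ.image a ∪ univ.image b) ∈ H := by
    intro τ a b hne
    unfold emG at hne
    by_contra hc
    rw [if_neg hc] at hne
    exact hne rfl
  unfold emf at hy
  have h3 := right_ne_zero_of_mul hy
  have h12 := left_ne_zero_of_mul hy
  have h2 := right_ne_zero_of_mul h12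
  have h1 := left_ne_zero_of_mul h12
  intro X hX
  unfold emK at hX
  simp only [Finset.mem_insert, Finset.mem_singleton] at hX
  rcases hX with rfl | rfl | rfl
  · rw [Finset.image_union, Finset.image_union, Finset.image_image, Finset.image_image,
      Finset.image_image]
    exact h _ _ _ h1
  · rw [Finset.image_union, Finset.image_union, Finset.image_image, Finset.image_image,
      Finset.image_image]
    exact h _ _ _ h2
  · rw [Finset.image_union, Finset.image_union, Finset.image_image, Finset.image_image,
      Finset.image_image]
    exact h _ _ _ h3

theorem em_copy {n m t s Q : ℕ} (ht : 1 ≤ t) (q : EmJ t s ≃ Fin Q) (F : Finset (Finset (Fin m)))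
    (hF : ∀ e ∈ F, e.card = t + 2 * s) (π : Fin m → EmJ t s) (hπ : ∀ e ∈ F, e.image π ∈ emK t s)
    (hinj : ∀ e ∈ F, Set.InjOn π e) (H : Finset (Finset (Fin n)))
    (ψ : Fin Q → Fin m → Fin n) (hψ : Function.Injective (Function.uncurry ψ))
    (hf : ∀ σ : Fin Q → Fin m, emf H (fun j => ψ (q j) (σ (q j))) ≠ 0) : HasCopy H F := by
  refine ⟨fun v => ψ (q (π v)) v, ?_, ?_⟩
  · intro v _ w _ h
    have := @hψ (q (π v), v) (q (π w), w) h
    exact (Prod.ext_iff.1 this).2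
  · intro e he
    have hne : e.Nonempty := by
      rw [← Finset.card_pos, hF e he]; omega
    obtain ⟨v0, _⟩ := hne
    have : Nonempty (Fin m) := ⟨v0⟩
    have hi : Set.InjOn (fun v => q (π v)) (e : Set (Fin m)) := fun v hv w hw h =>
      hinj e he hv hw (q.injective h)
    have hl := hi.leftInvOn_invFunOn
    have := emf_mem H _ (hf (Function.invFunOn (fun v => q (π v)) (e : Set (Fin m)))) _ (hπ e he)
    rw [Finset.image_image] at this
    convert this using 1
    refine Finset.image_congr fun v hv => ?_
    have h2 : Function.invFunOn (fun v => q (π v)) (e : Set (Fin m)) (q (π v)) = v := hl hv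
    simp only [Function.comp, h2]

theorem em_super {n m t s : ℕ} (hn : 1 ≤ n) (ht : 1 ≤ t) (F : Finset (Finset (Fin m)))
    (hF : ∀ e ∈ F, e.card = t + 2 * s) (π : Fin m → EmJ t s) (hπ : ∀ e ∈ F, e.image π ∈ emK t s)
    (hinj : ∀ e ∈ F, Set.InjOn π e) (H : Finset (Finset (Fin n))) (hH : ¬ HasCopy H F) :
    emEta H t s ^ (m ^ Fintype.card (EmJ t s)) ≤
      1 - (n.descFactorial (Fintype.card (EmJ t s) * m) : ℝ) /
        (n : ℝ) ^ (Fintype.card (EmJ t s) * m) := by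
  classical
  have : Nonempty (Fin n) := ⟨⟨0, hn⟩⟩
  obtain ⟨Q, hQ⟩ : ∃ Q, Fintype.card (EmJ t s) = Q := ⟨_, rfl⟩
  rw [hQ]
  have q : EmJ t s ≃ Fin Q := Fintype.equivFinOfCardEq hQ
  clear hQ
  have e1 : emEta H t s = 𝔼 y : Fin Q → Fin n, emf H (fun j => y (q j)) := by
    unfold emEta
    rw [← em_split (V := Fin n) (fun τ a b c => emG H τ a b * emG H τ b c * emG H τ a c)]
    refine Fintype.expect_equiv (Equiv.arrowCongr q (Equiv.refl _)) _ _ ?_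
    intro y
    simp [emf]
  rw [e1]
  refine (em_blowup m Q (fun y : Fin Q → Fin n => emf H (fun j => y (q j)))
    (fun y => emf_nonneg _ _)).trans ?_
  have e2 : ∀ ψ : Fin Q → Fin m → Fin n,
      ∏ σ : Fin Q → Fin m, emf H (fun j => ψ (q j) (σ (q j))) ≤
        1 - (if Function.Injective (Function.uncurry ψ) then (1 : ℝ) else 0) := by
    intro ψ
    split_ifs with h
    · rw [sub_self]
      have : ∃ σ : Fin Q → Fin m, emf H (fun j => ψ (q j) (σ (q j))) = 0 := by
        by_contra hc
        push Not at hc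
        exact hH (em_copy ht q F hF π hπ hinj H ψ h hc)
      obtain ⟨σ, hσ⟩ := this
      rw [Finset.prod_eq_zero (Finset.mem_univ σ) hσ]
    · rw [sub_zero]
      exact Finset.prod_le_one (fun σ _ => emf_nonneg _ _) (fun σ _ => emf_le_one _ _)
  refine (Finset.expect_le_expect fun ψ _ => e2 ψ).trans ?_
  rw [Finset.expect_sub_distrib, Fintype.expect_const]
  refine sub_le_sub_left ?_ _
  rw [Fintype.expect_eq_sum_div_card, Finset.sum_boole]
  have hcard : (Fintype.card (Fin Q → Fin m → Fin n) : ℝ) = (n : ℝ) ^ (Q * m) := by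
    rw [Fintype.card_fun, Fintype.card_fun, Fintype.card_fin, Fintype.card_fin, Fintype.card_fin,
      ← pow_mul, mul_comm m Q]
    push_cast
    rfl
  rw [hcard]
  refine div_le_div_of_nonneg_right ?_ (by positivity)
  have : n.descFactorial (Q * m) = Fintype.card (Fin Q × Fin m ↪ Fin n) := by
    rw [Fintype.card_embedding_eq, Fintype.card_prod, Fintype.card_fin, Fintype.card_fin,
      Fintype.card_fin]
  rw [this, ← Finset.card_univ]
  norm_cast
  refine Finset.card_le_card_of_injOn (fun f i j => f (i, j)) ?_ ?_
  · intro f _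
    simp only [Finset.coe_filter, Finset.mem_univ, true_and, Set.mem_ofPred_eq]
    exact f.injective
  · intro f _ g _ h
    ext ⟨i, j⟩
    exact congrArg Fin.val (congrFun (congrFun h i) j)

theorem em_desc (K : ℕ) :
    Tendsto (fun n : ℕ => (n.descFactorial K : ℝ) / (n : ℝ) ^ K) atTop (nhds 1) := by
  have h := isEquivalent_descFactorial K
  rw [Asymptotics.isEquivalent_iff_tendsto_one] at h
  · exact h
  · filter_upwards [eventually_ge_atTop 1] with n hn
    have : (0 : ℝ) < n := by exact_mod_cast hn
    positivity

theorem em_final {m t s r : ℕ} (ht : 1 ≤ t) (hr : t + 2 * s = r) (F : Finset (Finset (Fin m)))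
    (hF : ∀ e ∈ F, e.card = r) (π : Fin m → EmJ t s) (hπ : ∀ e ∈ F, e.image π ∈ emK t s)
    (hinj : ∀ e ∈ F, Set.InjOn π e) : turanDensity r F < 1 / 2 := by
  obtain ⟨C, hC⟩ : ∃ C : ℝ, C = (Fintype.card (EmJ t s ↪ EmI t s) : ℝ) := ⟨_, rfl⟩
  have hC1 : 1 ≤ C := by
    have : 0 < Fintype.card (EmJ t s ↪ EmI t s) := Fintype.card_pos_iff.2 ⟨Function.Embedding.inl⟩
    rw [hC]
    exact_mod_cast this
  obtain ⟨δ, hδ⟩ : ∃ δ : ℝ, δ = 1 / (12 * C) := ⟨_, rfl⟩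
  have hδC : δ * C = 1 / 12 := by rw [hδ]; field_simp
  have hδ0 : 0 < δ := by rw [hδ]; positivity
  have hδ1 : δ ≤ 1 / 12 := by nlinarith
  suffices h : turanDensity r F ≤ 1 / 2 - δ / 2 by linarith
  apply em_limit
  have ev1 : ∀ᶠ n : ℕ in atTop, (1 : ℝ) - (n.descFactorial (Fintype.card (EmJ t s) * m) : ℝ) /
        (n : ℝ) ^ (Fintype.card (EmJ t s) * m) < (1 / (32 * C)) ^ (m ^ Fintype.card (EmJ t s)) := by
    have := (em_desc (Fintype.card (EmJ t s) * m)).const_sub 1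
    rw [sub_self] at this
    exact this.eventually_lt_const (by positivity)
  have ev2 : ∀ᶠ n : ℕ in atTop, 1 - δ < (n.descFactorial r : ℝ) / (n : ℝ) ^ r :=
    (em_desc r).eventually_const_lt (by linarith)
  filter_upwards [ev1, ev2, eventually_ge_atTop 1, eventually_ge_atTop r] with n h1 h2 hn hnr
  have hnpos : (0 : ℝ) < n := by exact_mod_cast hn
  have hch : (0 : ℝ) < n.choose r := by exact_mod_cast Nat.choose_pos hnr
  rw [div_le_iff₀ hch]
  have key : exNum r n F ≤ ⌊(1 / 2 - δ / 2) * (n.choose r : ℝ)⌋₊ := by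
    apply em_le_of
    intro H hH hfree
    apply Nat.le_floor
    have : Nonempty (Fin n) := ⟨⟨0, hn⟩⟩
    have i1 := em_main_ineq H (t := t) (s := s) ht
    have i2 := em_super hn ht F (by rw [hr]; exact hF) π hπ hinj H hfree
    have i3 := em_P_ge H hr hH
    rw [← hC] at i1
    have hη : emEta H t s < 1 / (32 * C) := lt_of_pow_lt_pow_left₀ _ (by positivity) (i2.trans_lt h1)
    have hη' : C * emEta H t s < 1 / 32 := by
      rw [lt_div_iff₀ (by positivity)] at hη
      linarith
    have hp : emP H t s ≤ 1 / 2 - δ := by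
      by_contra hcon
      rw [not_le] at hcon
      generalize emP H t s = p at *
      generalize emEta H t s = η at *
      have a : C * (6 * p * (1 / 2 - p)) ≤ C * (6 * p * δ) := by
        apply mul_le_mul_of_nonneg_left _ (by linarith)
        apply mul_le_mul_of_nonneg_left <;> linarith
      have b : C * (6 * p * δ) = p / 2 := by
        have : C * (6 * p * δ) = 6 * p * (δ * C) := by ring
        rw [this, hδC]; ring
      nlinarith
    rw [Fintype.card_fin] at i3
    have i4 := i3.trans hp
    rw [div_le_iff₀ (by positivity)] at i4
    rw [lt_div_iff₀ (by positivity), Nat.descFactorial_eq_factorial_mul_choose] at h2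
    push_cast at h2
    have hf : (0 : ℝ) < r.factorial := by exact_mod_cast Nat.factorial_pos r
    have hnr : (0 : ℝ) < (n : ℝ) ^ r := by positivity
    generalize (n : ℝ) ^ r = N at *
    have i5 : (1 / 2 - δ) * N ≤ (1 / 2 - δ / 2) * ((1 - δ) * N) := by nlinarith [mul_pos hδ0 hδ0]
    have i6 : (1 / 2 - δ / 2) * ((1 - δ) * N) ≤ (1 / 2 - δ / 2) * (r.factorial * n.choose r) :=
      mul_le_mul_of_nonneg_left h2.le (by linarith)
    refine le_of_mul_le_mul_right ?_ hf
    calc _ ≤ _ := i4.trans (i5.trans i6)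
      _ = _ := by ring
  calc (exNum r n F : ℝ) ≤ (⌊(1 / 2 - δ / 2) * (n.choose r : ℝ)⌋₊ : ℝ) := by exact_mod_cast key
    _ ≤ _ := Nat.floor_le (mul_nonneg (by linarith) hch.le)

theorem em_iso {k m : ℕ} (hk : 1 ≤ k) (A B C S₁ S₂ S₃ : Finset (Fin m)) (h1 : S₁.card = k)
    (h2 : S₂.card = k) (h3 : S₃.card = k) (d12 : Disjoint S₁ S₂) (d13 : Disjoint S₁ S₃)
    (d23 : Disjoint S₂ S₃) (hA : A = S₁ ∪ S₂) (hB : B = S₂ ∪ S₃) (hC : C = S₁ ∪ S₃) :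
    IsIsoTo ({A, B, C} : Finset (Finset (Fin m))) (expTriangle k) := by
  obtain ⟨L, -, l1, l2, l3⟩ := em_label (t := 0) ∅ S₁ S₂ S₃ rfl h1 h2 h3 (by simp) (by simp) (by simp)
    d12 d13 d23
  have : Nonempty (EmJ 0 k) := ⟨Sum.inr (Sum.inl ⟨0, hk⟩)⟩
  let g : EmJ 0 k → Fin (3 * k) := Sum.elim (fun i => i.elim0)
    (Sum.elim (fun i => ⟨i, by omega⟩) (Sum.elim (fun i => ⟨k + i, by omega⟩) (fun i => ⟨2 * k + i, by omega⟩)))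
  have hg : Function.Injective g := by
    rintro (a | a | a | a) (b | b | b | b) h
    all_goals first | exact a.elim0 | exact b.elim0 | skip
    all_goals
      simp only [g, Sum.elim_inl, Sum.elim_inr, Fin.mk.injEq] at h
      first
      | (exfalso; have := a.isLt; have := b.isLt; omega)
      | (have : a = b := Fin.ext (by omega)
         rw [this])
  have hinv : ∀ x, Function.invFun L (L x) = x := Function.leftInverse_invFun L.injective
  let φ : Fin m → Fin (3 * k) := fun v => g (Function.invFun L v)
  have hφ : ∀ x, φ (L x) = g x := fun x => by simp only [φ, hinv]
  let S : ℕ → Finset (Fin (3 * k)) :=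
    fun a => Finset.univ.filter fun v => a * k ≤ v.val ∧ v.val < (a + 1) * k
  have s1 : S₁.image φ = S 0 := by
    rw [← l1, Finset.image_image]
    ext v
    simp only [Finset.mem_image, Finset.mem_univ, true_and, Function.comp, hφ, S, Finset.mem_filter]
    constructor
    · rintro ⟨i, rfl⟩
      have := i.isLt
      simp only [g, Sum.elim_inl, Sum.elim_inr]
      omega
    · intro hv
      refine ⟨⟨v.val, by omega⟩, Fin.ext ?_⟩
      simp only [g, Sum.elim_inl, Sum.elim_inr]
  have s2 : S₂.image φ = S 1 := by
    rw [← l2, Finset.image_image]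
    ext v
    simp only [Finset.mem_image, Finset.mem_univ, true_and, Function.comp, hφ, S, Finset.mem_filter]
    constructor
    · rintro ⟨i, rfl⟩
      have := i.isLt
      simp only [g, Sum.elim_inl, Sum.elim_inr]
      omega
    · intro hv
      refine ⟨⟨v.val - k, by omega⟩, Fin.ext ?_⟩
      simp only [g, Sum.elim_inl, Sum.elim_inr]
      omega
  have s3 : S₃.image φ = S 2 := by
    rw [← l3, Finset.image_image]
    ext v
    simp only [Finset.mem_image, Finset.mem_univ, true_and, Function.comp, hφ, S, Finset.mem_filter]
    constructor
    · rintro ⟨i, rfl⟩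
      have := i.isLt
      simp only [g, Sum.elim_inl, Sum.elim_inr]
      omega
    · intro hv
      refine ⟨⟨v.val - 2 * k, by omega⟩, Fin.ext ?_⟩
      simp only [g, Sum.elim_inl, Sum.elim_inr]
      omega
  have hex : expTriangle k = {S 0 ∪ S 1, S 1 ∪ S 2, S 2 ∪ S 0} := rfl
  refine ⟨φ, ?_, ?_⟩
  · have hr : ∀ v ∈ (⋃ e ∈ ({A, B, C} : Finset (Finset (Fin m))), (e : Set (Fin m))), ∃ x, L x = v := by
      intro v hv
      have hv' : v ∈ S₁ ∨ v ∈ S₂ ∨ v ∈ S₃ := by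
        simp only [Set.mem_iUnion, Finset.mem_insert, Finset.mem_singleton, exists_prop] at hv
        obtain ⟨e, he, hv⟩ := hv
        rw [Finset.mem_coe] at hv
        rcases he with rfl | rfl | rfl
        · rw [hA, Finset.mem_union] at hv; tauto
        · rw [hB, Finset.mem_union] at hv; tauto
        · rw [hC, Finset.mem_union] at hv; tauto
      rw [← l1, ← l2, ← l3] at hv'
      simp only [Finset.mem_image, Finset.mem_univ, true_and] at hv'
      rcases hv' with ⟨i, h⟩ | ⟨i, h⟩ | ⟨i, h⟩ <;> exact ⟨_, h⟩
    intro v hv w hw h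
    obtain ⟨x, rfl⟩ := hr v hv
    obtain ⟨y, rfl⟩ := hr w hw
    rw [hφ, hφ] at h
    rw [hg h]
  · rw [hex, Finset.image_insert, Finset.image_insert, Finset.image_singleton, hA, hB, hC,
      Finset.image_union, Finset.image_union, Finset.image_union, s1, s2, s3, Finset.union_comm (S 0) (S 2)]

theorem em_case {k m r : ℕ} (hk : 1 ≤ k) (hrk : r = 2 * k) (A B C : Finset (Fin m)) (hA : A.card = r)
    (hB : B.card = r) (hC : C.card = r) (h1 : (B ∩ C).card ≤ (A ∩ B).card)
    (h2 : (B ∩ C).card ≤ (A ∩ C).card)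
    (hniso : ¬ IsIsoTo ({A, B, C} : Finset (Finset (Fin m))) (expTriangle k)) :
    turanDensity r ({A, B, C} : Finset (Finset (Fin m))) < 1 / 2 := by
  obtain ⟨s, t, T, S₁, S₂, S₃, π, hr, cT, c1, c2, c3, dT1, dT2, dT3, d12, d13, d23, iA, iB, iC, hz⟩ :=
    em_fold A B C hA hB hC h1 h2
  rcases Nat.eq_zero_or_pos t with h0 | ht
  · obtain ⟨eA, eB, eC⟩ := hz h0
    have hs : s = k := by omega
    subst hs
    exact absurd (em_iso hk A B C S₁ S₂ S₃ c1 c2 c3 d12 d13 d23 eA eB eC) hniso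
  obtain ⟨L, l0, l1, l2, l3⟩ := em_label T S₁ S₂ S₃ cT c1 c2 c3 dT1 dT2 dT3 d12 d13 d23
  have : Nonempty (EmJ t s) := ⟨Sum.inl ⟨0, ht⟩⟩
  have hinv : ∀ x, Function.invFun L (L x) = x := Function.leftInverse_invFun L.injective
  have im : ∀ {n : ℕ} (X : Finset (Fin m)) (f : Fin n → EmJ t s),
      univ.image (fun i => L (f i)) = X → X.image (Function.invFun L) = univ.image f := by
    intro n X f hX
    rw [← hX, Finset.image_image]
    refine Finset.image_congr fun i _ => ?_
    exact hinv _
  have hm : ∀ e ∈ ({A, B, C} : Finset (Finset (Fin m))),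
      e.image (fun v => Function.invFun L (π v)) ∈ emK t s := by
    intro e he
    have hc : e.image (fun v => Function.invFun L (π v)) = (e.image π).image (Function.invFun L) := by
      rw [Finset.image_image]; rfl
    rw [hc]
    unfold emK
    simp only [Finset.mem_insert, Finset.mem_singleton] at he ⊢
    rcases he with rfl | rfl | rfl
    · left
      rw [iA, Finset.image_union, Finset.image_union, im T _ l0, im S₁ _ l1, im S₂ _ l2]
    · right; left
      rw [iB, Finset.image_union, Finset.image_union, im T _ l0, im S₂ _ l2, im S₃ _ l3]
    · right; right
      rw [iC, Finset.image_union, Finset.image_union, im T _ l0, im S₁ _ l1, im S₃ _ l3]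
  have hF : ∀ e ∈ ({A, B, C} : Finset (Finset (Fin m))), e.card = r := by
    intro e he
    simp only [Finset.mem_insert, Finset.mem_singleton] at he
    rcases he with rfl | rfl | rfl <;> assumption
  have hK : ∀ X ∈ emK t s, X.card = r := by
    intro X hX
    unfold emK at hX
    simp only [Finset.mem_insert, Finset.mem_singleton] at hX
    have cc : ∀ {n : ℕ} (f : Fin n → EmJ t s), Function.Injective f → (univ.image f).card = n := by
      intro n f hf
      rw [Finset.card_image_of_injective _ hf, Finset.card_univ, Fintype.card_fin]
    rcases hX with rfl | rfl | rfl
    all_goals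
      rw [Finset.card_union_of_disjoint, Finset.card_union_of_disjoint, cc, cc, cc]
      · omega
      all_goals first
      | (intro i j h; simpa using h)
      | (rw [Finset.disjoint_left]; intro y hy hy'
         simp only [Finset.mem_union, Finset.mem_image, Finset.mem_univ, true_and] at hy hy'
         obtain ⟨i, rfl⟩ := hy
         simp at hy')
  refine em_final ht hr _ hF (fun v => Function.invFun L (π v)) hm ?_
  intro e he
  rw [← Finset.card_image_iff, hK _ (hm e he), hF e he]
end assembly

/-- For even `r = 2k`, every `r`-graph with three edges other than the expanded triangle
has Turán density below one half. -/
theorem even_mantel (r k : ℕ) (hk : 1 ≤ k) (hrk : r = 2 * k) {m : ℕ}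
    (F : Finset (Finset (Fin m))) (hunif : ∀ e ∈ F, e.card = r) (hcard : F.card = 3)
    (hniso : ¬ IsIsoTo F (expTriangle k)) :
    turanDensity r F < 1 / 2 := by
  obtain ⟨A, B, C, hAB, hAC, hBC, rfl⟩ := Finset.card_eq_three.1 hcard
  have hA : A.card = r := hunif A (by simp)
  have hB : B.card = r := hunif B (by simp)
  have hC : C.card = r := hunif C (by simp)
  have p1 : ({A, B, C} : Finset (Finset (Fin m))) = {B, A, C} := by ext x; simp; tauto
  have p2 : ({A, B, C} : Finset (Finset (Fin m))) = {C, A, B} := by ext x; simp; tauto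
  have c1 : (A ∩ B).card = (B ∩ A).card := by rw [Finset.inter_comm]
  have c2 : (A ∩ C).card = (C ∩ A).card := by rw [Finset.inter_comm]
  have c3 : (B ∩ C).card = (C ∩ B).card := by rw [Finset.inter_comm]
  by_cases h1 : (B ∩ C).card ≤ (A ∩ B).card ∧ (B ∩ C).card ≤ (A ∩ C).card
  · exact em_case hk hrk A B C hA hB hC h1.1 h1.2 hniso
  by_cases h2 : (A ∩ C).card ≤ (A ∩ B).card ∧ (A ∩ C).card ≤ (B ∩ C).card
  · rw [p1] at hniso ⊢
    exact em_case hk hrk B A C hB hA hC (by omega) (by omega) hniso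
  · rw [p2] at hniso ⊢
    exact em_case hk hrk C A B hC hA hB (by omega) (by omega) hniso
end

section
/- Let r ≥ 2 be an integer and let F₁ be an r-uniform hypergraph with exactly three edges, no isolated vertices, and minimum degree exactly 1. Then there exists an r-uniform hypergraph F₂ with exactly three edges and minimum degree at least 2 such that there is a homomorphism from F₁ to F₂. -/
open Filter

theorem aux_img {α : Type*} [DecidableEq α] (P Q : Finset α) (h : P.card = Q.card) :
    ∃ f : α → α, P.image f = Q := by
  let e := Finset.equivOfCardEq h
  refine ⟨fun x => if hx : x ∈ P then (e ⟨x, hx⟩ : α) else x, ?_⟩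
  ext y
  simp only [Finset.mem_image]
  constructor
  · rintro ⟨x, hx, rfl⟩
    simp [hx]
  · intro hy
    refine ⟨(e.symm ⟨y, hy⟩ : α), (e.symm ⟨y, hy⟩).2, ?_⟩
    simp

theorem aux_target {α : Type*} [DecidableEq α] (r : ℕ) (C D M N : Finset α) (hC : C.card = r)
    (hD : Disjoint C D) (hM : M ⊆ C) (hN : N ⊆ C) (hMN : Disjoint M N)
    (hcM : M.card = D.card) (hcN : N.card = D.card) (hpos : 0 < D.card) :
    let F : Finset (Finset α) := {C, (C \ M) ∪ D, (C \ N) ∪ D}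
    (∀ e ∈ F, e.card = r) ∧ F.card = 3 ∧
      (∀ v, (∃ e ∈ F, v ∈ e) → 2 ≤ hypDegree F v) := by
  intro F
  obtain ⟨d, hd⟩ := Finset.card_pos.1 hpos
  obtain ⟨x, hx⟩ := Finset.card_pos.1 (hcM ▸ hpos)
  obtain ⟨y, hy⟩ := Finset.card_pos.1 (hcN ▸ hpos)
  rw [Finset.disjoint_left] at hD hMN
  have card_aux : ∀ K : Finset α, K ⊆ C → K.card = D.card → ((C \ K) ∪ D).card = r := by
    intro K hK hc
    rw [Finset.card_union_of_disjoint, Finset.card_sdiff_of_subset hK]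
    · have := Finset.card_le_card hK
      omega
    · rw [Finset.disjoint_left]
      intro a ha
      exact hD (Finset.mem_sdiff.1 ha).1
  have h1 : C ≠ (C \ M) ∪ D := by
    intro h
    exact hD (h ▸ Finset.mem_union_right _ hd) hd
  have h2 : C ≠ (C \ N) ∪ D := by
    intro h
    exact hD (h ▸ Finset.mem_union_right _ hd) hd
  have h3 : (C \ M) ∪ D ≠ (C \ N) ∪ D := by
    intro h
    have hxN := hMN hx
    have : x ∈ (C \ N) ∪ D := by simp [hM hx, hxN]
    rw [← h] at this
    have hxD := hD (hM hx)
    simp [hx, hxD] at this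
  refine ⟨?_, ?_, ?_⟩
  · intro e he
    simp only [F, Finset.mem_insert, Finset.mem_singleton] at he
    rcases he with rfl | rfl | rfl
    · exact hC
    · exact card_aux M hM hcM
    · exact card_aux N hN hcN
  · exact Finset.card_eq_three.2 ⟨_, _, _, h1, h2, h3, rfl⟩
  · rintro v ⟨e, he, hv⟩
    have key : ∀ X Y : Finset α, X ∈ F → Y ∈ F → X ≠ Y → v ∈ X → v ∈ Y →
        2 ≤ hypDegree F v := by
      intro X Y hX hY hne hvX hvY
      unfold hypDegree
      have : ({X, Y} : Finset (Finset α)) ⊆ F.filter fun e => v ∈ e := by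
        intro Z hZ
        simp only [Finset.mem_insert, Finset.mem_singleton] at hZ
        rcases hZ with rfl | rfl <;> simp [*]
      calc 2 = _ := (Finset.card_pair hne).symm
        _ ≤ _ := Finset.card_le_card this
    have m1 : C ∈ F := by simp [F]
    have m2 : (C \ M) ∪ D ∈ F := by simp [F]
    have m3 : (C \ N) ∪ D ∈ F := by simp [F]
    by_cases hvD : v ∈ D
    · exact key _ _ m2 m3 h3 (by simp [hvD]) (by simp [hvD])
    · have hvC : v ∈ C := by
        simp only [F, Finset.mem_insert, Finset.mem_singleton] at he
        rcases he with rfl | rfl | rfl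
        · exact hv
        · simp [hvD] at hv; exact hv.1
        · simp [hvD] at hv; exact hv.1
      by_cases hvM : v ∈ M
      · exact key _ _ m1 m3 h2 hvC (by simp [hvC, hMN hvM])
      · exact key _ _ m1 m2 h1 hvC (by simp [hvC, hvM])

set_option maxHeartbeats 4000000 in
theorem aux_main {α : Type*} [DecidableEq α] (r : ℕ) (hr : 2 ≤ r) (A B C : Finset α)
    (hA : A.card = r) (hB : B.card = r) (hC : C.card = r) (hAC : A ≠ C)
    (hm1 : ((A ∩ B) \ C).card ≤ ((B ∩ C) \ A).card)
    (hm2 : ((A ∩ B) \ C).card ≤ ((A ∩ C) \ B).card) :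
    ∃ F : Finset (Finset α), (∀ e ∈ F, e.card = r) ∧ F.card = 3 ∧
      (∀ v, (∃ e ∈ F, v ∈ e) → 2 ≤ hypDegree F v) ∧
      ∃ φ : α → α, A.image φ ∈ F ∧ B.image φ ∈ F ∧ C.image φ ∈ F := by
  obtain ⟨M, hM, hcM⟩ := Finset.exists_subset_card_eq hm1
  obtain ⟨N, hN, hcN⟩ := Finset.exists_subset_card_eq hm2
  have cnt : ∀ A B M : Finset α, A.card = r → M ⊆ (B ∩ C) \ A → M.card = ((A ∩ B) \ C).card →
      (A \ (B ∪ C)).card = ((C \ A) \ M).card := by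
    intro A B M hA hM hc
    have e1 := Finset.card_sdiff_add_card_inter A C
    have e2 := Finset.card_sdiff_add_card_inter C A
    have e3 := Finset.card_sdiff_add_card_inter (A \ C) B
    have e4 : (A \ C) \ B = A \ (B ∪ C) := by ext; simp; tauto
    have e5 : (A \ C) ∩ B = (A ∩ B) \ C := by ext; simp; tauto
    have hMs : M ⊆ C \ A := by
      intro z hz; have := hM hz; simp at this ⊢; tauto
    have e6 := Finset.card_sdiff_add_card_eq_card hMs
    rw [e4, e5] at e3
    rw [Finset.inter_comm] at e2
    omega
  obtain ⟨f, hf⟩ := aux_img _ _ (cnt A B M hA hM hcM)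
  obtain ⟨g, hg⟩ := aux_img _ _ (cnt B A N hB hN (by rw [hcN, Finset.inter_comm]))
  let φ : α → α := fun x => if x ∈ C then x else if x ∈ A then (if x ∈ B then x else f x) else g x
  have iC : C.image φ = C := by
    ext y
    simp only [Finset.mem_image]
    constructor
    · rintro ⟨x, hx, rfl⟩; simp [φ, hx]
    · intro hy; exact ⟨y, hy, by simp [φ, hy]⟩
  have iA : A.image φ = (C \ M) ∪ ((A ∩ B) \ C) := by
    ext y
    have hfy := congrArg (y ∈ ·) hf
    simp only [Finset.mem_image, Finset.mem_sdiff, Finset.mem_union, eq_iff_iff] at hfy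
    simp only [Finset.mem_image, Finset.mem_sdiff, Finset.mem_union, Finset.mem_inter]
    have hMy := @hM y
    simp only [Finset.mem_sdiff, Finset.mem_inter] at hMy
    constructor
    · rintro ⟨x, hx, rfl⟩
      by_cases h1 : x ∈ C
      · simp only [φ, h1, if_true] at hMy ⊢; tauto
      · by_cases h2 : x ∈ B
        · simp only [φ, h1, hx, h2, if_true, if_false] at hMy ⊢; tauto
        · simp only [φ, h1, hx, h2, if_true, if_false] at hfy ⊢
          have := hfy.1 ⟨x, ⟨hx, by tauto⟩, rfl⟩
          tauto
    · intro h
      by_cases h1 : y ∈ A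
      · refine ⟨y, h1, ?_⟩
        by_cases h2 : y ∈ C
        · simp [φ, h2]
        · have h3 : y ∈ B := by tauto
          simp [φ, h1, h2, h3]
      · obtain ⟨x, ⟨hx, hx2⟩, rfl⟩ := hfy.2 (by tauto)
        refine ⟨x, hx, ?_⟩
        have h3 : x ∉ B := by tauto
        have h4 : x ∉ C := by tauto
        simp [φ, hx, h3, h4]
  have iB : B.image φ = (C \ N) ∪ ((A ∩ B) \ C) := by
    ext y
    have hfy := congrArg (y ∈ ·) hg
    simp only [Finset.mem_image, Finset.mem_sdiff, Finset.mem_union, eq_iff_iff] at hfy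
    simp only [Finset.mem_image, Finset.mem_sdiff, Finset.mem_union, Finset.mem_inter]
    have hMy := @hN y
    simp only [Finset.mem_sdiff, Finset.mem_inter] at hMy
    constructor
    · rintro ⟨x, hx, rfl⟩
      by_cases h1 : x ∈ C
      · simp only [φ, h1, if_true] at hMy ⊢; tauto
      · by_cases h2 : x ∈ A
        · simp only [φ, h1, hx, h2, if_true, if_false] at hMy ⊢; tauto
        · simp only [φ, h1, h2, if_false] at hfy ⊢
          have := hfy.1 ⟨x, ⟨hx, by tauto⟩, rfl⟩
          tauto
    · intro h
      by_cases h1 : y ∈ B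
      · refine ⟨y, h1, ?_⟩
        by_cases h2 : y ∈ C
        · simp [φ, h2]
        · have h3 : y ∈ A := by tauto
          simp [φ, h1, h2, h3]
      · obtain ⟨x, ⟨hx, hx2⟩, rfl⟩ := hfy.2 (by tauto)
        refine ⟨x, hx, ?_⟩
        have h3 : x ∉ A := by tauto
        have h4 : x ∉ C := by tauto
        simp [φ, h3, h4]
  rcases Nat.eq_zero_or_pos ((A ∩ B) \ C).card with h0 | hpos
  · rw [h0, Finset.card_eq_zero] at hcM hcN
    rw [Finset.card_eq_zero] at h0
    subst hcM hcN
    rw [h0] at iA iB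
    simp only [Finset.sdiff_empty, Finset.union_empty] at iA iB
    have : ∃ d ∈ A, d ∉ C := by
      by_contra! h
      exact hAC (Finset.eq_of_subset_of_card_le h (by omega))
    obtain ⟨d, -, hd⟩ := this
    obtain ⟨x, hx, y, hy, hxy⟩ := Finset.one_lt_card.1 (show 1 < C.card by omega)
    obtain ⟨t1, t2, t3⟩ := aux_target r C {d} {x} {y} hC (by simpa using hd) (by simpa using hx)
      (by simpa using hy) (by simpa using hxy) (by simp) (by simp) (by simp)
    refine ⟨_, t1, t2, t3, φ, ?_⟩
    rw [iA, iB, iC]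
    simp
  · obtain ⟨t1, t2, t3⟩ := aux_target r C ((A ∩ B) \ C) M N hC Finset.disjoint_sdiff
      (fun z hz => by have := hM hz; simp at this; tauto)
      (fun z hz => by have := hN hz; simp at this; tauto)
      (Finset.disjoint_left.2 fun z hz hz' => by
        have := hM hz; have := hN hz'; simp at *; tauto) hcM hcN hpos
    refine ⟨_, t1, t2, t3, φ, ?_⟩
    rw [iA, iB, iC]
    simp

/-- Every `r`-graph (`r ≥ 2`) with exactly three edges, no isolated vertices
and minimum degree exactly `1` admits a homomorphism to some `r`-graph with
exactly three edges and minimum degree at least `2`. -/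
theorem hom_to_min_deg_two (r : ℕ) (hr : 2 ≤ r) {m : ℕ}
    (F₁ : Finset (Finset (Fin m)))
    (hunif : ∀ e ∈ F₁, e.card = r) (hcard : F₁.card = 3)
    (hcover : ∀ v : Fin m, 1 ≤ hypDegree F₁ v)
    (hmin : ∃ v : Fin m, hypDegree F₁ v = 1) :
    ∃ (m₂ : ℕ) (F₂ : Finset (Finset (Fin m₂))),
      (∀ e ∈ F₂, e.card = r) ∧ F₂.card = 3 ∧
      (∀ v, (∃ e ∈ F₂, v ∈ e) → 2 ≤ hypDegree F₂ v) ∧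
      ∃ φ : Fin m → Fin m₂, ∀ e ∈ F₁, e.image φ ∈ F₂ := by
  obtain ⟨A, B, C, hAB, hAC, hBC, rfl⟩ := Finset.card_eq_three.1 hcard
  have hA := hunif A (by simp)
  have hB := hunif B (by simp)
  have hC := hunif C (by simp)
  refine ⟨m, ?_⟩
  have c1 := Finset.inter_comm A B
  have c2 := Finset.inter_comm B C
  have c3 := Finset.inter_comm A C
  by_cases h1 : ((A ∩ B) \ C).card ≤ ((B ∩ C) \ A).card ∧
      ((A ∩ B) \ C).card ≤ ((A ∩ C) \ B).card
  · obtain ⟨F, t1, t2, t3, φ, p1, p2, p3⟩ := aux_main r hr A B C hA hB hC hAC h1.1 h1.2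
    exact ⟨F, t1, t2, t3, φ, by simp [p1, p2, p3]⟩
  by_cases h2 : ((B ∩ C) \ A).card ≤ ((A ∩ C) \ B).card
  · obtain ⟨F, t1, t2, t3, φ, p1, p2, p3⟩ := aux_main r hr B C A hB hC hA hAB.symm
      (by rw [← c3]; omega) (by rw [← c1]; omega)
    exact ⟨F, t1, t2, t3, φ, by simp [p1, p2, p3]⟩
  · obtain ⟨F, t1, t2, t3, φ, p1, p2, p3⟩ := aux_main r hr A C B hA hC hB hAB
      (by rw [← c2]; omega) (by omega)
    exact ⟨F, t1, t2, t3, φ, by simp [p1, p2, p3]⟩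
end

section
/- For every integer k ≥ 1, the Turán density of the (2k+1)-suspension of the expanded triangle satisfies π(T̂_{2k}^{2k+1}) < 1/2. -/
open Filter

section Aux

open Finset

lemma aux_goodman {Y X : Type*} [Fintype Y] [Fintype X] (f : Y → X → X → ℝ)
    (hsymm : ∀ v a b, f v a b = f v b a)
    (htri : ∀ v a b c, f v a b * f v a c * f v b c = 0) :
    2 * (∑ v, ∑ a, ∑ b, f v a b) ^ 2 ≤ (Fintype.card Y * Fintype.card X : ℝ) *
      (Fintype.card X * (∑ v, ∑ a, ∑ b, f v a b) -
        ∑ v, ∑ a, ∑ b, ∑ c, f v a b * (1 - f v a c) * (1 - f v b c)) := by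
  have h1 : ∀ v, (∑ a, ∑ b, ∑ c, f v a b * (1 - f v a c) * (1 - f v b c)) =
      Fintype.card X * (∑ a, ∑ b, f v a b) - 2 * ∑ a, (∑ b, f v a b) ^ 2 := by
    intro v
    have e1 : ∀ a b c, f v a b * (1 - f v a c) * (1 - f v b c) =
        f v a b - f v a b * f v a c - f v b a * f v b c := by
      intro a b c
      have := htri v a b c
      rw [← hsymm v a b]
      linear_combination this
    have e2 : ∑ a, ∑ b, ∑ c, f v a b * f v a c = ∑ a, (∑ b, f v a b) ^ 2 := by
      refine sum_congr rfl fun a _ => ?_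
      rw [sq, sum_mul_sum]
    have e3 : ∑ a, ∑ b, ∑ c, f v b a * f v b c = ∑ a, (∑ b, f v a b) ^ 2 := by
      rw [sum_comm]; exact e2
    simp only [e1, sum_sub_distrib, e2, e3]
    simp only [sum_const, card_univ, nsmul_eq_mul, ← mul_sum]
    ring
  have h2 : (∑ v, ∑ a, ∑ b, f v a b) ^ 2 ≤
      (Fintype.card Y * Fintype.card X : ℝ) * ∑ v, ∑ a, (∑ b, f v a b) ^ 2 := by
    have := sq_sum_le_card_mul_sum_sq (s := (univ : Finset (Y × X)))
      (f := fun p => ∑ b, f p.1 p.2 b)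
    simp only [Fintype.sum_prod_type, card_univ, Fintype.card_prod] at this
    push_cast at this
    exact this
  simp only [h1, sum_sub_distrib, ← mul_sum]
  linarith

lemma aux_s1 {W : Type*} [DecidableEq W] {A B : Finset W} {v : W} (z : W) (hv : v ∈ B) :
    insert v (A ∪ insert z (B.erase v)) = insert z (A ∪ B) := by
  ext w; by_cases hw : w = v <;> simp [hw, hv]

lemma aux_s2 {W : Type*} [DecidableEq W] {C B : Finset W} {v : W} (z : W) (hv : v ∈ B) :
    insert v (insert z (B.erase v) ∪ C) = insert z (C ∪ B) := by
  rw [union_comm, aux_s1 z hv]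

lemma aux_s3 {W : Type*} [DecidableEq W] {A B : Finset W} {v z : W} (d : Disjoint A B)
    (hz : z ∉ A) : Disjoint A (insert z (B.erase v)) := by
  rw [disjoint_insert_right]
  exact ⟨hz, d.mono_right (erase_subset _ _)⟩

lemma aux_s4 {W : Type*} [DecidableEq W] {S S' : Finset W} {x y : W} (hy : y ∈ S') :
    insert y (S.erase x) \ S' = (S \ S').erase x := by
  ext w; by_cases hw : w = y <;> simp [hw, hy]; tauto

/-- Structural lemma: a parity-consistent set system is empty on `(2k+1)`-sets. -/
lemma aux_struct {W : Type*} [Fintype W] [DecidableEq W] (k : ℕ) (hk : 1 ≤ k)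
    (hW : 3 * k + 2 ≤ Fintype.card W) (g : Finset W → Bool)
    (h : ∀ (v : W) (A B C : Finset W), A.card = k → B.card = k → C.card = k →
      v ∉ A → v ∉ B → v ∉ C → Disjoint A B → Disjoint B C → Disjoint A C →
      xor (g (insert v (A ∪ B))) (xor (g (insert v (A ∪ C))) (g (insert v (B ∪ C)))) = false)
    (S : Finset W) (hS : S.card = 2 * k + 1) : g S = false := by
  have hD : ∀ (x y : W) (A B C : Finset W), A.card = k → B.card = k → C.card = k →
      x ∉ A → x ∉ B → x ∉ C → y ∉ A → y ∉ B → y ∉ C → x ≠ y →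
      Disjoint A B → Disjoint B C → Disjoint A C →
      xor (g (insert x (A ∪ B))) (g (insert y (A ∪ B))) =
      xor (g (insert x (C ∪ B))) (g (insert y (C ∪ B))) := by
    intro x y A B C hA hB hC xA xB xC yA yB yC hxy dAB dBC dAC
    obtain ⟨v, hv⟩ : B.Nonempty := by rw [← card_pos]; omega
    have key : ∀ z, z ∉ A → z ∉ B → z ∉ C →
        xor (g (insert z (A ∪ B))) (g (insert z (C ∪ B))) = g (insert v (A ∪ C)) := by
      intro z zA zB zC
      have := h v A (insert z (B.erase v)) C hA
        (by rw [card_insert_of_notMem (by simp [zB]), card_erase_of_mem hv]; omega) hC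
        (fun hh => disjoint_left.1 dAB hh hv) (by simp; rintro rfl; exact zB hv)
        (fun hh => disjoint_left.1 dBC hv hh)
        (aux_s3 dAB zA) (aux_s3 dBC.symm zC).symm dAC
      rw [aux_s1 z hv, aux_s2 z hv] at this
      generalize g (insert z (A ∪ B)) = p at *
      generalize g (insert z (C ∪ B)) = q at *
      generalize g (insert v (A ∪ C)) = r at *
      clear h
      revert p q r
      decide
    have k1 := key x xA xB xC
    have k2 := key y yA yB yC
    generalize g (insert x (A ∪ B)) = p at *
    generalize g (insert x (C ∪ B)) = q at *
    generalize g (insert y (A ∪ B)) = p' at *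
    generalize g (insert y (C ∪ B)) = q' at *
    generalize g (insert v (A ∪ C)) = r at *
    clear key h
    revert p q r p' q'
    decide
  have hZ : ∀ (x y : W) (A B C : Finset W), A.card = k → B.card = k → C.card = k →
      x ∉ A → x ∉ B → x ∉ C → y ∉ A → y ∉ B → y ∉ C → x ≠ y →
      Disjoint A B → Disjoint B C → Disjoint A C →
      g (insert x (A ∪ B)) = g (insert y (A ∪ B)) := by
    intro x y A B C hA hB hC xA xB xC yA yB yC hxy dAB dBC dAC
    have d1 := hD x y A B C hA hB hC xA xB xC yA yB yC hxy dAB dBC dAC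
    have d2 := hD x y B A C hB hA hC xB xA xC yB yA yC hxy dAB.symm dAC dBC
    have i1 := h x A B C hA hB hC xA xB xC dAB dBC dAC
    have i2 := h y A B C hA hB hC yA yB yC dAB dBC dAC
    rw [union_comm C B] at d1
    rw [union_comm C A, union_comm B A] at d2
    generalize g (insert x (A ∪ B)) = p at *
    generalize g (insert x (A ∪ C)) = q at *
    generalize g (insert x (B ∪ C)) = r at *
    generalize g (insert y (A ∪ B)) = p' at *
    generalize g (insert y (A ∪ C)) = q' at *
    generalize g (insert y (B ∪ C)) = r' at *
    clear hD h
    revert p q r p' q' r'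
    decide
  have hswap : ∀ (U : Finset W) (x y : W), U.card = 2 * k → x ∉ U → y ∉ U → x ≠ y →
      g (insert x U) = g (insert y U) := by
    intro U x y hU xU yU hxy
    obtain ⟨A, hAU, hA⟩ := exists_subset_card_eq (s := U) (n := k) (by omega)
    have hc : (insert x (insert y U)).card = 2 * k + 2 := by
      rw [card_insert_of_notMem (by simp [hxy, xU]), card_insert_of_notMem yU, hU]
    obtain ⟨C, hCU, hC⟩ := exists_subset_card_eq (s := (insert x (insert y U))ᶜ) (n := k)
      (by rw [card_compl]; omega)
    have hB : (U \ A).card = k := by rw [card_sdiff_of_subset hAU]; omega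
    have hCx : ∀ z ∈ C, z ≠ x ∧ z ≠ y ∧ z ∉ U := by
      intro z hz; have := hCU hz; simpa using this
    have := hZ x y A (U \ A) C hA hB hC (fun hh => xU (hAU hh)) (by simp [xU])
      (fun hh => (hCx x hh).1 rfl) (fun hh => yU (hAU hh)) (by simp [yU])
      (fun hh => (hCx y hh).2.1 rfl) hxy disjoint_sdiff
      (disjoint_left.2 fun z hz hz' => (hCx z hz').2.2 (Finset.mem_sdiff.1 hz).1)
      (disjoint_left.2 fun z hz hz' => (hCx z hz').2.2 (hAU hz))
    rwa [union_sdiff_of_subset hAU] at this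
  have hconst : ∀ (n : ℕ) (S S' : Finset W), S.card = 2 * k + 1 → S'.card = 2 * k + 1 →
      (S \ S').card = n → g S = g S' := by
    intro n
    induction n with
    | zero =>
      intro S S' hS hS' h0
      rw [card_eq_zero, sdiff_eq_empty_iff_subset] at h0
      rw [eq_of_subset_of_card_le h0 (by omega)]
    | succ n ih =>
      intro S S' hS hS' h0
      have h0' : (S' \ S).card = n + 1 := by
        have := card_sdiff_add_card S S'
        have := card_sdiff_add_card S' S
        rw [union_comm S' S] at this
        omega
      obtain ⟨x, hx⟩ : (S \ S').Nonempty := by rw [← card_pos]; omega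
      obtain ⟨y, hy⟩ : (S' \ S).Nonempty := by rw [← card_pos]; omega
      rw [Finset.mem_sdiff] at hx hy
      have hyE : y ∉ S.erase x := fun hh => hy.2 (mem_of_mem_erase hh)
      have hcE : (S.erase x).card = 2 * k := by rw [card_erase_of_mem hx.1]; omega
      have s1 := hswap (S.erase x) x y hcE (by simp) hyE (by rintro rfl; exact hy.2 hx.1)
      rw [insert_erase hx.1] at s1
      rw [s1]
      refine ih _ _ (by rw [card_insert_of_notMem hyE]; omega) hS' ?_
      rw [aux_s4 hy.1, card_erase_of_mem (by simp [hx])]; omega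
  obtain ⟨v, hv⟩ : S.Nonempty := by rw [← card_pos]; omega
  have hcE : (S.erase v).card = 2 * k := by rw [card_erase_of_mem hv]; omega
  obtain ⟨A, hAU, hA⟩ := exists_subset_card_eq (s := S.erase v) (n := k) (by omega)
  obtain ⟨C, hCU, hC⟩ := exists_subset_card_eq (s := Sᶜ) (n := k) (by rw [card_compl]; omega)
  have hB : (S.erase v \ A).card = k := by rw [card_sdiff_of_subset hAU]; omega
  have hCx : ∀ z ∈ C, z ∉ S := by
      intro z hz; have := hCU hz; simpa using this
  have dAC : Disjoint A C :=
    disjoint_left.2 fun z hz hz' => hCx z hz' (mem_of_mem_erase (hAU hz))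
  have dBC : Disjoint (S.erase v \ A) C :=
    disjoint_left.2 fun z hz hz' => hCx z hz' (mem_of_mem_erase (Finset.mem_sdiff.1 hz).1)
  have vA : v ∉ A := fun hh => by simpa using hAU hh
  have vB : v ∉ S.erase v \ A := by simp
  have vC : v ∉ C := fun hh => hCx v hh hv
  have i := h v A _ C hA hB hC vA vB vC disjoint_sdiff dBC dAC
  rw [union_sdiff_of_subset hAU, insert_erase hv] at i
  rw [← hconst _ S (insert v (A ∪ C)) hS (by
      rw [card_insert_of_notMem (by simp [vA, vC]), card_union_of_disjoint dAC]; omega) rfl,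
    ← hconst _ S (insert v (S.erase v \ A ∪ C)) hS (by
      rw [card_insert_of_notMem (by simp only [mem_union, not_or]; exact ⟨vB, vC⟩),
        card_union_of_disjoint dBC]; omega) rfl] at i
  cases hg : g S <;> simp [hg] at i ⊢

/-- Counting functions through an injection. -/
lemma aux_count {I W V : Type*} [Fintype I] [Fintype W] [Fintype V] [DecidableEq W]
    [DecidableEq I]
    (ι : I → W) (hι : Function.Injective ι) (Q : (I → V) → Prop) [DecidablePred Q] :
    (univ.filter fun ψ : W → V => Q (ψ ∘ ι)).card =
      (univ.filter Q).card * Fintype.card V ^ (Fintype.card W - Fintype.card I) := by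
  classical
  let R := {w : W // w ∉ Set.range ι}
  let e : I ⊕ R ≃ W := (Equiv.sumCongr (Equiv.ofInjective ι hι) (Equiv.refl _)).trans
    (Equiv.sumCompl (· ∈ Set.range ι))
  have he : ∀ i, e (Sum.inl i) = ι i := fun i => rfl
  have hcard : Fintype.card R = Fintype.card W - Fintype.card I := by
    have := Fintype.card_congr e
    rw [Fintype.card_sum] at this
    omega
  rw [← hcard, ← Fintype.card_fun, ← card_univ (α := R → V), ← card_product]
  refine card_bij' (fun ψ _ => (ψ ∘ ι, fun r => ψ r.1))
    (fun p _ => fun w => Sum.elim p.1 p.2 (e.symm w)) ?_ ?_ ?_ ?_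
  · intro ψ hψ; simpa using hψ
  · rintro ⟨p, q⟩ hp
    have : (fun w => Sum.elim p q (e.symm w)) ∘ ι = p := by
      funext i; simp [← he]
    simp only [mem_filter, mem_univ, true_and, this]
    simpa using hp
  · intro ψ hψ
    funext w
    obtain ⟨s, rfl⟩ := e.surjective w
    rcases s with i | r <;> simp <;> rfl
  · rintro ⟨p, q⟩ hp
    refine Prod.ext ?_ ?_
    · funext i; simp [← he]
    · funext r
      have : (r : W) = e (Sum.inr r) := rfl
      simp only [this, Equiv.symm_apply_apply, Sum.elim_inr]

lemma aux_inj {V : Type*} [DecidableEq V] {k : ℕ} {v : V} {a b : Fin k → V}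
    (h : (insert v (univ.image a ∪ univ.image b)).card = 2 * k + 1) :
    Function.Injective a ∧ Function.Injective b ∧ (∀ i j, a i ≠ b j) ∧
      (∀ i, a i ≠ v) ∧ (∀ i, b i ≠ v) := by
  have e : insert v (univ.image a ∪ univ.image b) =
      univ.image (Sum.elim (fun _ : Unit => v) (Sum.elim a b)) := by
    ext w; simp [eq_comm]
  rw [e] at h
  have h' : (univ.image (Sum.elim (fun _ : Unit => v) (Sum.elim a b))).card =
      (univ : Finset (Unit ⊕ (Fin k ⊕ Fin k))).card := by
    rw [h]; simp; omega
  have hi : Function.Injective (Sum.elim (fun _ : Unit => v) (Sum.elim a b)) := by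
    rw [card_image_iff] at h'
    simpa [Set.injOn_univ] using h'
  refine ⟨fun i j hij => ?_, fun i j hij => ?_, fun i j hij => ?_, fun i hij => ?_,
    fun i hij => ?_⟩
  · simpa using @hi (Sum.inr (Sum.inl i)) (Sum.inr (Sum.inl j)) (by simpa using hij)
  · simpa using @hi (Sum.inr (Sum.inr i)) (Sum.inr (Sum.inr j)) (by simpa using hij)
  · simpa using @hi (Sum.inr (Sum.inl i)) (Sum.inr (Sum.inr j)) (by simpa using hij)
  · simpa using @hi (Sum.inr (Sum.inl i)) (Sum.inl ()) (by simpa using hij)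
  · simpa using @hi (Sum.inr (Sum.inr i)) (Sum.inl ()) (by simpa using hij)

lemma aux_copy {V : Type*} [DecidableEq V] {k : ℕ} {H : Finset (Finset V)}
    (hH : ∀ e ∈ H, e.card = 2 * k + 1) {v : V} {a b c : Fin k → V}
    (h1 : insert v (univ.image a ∪ univ.image b) ∈ H)
    (h2 : insert v (univ.image a ∪ univ.image c) ∈ H)
    (h3 : insert v (univ.image b ∪ univ.image c) ∈ H) :
    HasCopy H (suspend 1 (expTriangle k)) := by
  obtain ⟨ia, ib, hab, hav, hbv⟩ := aux_inj (hH _ h1)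
  obtain ⟨-, ic, hac, -, hcv⟩ := aux_inj (hH _ h2)
  obtain ⟨-, -, hbc, -, -⟩ := aux_inj (hH _ h3)
  let φ : Fin (3 * k + 1) → V := fun x =>
    if h : x.val < k then a ⟨x.val, h⟩ else if h : x.val - k < k then b ⟨x.val - k, h⟩ else
    if h : x.val - 2 * k < k then c ⟨x.val - 2 * k, h⟩ else v
  have hφ : Function.Injective φ := by
    intro x y hxy
    simp only [φ] at hxy
    apply Fin.ext
    split_ifs at hxy
    all_goals first
      | (exact absurd hxy (hab _ _)) | (exact absurd hxy.symm (hab _ _))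
      | (exact absurd hxy (hac _ _)) | (exact absurd hxy.symm (hac _ _))
      | (exact absurd hxy (hbc _ _)) | (exact absurd hxy.symm (hbc _ _))
      | (exact absurd hxy (hav _)) | (exact absurd hxy.symm (hav _))
      | (exact absurd hxy (hbv _)) | (exact absurd hxy.symm (hbv _))
      | (exact absurd hxy (hcv _)) | (exact absurd hxy.symm (hcv _))
      | (have := ia hxy; simp at this; omega)
      | (have := ib hxy; simp at this; omega)
      | (have := ic hxy; simp at this; omega)
      | omega
  let S : ℕ → Finset (Fin (3 * k)) :=
    fun a => Finset.univ.filter fun v => a * k ≤ v.val ∧ v.val < (a + 1) * k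
  have hA : ((S 0).image (Fin.castAdd 1)).image φ = univ.image a := by
    ext w
    simp only [mem_image, S, mem_filter, mem_univ, true_and]
    constructor
    · rintro ⟨_, ⟨x, hx, rfl⟩, rfl⟩
      refine ⟨⟨x.val, by omega⟩, ?_⟩
      have : x.val < k := by omega
      simp [φ, this]
    · rintro ⟨i, rfl⟩
      have := i.2
      refine ⟨_, ⟨⟨i.val, by omega⟩, by simp, rfl⟩, ?_⟩
      simp [φ]
  have hB : ((S 1).image (Fin.castAdd 1)).image φ = univ.image b := by
    ext w
    simp only [mem_image, S, mem_filter, mem_univ, true_and]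
    constructor
    · rintro ⟨_, ⟨x, hx, rfl⟩, rfl⟩
      refine ⟨⟨x.val - k, by omega⟩, ?_⟩
      have h1 : ¬ x.val < k := by omega
      have h2 : x.val - k < k := by omega
      simp [φ, h1, h2]
    · rintro ⟨i, rfl⟩
      have := i.2
      refine ⟨_, ⟨⟨k + i.val, by omega⟩, ⟨by simp, by simp; omega⟩, rfl⟩, ?_⟩
      simp [φ]
  have hC : ((S 2).image (Fin.castAdd 1)).image φ = univ.image c := by
    ext w
    simp only [mem_image, S, mem_filter, mem_univ, true_and]
    constructor
    · rintro ⟨_, ⟨x, hx, rfl⟩, rfl⟩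
      refine ⟨⟨x.val - 2 * k, by omega⟩, ?_⟩
      have h1 : ¬ x.val < k := by omega
      have h2 : ¬ x.val - k < k := by omega
      have h3 : x.val - 2 * k < k := by omega
      simp [φ, h1, h2, h3]
    · rintro ⟨i, rfl⟩
      have := i.2
      refine ⟨_, ⟨⟨2 * k + i.val, by omega⟩, ⟨by simp, by simp; omega⟩, rfl⟩, ?_⟩
      have h1 : ¬ 2 * k + i.val < k := by omega
      have h2 : ¬ 2 * k + i.val - k < k := by omega
      simp [φ, h1, h2]
  have hL : (univ.filter fun x : Fin (3 * k + 1) => 3 * k ≤ x.val).image φ = {v} := by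
    have e : (univ.filter fun x : Fin (3 * k + 1) => 3 * k ≤ x.val) = {Fin.last (3 * k)} := by
      ext x; simp [Fin.ext_iff]; omega
    rw [e, image_singleton]
    have h1 : ¬ 3 * k < k := by omega
    have h2 : ¬ 3 * k - k < k := by omega
    have h3 : ¬ 3 * k - 2 * k < k := by omega
    simp [φ, h1, h2, h3]
  refine ⟨φ, hφ.injOn, ?_⟩
  intro e he
  have he' : e = (S 0 ∪ S 1).image (Fin.castAdd 1) ∪ univ.filter (fun x : Fin (3 * k + 1) => 3 * k ≤ x.val) ∨
      e = (S 1 ∪ S 2).image (Fin.castAdd 1) ∪ univ.filter (fun x : Fin (3 * k + 1) => 3 * k ≤ x.val) ∨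
      e = (S 2 ∪ S 0).image (Fin.castAdd 1) ∪ univ.filter (fun x : Fin (3 * k + 1) => 3 * k ≤ x.val) := by
    simp only [suspend, expTriangle, mem_image, mem_insert, mem_singleton] at he
    obtain ⟨s, hs, rfl⟩ := he
    rcases hs with rfl | rfl | rfl
    · left; rfl
    · right; left; rfl
    · right; right; rfl
  rcases he' with rfl | rfl | rfl
  · rw [image_union, image_union, image_union, hA, hB, hL, union_comm _ {v}]
    exact h1
  · rw [image_union, image_union, image_union, hB, hC, hL, union_comm _ {v}]
    exact h3
  · rw [image_union, image_union, image_union, hC, hA, hL, union_comm _ {v},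
      union_comm (univ.image c)]
    exact h2

lemma aux_enum {W : Type*} [DecidableEq W] {k : ℕ} {A : Finset W} (hA : A.card = k) :
    ∃ α : Fin k → W, Function.Injective α ∧ univ.image α = A := by
  let e := A.equivFinOfCardEq hA
  refine ⟨fun i => (e.symm i).1, fun i j hij => ?_, ?_⟩
  · exact e.symm.injective (Subtype.ext hij)
  · ext w
    simp only [mem_image, mem_univ, true_and]
    constructor
    · rintro ⟨i, rfl⟩; exact (e.symm i).2
    · intro hw; exact ⟨e ⟨w, hw⟩, by simp⟩

/-- edge predicate on tuples -/
def auxE {V : Type*} [DecidableEq V] {k : ℕ} (H : Finset (Finset V)) (v : V)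
    (a b : Fin k → V) : Prop := insert v (univ.image a ∪ univ.image b) ∈ H

instance auxEDec {V : Type*} [DecidableEq V] {k : ℕ} (H : Finset (Finset V)) (v : V)
    (a b : Fin k → V) : Decidable (auxE H v a b) :=
  inferInstanceAs (Decidable (insert v (univ.image a ∪ univ.image b) ∈ H))

/-- exactly one edge, namely the first -/
def auxBad {V : Type*} [DecidableEq V] {k : ℕ} (H : Finset (Finset V)) (v : V)
    (a b c : Fin k → V) : Prop := auxE H v a b ∧ ¬ auxE H v a c ∧ ¬ auxE H v b c

instance auxBadDec {V : Type*} [DecidableEq V] {k : ℕ} (H : Finset (Finset V)) (v : V)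
    (a b c : Fin k → V) : Decidable (auxBad H v a b c) :=
  inferInstanceAs (Decidable (auxE H v a b ∧ ¬ auxE H v a c ∧ ¬ auxE H v b c))

lemma aux_pull {V W : Type*} [DecidableEq V] [Fintype W] [DecidableEq W] {k : ℕ} (hk : 1 ≤ k)
    (hW : 3 * k + 2 ≤ Fintype.card W) {H : Finset (Finset V)}
    (hH : ∀ e ∈ H, e.card = 2 * k + 1) (hF : ¬ HasCopy H (suspend 1 (expTriangle k)))
    (ψ : W → V) (S : Finset W) (hS : S.card = 2 * k + 1) (hSH : S.image ψ ∈ H) :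
    ∃ ι : Unit ⊕ (Fin k ⊕ (Fin k ⊕ Fin k)) → W, Function.Injective ι ∧
      auxBad H (ψ (ι (Sum.inl ()))) (fun i => ψ (ι (Sum.inr (Sum.inl i))))
        (fun i => ψ (ι (Sum.inr (Sum.inr (Sum.inl i)))))
        (fun i => ψ (ι (Sum.inr (Sum.inr (Sum.inr i))))) := by
  by_contra hno
  push Not at hno
  have hno' : ∀ (v : W) (α β γ : Fin k → W), Function.Injective α → Function.Injective β →
      Function.Injective γ → (∀ i, v ≠ α i) → (∀ i, v ≠ β i) → (∀ i, v ≠ γ i) →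
      (∀ i j, α i ≠ β j) → (∀ i j, α i ≠ γ j) → (∀ i j, β i ≠ γ j) →
      ¬ auxBad H (ψ v) (ψ ∘ α) (ψ ∘ β) (ψ ∘ γ) := by
    intro v α β γ iα iβ iγ vα vβ vγ αβ αγ βγ
    refine hno (Sum.elim (fun _ => v) (Sum.elim α (Sum.elim β γ))) ?_
    refine Function.Injective.sumElim (fun _ _ _ => rfl)
      (iα.sumElim (iβ.sumElim iγ βγ) ?_) ?_
    · rintro i (j | j)
      · exact αβ i j
      · exact αγ i j
    · rintro _ (i | i | i)
      · exact vα i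
      · exact vβ i
      · exact vγ i
  have hfin := aux_struct k hk hW (fun S => decide (S.image ψ ∈ H)) ?_ S hS
  · simp [hSH] at hfin
  intro v A B C hA hB hC vA vB vC dAB dBC dAC
  obtain ⟨α, iα, rfl⟩ := aux_enum hA
  obtain ⟨β, iβ, rfl⟩ := aux_enum hB
  obtain ⟨γ, iγ, rfl⟩ := aux_enum hC
  have him : ∀ (α β : Fin k → W), (insert v (univ.image α ∪ univ.image β)).image ψ =
      insert (ψ v) (univ.image (ψ ∘ α) ∪ univ.image (ψ ∘ β)) := by
    intro α β
    rw [image_insert, image_union, image_image, image_image]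
  have hd : ∀ (α β : Fin k → W), Disjoint (univ.image α) (univ.image β) → ∀ i j, α i ≠ β j := by
    intro α β d i j hij
    exact disjoint_left.1 d (mem_image_of_mem α (mem_univ i))
      (by rw [hij]; exact mem_image_of_mem β (mem_univ j))
  have hv : ∀ (α : Fin k → W), v ∉ univ.image α → ∀ i, v ≠ α i := by
    intro α h i hi
    exact h (by rw [hi]; exact mem_image_of_mem α (mem_univ i))
  have b1 := hno' v α β γ iα iβ iγ (hv _ vA) (hv _ vB) (hv _ vC) (hd _ _ dAB) (hd _ _ dAC)
    (hd _ _ dBC)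
  have b2 := hno' v α γ β iα iγ iβ (hv _ vA) (hv _ vC) (hv _ vB) (hd _ _ dAC) (hd _ _ dAB)
    (hd _ _ dBC.symm)
  have b3 := hno' v β γ α iβ iγ iα (hv _ vB) (hv _ vC) (hv _ vA) (hd _ _ dBC)
    (hd _ _ dAB.symm) (hd _ _ dAC.symm)
  have b4 : ¬ (auxE H (ψ v) (ψ ∘ α) (ψ ∘ β) ∧ auxE H (ψ v) (ψ ∘ α) (ψ ∘ γ) ∧
      auxE H (ψ v) (ψ ∘ β) (ψ ∘ γ)) := fun h => hF (aux_copy hH h.1 h.2.1 h.2.2)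
  simp only [him]
  have hs : ∀ a b : Fin k → V, auxE H (ψ v) a b = auxE H (ψ v) b a := by
    intro a b; simp only [auxE, union_comm]
  simp only [auxBad, hs (ψ ∘ γ), hs (ψ ∘ β) (ψ ∘ α)] at b1 b2 b3 b4
  change (xor (decide (auxE H (ψ v) (ψ ∘ α) (ψ ∘ β))) (xor (decide (auxE H (ψ v) (ψ ∘ α) (ψ ∘ γ)))
    (decide (auxE H (ψ v) (ψ ∘ β) (ψ ∘ γ))))) = false
  by_cases p : auxE H (ψ v) (ψ ∘ α) (ψ ∘ β) <;> by_cases q : auxE H (ψ v) (ψ ∘ α) (ψ ∘ γ) <;>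
    by_cases r : auxE H (ψ v) (ψ ∘ β) (ψ ∘ γ) <;> simp [p, q, r] at b1 b2 b3 b4 ⊢

/-- number of ordered edges -/
def auxNE {n k : ℕ} (H : Finset (Finset (Fin n))) : ℕ :=
  (univ.filter fun χ : Unit ⊕ (Fin k ⊕ Fin k) → Fin n => univ.image χ ∈ H).card

/-- number of bad tuples -/
def auxNT {n k : ℕ} (H : Finset (Finset (Fin n))) : ℕ :=
  (univ.filter fun χ : Unit ⊕ (Fin k ⊕ (Fin k ⊕ Fin k)) → Fin n =>
    auxBad H (χ (Sum.inl ())) (fun i => χ (Sum.inr (Sum.inl i)))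
        (fun i => χ (Sum.inr (Sum.inr (Sum.inl i))))
        (fun i => χ (Sum.inr (Sum.inr (Sum.inr i))))).card

lemma aux_NE_le {n k : ℕ} (hk : 1 ≤ k) (hn : 0 < n) (H : Finset (Finset (Fin n)))
    (hH : ∀ e ∈ H, e.card = 2 * k + 1) (hF : ¬ HasCopy H (suspend 1 (expTriangle k))) :
    auxNE (k := k) H * n ^ k ≤ (3 * k + 2) ^ (3 * k + 1) * auxNT (k := k) H := by
  classical
  obtain ⟨ι0⟩ : Nonempty (Unit ⊕ (Fin k ⊕ Fin k) ↪ Fin (3 * k + 2)) := by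
    apply Function.Embedding.nonempty_of_card_le
    simp; omega
  let Bad : (Unit ⊕ (Fin k ⊕ (Fin k ⊕ Fin k)) → Fin n) → Prop := fun χ =>
    auxBad H (χ (Sum.inl ())) (fun i => χ (Sum.inr (Sum.inl i)))
        (fun i => χ (Sum.inr (Sum.inr (Sum.inl i))))
        (fun i => χ (Sum.inr (Sum.inr (Sum.inr i))))
  have c1 := aux_count (V := Fin n) ι0 ι0.injective (fun χ => univ.image χ ∈ H)
  have hsub : (univ.filter fun ψ : Fin (3 * k + 2) → Fin n => univ.image (ψ ∘ ι0) ∈ H) ⊆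
      (univ.filter fun ι : Unit ⊕ (Fin k ⊕ (Fin k ⊕ Fin k)) → Fin (3 * k + 2) =>
        Function.Injective ι).biUnion
        (fun ι => univ.filter fun ψ : Fin (3 * k + 2) → Fin n => Bad (ψ ∘ ι)) := by
    intro ψ hψ
    simp only [mem_filter, mem_univ, true_and, mem_biUnion] at hψ ⊢
    refine aux_pull hk (by simp) hH hF ψ (univ.image ι0) ?_ (by rwa [image_image])
    rw [card_image_of_injective _ ι0.injective]
    simp; omega
  have c2 := card_le_card hsub
  have c3 := c2.trans card_biUnion_le
  have c4 : ∀ ι ∈ (univ.filter fun ι : Unit ⊕ (Fin k ⊕ (Fin k ⊕ Fin k)) → Fin (3 * k + 2) =>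
        Function.Injective ι),
      (univ.filter fun ψ : Fin (3 * k + 2) → Fin n => Bad (ψ ∘ ι)).card ≤
        auxNT (k := k) H * n := by
    intro ι hι
    have := aux_count (V := Fin n) ι (by simpa using hι) Bad
    rw [this]
    have e : Fintype.card (Fin (3 * k + 2)) -
        Fintype.card (Unit ⊕ (Fin k ⊕ (Fin k ⊕ Fin k))) = 1 := by
      simp; omega
    rw [e, pow_one, Fintype.card_fin]
    apply le_of_eq
    unfold auxNT
    congr 1
  have c5 := c3.trans (sum_le_card_nsmul _ _ _ c4)
  have c6 : (univ.filter fun ι : Unit ⊕ (Fin k ⊕ (Fin k ⊕ Fin k)) → Fin (3 * k + 2) =>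
        Function.Injective ι).card ≤ (3 * k + 2) ^ (3 * k + 1) := by
    refine (card_filter_le _ _).trans (le_of_eq ?_)
    have e6 : Fintype.card (Unit ⊕ (Fin k ⊕ (Fin k ⊕ Fin k))) = 3 * k + 1 := by
      simp only [Fintype.card_sum, Fintype.card_fin, Fintype.card_unit]; omega
    rw [card_univ, Fintype.card_fun, e6, Fintype.card_fin]
  have e : Fintype.card (Fin (3 * k + 2)) -
        Fintype.card (Unit ⊕ (Fin k ⊕ Fin k)) = k + 1 := by
      simp only [Fintype.card_sum, Fintype.card_fin, Fintype.card_unit]; omega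
  rw [e, Fintype.card_fin] at c1
  rw [c1, smul_eq_mul] at c5
  have c7 := c5.trans (Nat.mul_le_mul_right _ c6)
  rw [pow_succ, ← mul_assoc, ← mul_assoc] at c7
  exact Nat.le_of_mul_le_mul_right c7 hn

lemma aux_NE_ge {n k : ℕ} (H : Finset (Finset (Fin n)))
    (hH : ∀ e ∈ H, e.card = 2 * k + 1) :
    H.card * (2 * k + 1).factorial ≤ auxNE (k := k) H := by
  classical
  unfold auxNE
  have hm : ∀ χ ∈ (univ.filter fun χ : Unit ⊕ (Fin k ⊕ Fin k) → Fin n => univ.image χ ∈ H),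
      univ.image χ ∈ H := by simp
  rw [card_eq_sum_card_fiberwise (fun χ hχ => hm χ hχ), ← smul_eq_mul]
  refine card_nsmul_le_sum _ _ _ fun S hS => ?_
  have hc : Fintype.card (Unit ⊕ (Fin k ⊕ Fin k)) = Fintype.card S := by
    simp [hH S hS]; omega
  have e0 := Fintype.equivOfCardEq hc
  have h1 := Fintype.card_equiv e0
  have h2 : Fintype.card (Unit ⊕ (Fin k ⊕ Fin k)) = 2 * k + 1 := by simp; omega
  rw [h2] at h1
  rw [← h1, ← card_univ]
  refine card_le_card_of_injOn (fun e i => (e i).1) ?_ ?_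
  · intro e _
    have : univ.image (fun i => (e i).1) = S := by
      ext w
      simp only [mem_image, mem_univ, true_and]
      constructor
      · rintro ⟨i, rfl⟩; exact (e i).2
      · intro hw; exact ⟨e.symm ⟨w, hw⟩, by simp⟩
    simp [this, hS]
  · intro e _ e' _ h
    apply Equiv.ext
    intro i
    exact Subtype.ext (congrFun h i)

lemma aux_NE_sum {n k : ℕ} (H : Finset (Finset (Fin n))) :
    (auxNE (k := k) H : ℝ) = ∑ v : Fin n, ∑ a : Fin k → Fin n, ∑ b : Fin k → Fin n,
      (if auxE H v a b then 1 else 0 : ℝ) := by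
  unfold auxNE
  rw [card_filter]
  push_cast
  let e : (Unit ⊕ (Fin k ⊕ Fin k) → Fin n) ≃ Fin n × ((Fin k → Fin n) × (Fin k → Fin n)) :=
    (Equiv.sumArrowEquivProdArrow _ _ _).trans
      (Equiv.prodCongr (Equiv.funUnique _ _) (Equiv.sumArrowEquivProdArrow _ _ _))
  rw [← e.symm.sum_comp, Fintype.sum_prod_type]
  refine sum_congr rfl fun v _ => ?_
  rw [Fintype.sum_prod_type]
  refine sum_congr rfl fun a _ => sum_congr rfl fun b _ => ?_
  have : univ.image (e.symm (v, a, b)) = insert v (univ.image a ∪ univ.image b) := by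
    have : e.symm (v, a, b) = Sum.elim (fun _ => v) (Sum.elim a b) := by
      rw [Equiv.symm_apply_eq]; rfl
    rw [this]
    ext w; simp [eq_comm]
  rw [this]
  rfl

lemma aux_NT_sum {n k : ℕ} (H : Finset (Finset (Fin n))) :
    (auxNT (k := k) H : ℝ) = ∑ v : Fin n, ∑ a : Fin k → Fin n, ∑ b : Fin k → Fin n,
      ∑ c : Fin k → Fin n, (if auxE H v a b then 1 else 0 : ℝ) *
        (1 - (if auxE H v a c then 1 else 0 : ℝ)) *
        (1 - (if auxE H v b c then 1 else 0 : ℝ)) := by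
  unfold auxNT
  rw [card_filter]
  push_cast
  let e : (Unit ⊕ (Fin k ⊕ (Fin k ⊕ Fin k)) → Fin n) ≃
      Fin n × ((Fin k → Fin n) × ((Fin k → Fin n) × (Fin k → Fin n))) :=
    (Equiv.sumArrowEquivProdArrow _ _ _).trans
      (Equiv.prodCongr (Equiv.funUnique _ _) ((Equiv.sumArrowEquivProdArrow _ _ _).trans
        (Equiv.prodCongr (Equiv.refl _) (Equiv.sumArrowEquivProdArrow _ _ _))))
  rw [← e.symm.sum_comp, Fintype.sum_prod_type]
  refine sum_congr rfl fun v _ => ?_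
  rw [Fintype.sum_prod_type]
  refine sum_congr rfl fun a _ => ?_
  rw [Fintype.sum_prod_type]
  refine sum_congr rfl fun b _ => sum_congr rfl fun c _ => ?_
  have : e.symm (v, a, b, c) = Sum.elim (fun _ => v) (Sum.elim a (Sum.elim b c)) := by
    rw [Equiv.symm_apply_eq]; rfl
  rw [this]
  simp only [Sum.elim_inl, Sum.elim_inr, auxBad]
  by_cases p : auxE H v a b <;> by_cases q : auxE H v a c <;>
    by_cases r : auxE H v b c <;> simp [p, q, r]

lemma aux_main_s10 {n k : ℕ} (hk : 1 ≤ k) (hn : 0 < n) (H : Finset (Finset (Fin n)))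
    (hH : ∀ e ∈ H, e.card = 2 * k + 1) (hF : ¬ HasCopy H (suspend 1 (expTriangle k))) :
    2 * ((H.card : ℝ) * (2 * k + 1).factorial) * ((3 * k + 2) ^ (3 * k + 1) : ℕ) ≤
      (n : ℝ) ^ (2 * k + 1) * (((3 * k + 2) ^ (3 * k + 1) : ℕ) - 1) := by
  have g := aux_goodman (fun (v : Fin n) (a b : Fin k → Fin n) =>
    (if auxE H v a b then 1 else 0 : ℝ)) (by
      intro v a b
      have : auxE H v a b ↔ auxE H v b a := by simp only [auxE, union_comm]
      simp only [this]) (by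
      intro v a b c
      by_contra hne
      have hh : auxE H v a b ∧ auxE H v a c ∧ auxE H v b c := by
        by_cases p : auxE H v a b <;> by_cases q : auxE H v a c <;>
          by_cases r : auxE H v b c <;> simp [p, q, r] at hne ⊢
      exact hF (aux_copy hH hh.1 hh.2.1 hh.2.2))
  rw [← aux_NE_sum, ← aux_NT_sum] at g
  simp only [Fintype.card_fin, Fintype.card_fun] at g
  have h1 := aux_NE_le hk hn H hH hF
  have h2 := aux_NE_ge H hH
  generalize auxNE (k := k) H = E at *
  generalize auxNT (k := k) H = T at *
  have hK : 1 ≤ (3 * k + 2) ^ (3 * k + 1) := Nat.one_le_pow _ _ (by omega)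
  generalize (3 * k + 2) ^ (3 * k + 1) = K at *
  have h1' : (E : ℝ) * (n : ℝ) ^ k ≤ K * T := by exact_mod_cast h1
  have h2' : (H.card : ℝ) * (2 * k + 1).factorial ≤ E := by exact_mod_cast h2
  have hK' : (1 : ℝ) ≤ K := by exact_mod_cast hK
  have hn' : (0 : ℝ) < n := by exact_mod_cast hn
  push_cast at g
  have hE0 : (0 : ℝ) ≤ E := by positivity
  have hfin : 2 * (E : ℝ) * K ≤ (n : ℝ) ^ (2 * k + 1) * (K - 1) := by
    rcases hE0.eq_or_lt with h0 | h0
    · rw [← h0]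
      have : (0 : ℝ) ≤ K - 1 := by linarith
      simp only [mul_zero, zero_mul]; positivity
    · have hM : (0 : ℝ) < (n : ℝ) ^ k := by positivity
      have hp : (n : ℝ) ^ (2 * k + 1) = n * (n : ℝ) ^ k * (n : ℝ) ^ k := by ring
      rw [hp]
      generalize (n : ℝ) ^ k = M at *
      have s1 := mul_le_mul_of_nonneg_right g (by positivity : (0 : ℝ) ≤ K)
      have s2 := mul_le_mul_of_nonneg_left h1' (by positivity : (0 : ℝ) ≤ n * M)
      have s3 : (2 * (E : ℝ) * K) * E ≤ (n * M * M * (K - 1)) * E := by nlinarith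
      exact le_of_mul_le_mul_right s3 h0
  refine le_trans ?_ hfin
  gcongr

lemma aux_exNum_succ (r n : ℕ) (hr : r ≤ n) {m : ℕ} (F : Finset (Finset (Fin m))) :
    exNum r (n + 1) F * (n + 1 - r) ≤ (n + 1) * exNum r n F := by
  classical
  have key : ∀ H : Finset (Finset (Fin (n + 1))), (∀ e ∈ H, e.card = r) → ¬ HasCopy H F →
      H.card * (n + 1 - r) ≤ (n + 1) * exNum r n F := by
    intro H hH hF
    have hv : ∀ v : Fin (n + 1), (H.filter fun e => v ∉ e).card ≤ exNum r n F := by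
      intro v
      let H' : Finset (Finset (Fin n)) := univ.filter fun e => e.map v.succAboveEmb ∈ H
      have hle : H'.card ≤ exNum r n F := by
        unfold exNum
        refine le_sup (f := Finset.card) ?_
        simp only [mem_filter, mem_univ, true_and]
        refine ⟨fun e he => ?_, fun ⟨φ, hφ, hc⟩ => hF ⟨fun x => v.succAbove (φ x), ?_, ?_⟩⟩
        · have := hH _ (mem_filter.1 he).2
          rwa [card_map] at this
        · intro x hx y hy hxy
          exact hφ hx hy (Fin.succAbove_right_injective hxy)
        · intro e he
          have := (mem_filter.1 (hc e he)).2
          rw [map_eq_image, image_image] at this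
          exact this
      refine le_trans ?_ hle
      have hsub : (H.filter fun e => v ∉ e) ⊆
          H'.image (fun e => e.map v.succAboveEmb) := by
        intro e he
        rw [mem_filter] at he
        have heq : (univ.filter fun x => v.succAbove x ∈ e).map v.succAboveEmb = e := by
          ext w
          simp only [Finset.mem_map, mem_filter, mem_univ, true_and]
          constructor
          · rintro ⟨x, hx, rfl⟩; exact hx
          · intro hw
            obtain ⟨x, hx⟩ := Fin.exists_succAbove_eq (x := w) (y := v)
              (by rintro rfl; exact he.2 hw)
            exact ⟨x, by rwa [hx], hx⟩
        refine mem_image.2 ⟨_, ?_, heq⟩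
        simp only [H', mem_filter, mem_univ, true_and]
        rw [heq]; exact he.1
      exact (card_le_card hsub).trans card_image_le
    have hsum : ∑ v : Fin (n + 1), (H.filter fun e => v ∉ e).card = H.card * (n + 1 - r) := by
      simp only [card_filter]
      rw [sum_comm, ← smul_eq_mul, ← sum_const]
      refine sum_congr rfl fun e he => ?_
      rw [← card_filter, filter_not, ← compl_eq_univ_sdiff]
      simp [card_compl, hH e he]
    rw [← hsum]
    refine (sum_le_card_nsmul _ _ _ fun v _ => hv v).trans ?_
    simp
  rcases (((Finset.univ : Finset (Finset (Finset (Fin (n + 1))))).filter fun H =>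
    (∀ e ∈ H, e.card = r) ∧ ¬ HasCopy H F)).eq_empty_or_nonempty with h | h
  · have : exNum r (n + 1) F = 0 := by
      unfold exNum; rw [h]; rfl
    rw [this]; simp
  · obtain ⟨H, hH, hc⟩ := exists_mem_eq_sup _ h Finset.card
    have : exNum r (n + 1) F = H.card := hc
    rw [this]
    simp only [mem_filter, mem_univ, true_and] at hH
    exact key H hH.1 hH.2

lemma aux_le_of_lim (r : ℕ) {m : ℕ} (F : Finset (Finset (Fin m))) (n : ℕ) (hn : r ≤ n) :
    turanDensity r F ≤ (exNum r n F : ℝ) / (n.choose r : ℝ) := by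
  let u : ℕ → ℝ := fun n => (exNum r n F : ℝ) / (n.choose r : ℝ)
  have hanti : Antitone (fun n => u (n + r)) := by
    refine antitone_nat_of_succ_le fun j => ?_
    have hr : r ≤ j + r := Nat.le_add_left _ _
    have h1 := aux_exNum_succ r (j + r) hr F
    have h2 := Nat.choose_mul_succ_eq (j + r) r
    have e : j + 1 + r = j + r + 1 := by omega
    simp only [u, e]
    have p1 : 0 < (j + r).choose r := Nat.choose_pos hr
    have p2 : 0 < (j + r + 1).choose r := Nat.choose_pos (by omega)
    rw [div_le_div_iff₀ (by exact_mod_cast p2) (by exact_mod_cast p1)]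
    norm_cast
    have p3 : 0 < (j + r + 1 - r) := by omega
    refine Nat.le_of_mul_le_mul_right ?_ p3
    calc exNum r (j + r + 1) F * (j + r).choose r * (j + r + 1 - r)
        = (exNum r (j + r + 1) F * (j + r + 1 - r)) * (j + r).choose r := by ring
      _ ≤ ((j + r + 1) * exNum r (j + r) F) * (j + r).choose r := Nat.mul_le_mul_right _ h1
      _ = exNum r (j + r) F * ((j + r).choose r * (j + r + 1)) := by ring
      _ = exNum r (j + r) F * (j + r + 1).choose r * (j + r + 1 - r) := by rw [h2]; ring
  have hb : BddBelow (Set.range (fun n => u (n + r))) :=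
    ⟨0, by rintro _ ⟨j, rfl⟩; simp only [u]; positivity⟩
  have ht := tendsto_atTop_ciInf hanti hb
  have ht' := (tendsto_add_atTop_iff_nat (f := u) r).1 ht
  have : turanDensity r F = ⨅ i, u (i + r) := ht'.limUnder_eq
  rw [this]
  have := ciInf_le hb (n - r)
  rwa [Nat.sub_add_cancel hn] at this

lemma aux_exists_n (r K : ℕ) (hr : 1 ≤ r) (hK : 1 ≤ K) : ∃ n : ℕ, r ≤ n ∧ 0 < n ∧
    (n : ℝ) ^ r * ((K : ℝ) - 1) < K * n.descFactorial r := by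
  refine ⟨r * r * K + r, by omega, by omega, ?_⟩
  set n := r * r * K + r with hn
  have hrn : r ≤ n := by omega
  have h1 : (n + 1 - r) ^ r ≤ n.descFactorial r := Nat.pow_sub_le_descFactorial n r
  have h2 : ((n : ℝ) - r) ^ r ≤ n.descFactorial r := by
    have : (n - r) ^ r ≤ n.descFactorial r := le_trans (Nat.pow_le_pow_left (by omega) _) h1
    rw [← Nat.cast_sub hrn]
    exact_mod_cast this
  have hn0 : (0 : ℝ) < n := by exact_mod_cast (by omega : 0 < n)
  have hr0 : (1 : ℝ) ≤ r := by exact_mod_cast hr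
  have hK0 : (1 : ℝ) ≤ K := by exact_mod_cast hK
  have hrn' : (r : ℝ) ≤ n := by exact_mod_cast hrn
  have hx : (r : ℝ) / n ≤ 1 := (div_le_one hn0).2 hrn'
  have hb := one_add_mul_le_pow (a := -((r : ℝ) / n)) (by linarith) r
  have he : ((n : ℝ) - r) ^ r = (n : ℝ) ^ r * (1 + -((r : ℝ) / n)) ^ r := by
    rw [← mul_pow]; congr 1; field_simp; ring
  have hlt : (r : ℝ) * (r / n) * K < 1 := by
    have : (r : ℝ) * (r / n) * K = (r * r * K) / n := by ring
    rw [this, div_lt_one hn0, hn]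
    push_cast; linarith
  have hp : (0 : ℝ) < (n : ℝ) ^ r := by positivity
  calc (n : ℝ) ^ r * ((K : ℝ) - 1) < (n : ℝ) ^ r * (K * (1 + r * -((r : ℝ) / n))) := by
        apply mul_lt_mul_of_pos_left _ hp
        linarith
    _ = K * ((n : ℝ) ^ r * (1 + r * -((r : ℝ) / n))) := by ring
    _ ≤ K * ((n : ℝ) ^ r * (1 + -((r : ℝ) / n)) ^ r) := by gcongr
    _ = K * ((n : ℝ) - r) ^ r := by rw [he]
    _ ≤ K * n.descFactorial r := by gcongr

end Aux

/-- For every `k ≥ 1`, the Turán density of the `(2k+1)`-suspension of the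
expanded triangle `T_{2k}` is strictly less than `1/2`. -/
theorem susp_expTriangle_lt_half (k : ℕ) (hk : 1 ≤ k) :
    turanDensity (2 * k + 1) (suspend 1 (expTriangle k)) < 1 / 2 := by
  classical
  have hK : 1 ≤ (3 * k + 2) ^ (3 * k + 1) := Nat.one_le_pow _ _ (by omega)
  obtain ⟨n, hrn, hn, hlt⟩ := aux_exists_n (2 * k + 1) ((3 * k + 2) ^ (3 * k + 1)) (by omega) hK
  refine lt_of_le_of_lt (aux_le_of_lim _ _ n hrn) ?_
  have hpos : 0 < n.choose (2 * k + 1) := Nat.choose_pos hrn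
  have hpos' : (0 : ℝ) < n.choose (2 * k + 1) := by exact_mod_cast hpos
  rw [div_lt_iff₀ hpos']
  have key : ∀ H : Finset (Finset (Fin n)), (∀ e ∈ H, e.card = 2 * k + 1) →
      ¬ HasCopy H (suspend 1 (expTriangle k)) →
      (H.card : ℝ) < 1 / 2 * n.choose (2 * k + 1) := by
    intro H hH hF
    have h := (aux_main_s10 hk hn H hH hF).trans_lt hlt
    rw [Nat.descFactorial_eq_factorial_mul_choose] at h
    generalize (3 * k + 2) ^ (3 * k + 1) = K at *
    have hK' : (0 : ℝ) < K := by exact_mod_cast hK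
    have hf : (0 : ℝ) < (2 * k + 1).factorial := by exact_mod_cast Nat.factorial_pos _
    push_cast at h
    have h' : (2 * (H.card : ℝ)) * ((2 * k + 1).factorial * K) <
        n.choose (2 * k + 1) * ((2 * k + 1).factorial * K) := by linarith
    have := lt_of_mul_lt_mul_right h' (by positivity)
    linarith
  rcases (((Finset.univ : Finset (Finset (Finset (Fin n)))).filter fun H =>
    (∀ e ∈ H, e.card = 2 * k + 1) ∧
      ¬ HasCopy H (suspend 1 (expTriangle k)))).eq_empty_or_nonempty with h | h
  · have : exNum (2 * k + 1) n (suspend 1 (expTriangle k)) = 0 := by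
      unfold exNum; rw [h]; rfl
    rw [this]; push_cast; positivity
  · obtain ⟨H, hH, hc⟩ := Finset.exists_mem_eq_sup _ h Finset.card
    have : exNum (2 * k + 1) n (suspend 1 (expTriangle k)) = H.card := hc
    rw [this]
    simp only [Finset.mem_filter, Finset.mem_univ, true_and] at hH
    exact key H hH.1 hH.2
end
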